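/- Generalized Cherednik–Macdonald identity for Σ of type C_n, case (ii): let n ≥ 2, ω₊,ω₋ ∈ ℂ₊ with Im(ω₊ω₋) < 0, and k_s, k_l ∈ ℂ₋ ∩ ω₊ω₋ℂ₊. Then ∫_{ℝⁿ} ∏_{α∈R_s} G(ω₊,ω₋/2; ⟨α,v⟩+i(ω₊/2+ω₋/4)) / G(ω₊,ω₋/2; ⟨α,v⟩+i(k_l+ω₊/2+ω₋/4)) · ∏_{β∈R_l} G(ω₊,ω₋;⟨β,v⟩+iω) / G(ω₊,ω₋;⟨β,v⟩+i(k_s+ω)) d′v converges absolutely and equals N_BC(ω₊,ω₋; γ = (k_l, k_l−ω₋/2, −ω₊/2, −ω), κ = k_s). -/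

import Mathlib

open MeasureTheory Set
open scoped BigOperators Classical

noncomputable section

/-- Ruijsenaars' hyperbolic gamma function `G(ω₊,ω₋;z)`, defined by the integral
representation, valid on the strip `|Im z| < Re((ω₊+ω₋)/2)`. -/
def hypGammaInt (op om z : ℂ) : ℂ :=
  Complex.exp (Complex.I * ∫ y in Set.Ioi (0:ℝ),
    (1/(y:ℂ)) * (Complex.sin (2*(y:ℂ)*z) /
        (2 * Complex.sinh (op*(y:ℂ)) * Complex.sinh (om*(y:ℂ)))
      - z/(op*om*(y:ℂ))))

/-- The locus `-iω - Λ` (with `ω = (ω₊+ω₋)/2`, `Λ = ℤ≥0·iω₊ + ℤ≥0·iω₋`) containing the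
poles of the hyperbolic gamma function; off this set the meromorphic extension is defined. -/
def hypGammaPoles (op om : ℂ) : Set ℂ :=
  {z | ∃ m n : ℕ, z = -Complex.I*(op+om)/2 - (m:ℂ)*Complex.I*op - (n:ℂ)*Complex.I*om}

/-- Predicate expressing that `G : ℂ → ℂ` is the meromorphic extension in `z` of
Ruijsenaars' hyperbolic gamma function with quasi-periods `ω₊ = op`, `ω₋ = om`:
it agrees with the integral representation on the strip `|Im z| < Re((ω₊+ω₋)/2)`,
satisfies both functional equations (away from the zeros of the `cosh` factor, where
the two sides have poles), and is continuous away from the pole locus. -/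
structure IsHypGamma (op om : ℂ) (G : ℂ → ℂ) : Prop where
  strip : ∀ z : ℂ, |z.im| < ((op+om)/2).re → G z = hypGammaInt op om z
  funEqm : ∀ z : ℂ, Complex.cosh (Real.pi * z / op) ≠ 0 →
    G (z + Complex.I * om/2) = 2 * Complex.cosh (Real.pi * z / op) * G (z - Complex.I * om/2)
  funEqp : ∀ z : ℂ, Complex.cosh (Real.pi * z / om) ≠ 0 →
    G (z + Complex.I * op/2) = 2 * Complex.cosh (Real.pi * z / om) * G (z - Complex.I * op/2)
  cont : ContinuousOn G (hypGammaPoles op om)ᶜ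

/-- `∏_{α ∈ R_s} f(⟨α,v⟩)` where `R_s = {±ε_j}_{j=1}^n`. -/
def bcShort {n : ℕ} (f : ℝ → ℂ) (v : Fin n → ℝ) : ℂ :=
  ∏ j : Fin n, (f (v j) * f (-v j))

/-- `∏_{β ∈ R_l} f(⟨β,v⟩)` where `R_l = {±(ε_r ± ε_s)}_{1 ≤ r < s ≤ n}` (empty for `n = 1`). -/
def bcLong {n : ℕ} (f : ℝ → ℂ) (v : Fin n → ℝ) : ℂ :=
  ∏ p ∈ Finset.univ.filter (fun p : Fin n × Fin n => p.1 < p.2),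
    (f (v p.1 + v p.2) * f (-(v p.1 + v p.2)) * f (v p.1 - v p.2) * f (v p.2 - v p.1))

/-- The evaluation `N_BC` of the hyperbolic `BC_n` (Koornwinder-type) integral. -/
def NBC (G : ℂ → ℂ → ℂ → ℂ) (n : ℕ) (op om : ℂ) (γ : Fin 4 → ℂ) (κ : ℂ) : ℂ :=
  2^n * (Nat.factorial n : ℂ) * ((op*om) ^ ((1:ℂ)/2))^n *
    ∏ j ∈ Finset.range n,
      (G op om (Complex.I*((op+om)/2 + κ)) *
          G op om (Complex.I*((op+om)/2 + (2*(n:ℂ) - (j:ℂ) - 2)*κ + (γ 0 + γ 1 + γ 2 + γ 3)))) /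
        (G op om (Complex.I*((op+om)/2 + ((j:ℂ)+1)*κ)) *
          ∏ p ∈ Finset.univ.filter (fun p : Fin 4 × Fin 4 => p.1 < p.2),
            G op om (Complex.I*((op+om)/2 + (j:ℂ)*κ + γ p.1 + γ p.2)))

/-- Membership in the parameter space `𝒮_BC`. -/
def inSBC (op om : ℂ) (γ : Fin 4 → ℂ) (κ : ℂ) : Prop :=
  0 < op.re ∧ 0 < om.re ∧ (op*om).im < 0 ∧ (∀ r, (γ r).re < 0) ∧
    (∃ w : ℂ, 0 < w.re ∧ op + om + (γ 0 + γ 1 + γ 2 + γ 3) = op*om*w) ∧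
    κ.re < 0 ∧ ∃ w : ℂ, 0 < w.re ∧ κ = op*om*w

section

open Filter Topology

theorem differentiableAt_integral_of_local_bound {α : Type*} [MeasurableSpace α] {μ : Measure α}
    {f : ℂ → α → ℂ} {z₀ : ℂ} {r : ℝ} (hr : 0 < r) {bound : α → ℝ}
    (hmeas : ∀ z ∈ Metric.ball z₀ r, AEStronglyMeasurable (f z) μ)
    (hbound : ∀ᵐ a ∂μ, ∀ z ∈ Metric.ball z₀ r, ‖f z a‖ ≤ bound a)
    (hint : Integrable bound μ)
    (hdiff : ∀ᵐ a ∂μ, DifferentiableOn ℂ (fun z => f z a) (Metric.ball z₀ r)) :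
    DifferentiableAt ℂ (fun z => ∫ a, f z a ∂μ) z₀ := by
  have h0 : z₀ ∈ Metric.ball z₀ r := Metric.mem_ball_self hr
  have hder : ∀ᵐ a ∂μ, ∀ z ∈ Metric.ball z₀ (r/2),
      HasDerivAt (fun z => f z a) (deriv (fun z => f z a) z) z := by
    filter_upwards [hdiff] with a ha z hz
    exact (ha.differentiableAt (Metric.isOpen_ball.mem_nhds
      (Metric.ball_subset_ball (by linarith) hz))).hasDerivAt
  have hF'm : AEStronglyMeasurable (fun a => deriv (fun z => f z a) z₀) μ := by
    have hu : Tendsto (fun n : ℕ => ((r/2/(n+1) : ℝ) : ℂ)) atTop (𝓝[≠] 0) := by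
      rw [tendsto_nhdsWithin_iff]
      constructor
      · have : Tendsto (fun n : ℕ => (r/2/(n+1) : ℝ)) atTop (𝓝 0) :=
          tendsto_const_div_atTop_nhds_zero_nat (r/2) |>.comp (tendsto_add_atTop_nat 1) |>.congr
            (fun n => by simp)
        exact_mod_cast (Complex.continuous_ofReal.tendsto 0).comp this
      · refine Eventually.of_forall fun n => ?_
        have : (r/2/(n+1) : ℝ) ≠ 0 := by positivity
        simpa only [mem_compl_iff, mem_singleton_iff, Complex.ofReal_eq_zero] using this
    refine aestronglyMeasurable_of_tendsto_ae atTop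
      (f := fun (n : ℕ) a => (((r/2/(n+1) : ℝ) : ℂ))⁻¹ • (f (z₀ + ((r/2/(n+1) : ℝ) : ℂ)) a - f z₀ a))
      (fun n => ?_) ?_
    · refine AEStronglyMeasurable.fun_const_smul ((hmeas _ ?_).sub (hmeas _ h0)) _
      rw [Metric.mem_ball, dist_eq_norm, add_sub_cancel_left, Complex.norm_real,
        Real.norm_of_nonneg (by positivity)]
      have : r/2/((n:ℝ)+1) ≤ r/2 := div_le_self (by positivity) (by linarith [n.cast_nonneg (α := ℝ)])
      linarith
    · filter_upwards [hder] with a ha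
      exact (hasDerivAt_iff_tendsto_slope_zero.mp (ha z₀ (Metric.mem_ball_self (by positivity)))).comp hu
  refine (hasDerivAt_integral_of_dominated_loc_of_deriv_le (μ := μ) (F := f)
    (F' := fun z a => deriv (fun z => f z a) z) (bound := fun a => bound a / (r/4))
    (Metric.ball_mem_nhds z₀ (half_pos hr)) ?_ ?_ hF'm ?_ (hint.div_const _) hder).2.differentiableAt
  · filter_upwards [Metric.ball_mem_nhds z₀ hr] with z hz using hmeas z hz
  · refine hint.mono' (hmeas _ h0) ?_
    filter_upwards [hbound] with a ha using ha _ h0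
  · filter_upwards [hbound, hdiff] with a ha hd z hz
    have hsub : Metric.closedBall z (r/4) ⊆ Metric.ball z₀ r := by
      intro w hw
      rw [Metric.mem_ball] at *
      linarith [dist_triangle w z z₀, Metric.mem_closedBall.mp hw]
    refine Complex.norm_deriv_le_of_forall_mem_sphere_norm_le (R := r/4) (by positivity) ?_ ?_
    · exact (hd.mono hsub).diffContOnCl_ball subset_rfl
    · exact fun w hw => ha w (hsub (Metric.sphere_subset_closedBall hw))

/-- A holomorphic function on a convex open set containing a closed period parallelogram of two
`ℝ`-independent periods is constant. -/
theorem eqOn_const_of_two_periods {V : Set ℂ} (hV : IsOpen V) (hVc : Convex ℝ V) {f : ℂ → ℂ}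
    (hf : DifferentiableOn ℂ f V) {w₁ w₂ : ℂ} (hw : (w₁ * starRingEnd ℂ w₂).im ≠ 0)
    (hsub : ∀ s t : ℝ, |s| ≤ 1/2 → |t| ≤ 1/2 → (s:ℂ) * w₁ + (t:ℂ) * w₂ ∈ V)
    (h₁ : ∀ z ∈ V, z + w₁ ∈ V → f (z + w₁) = f z)
    (h₂ : ∀ z ∈ V, z + w₂ ∈ V → f (z + w₂) = f z) : ∀ z ∈ V, f z = f 0 := by
  set P : ℝ × ℝ → ℂ := fun p => (p.1:ℂ) * w₁ + (p.2:ℂ) * w₂ with hP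
  have hPc : Continuous P := by fun_prop
  set S : Set (ℝ × ℝ) := Icc (-(1/2)) (1/2) ×ˢ Icc (-(1/2)) (1/2) with hS
  have hSc : IsCompact S := isCompact_Icc.prod isCompact_Icc
  have hPS : ∀ p ∈ S, P p ∈ V := fun p hp =>
    hsub _ _ (abs_le.mpr ⟨hp.1.1, hp.1.2⟩) (abs_le.mpr ⟨hp.2.1, hp.2.2⟩)
  set T : Set ℂ := P '' S with hT
  have hTc : IsCompact T := hSc.image hPc
  have hTV : T ⊆ V := by rintro _ ⟨p, hp, rfl⟩; exact hPS p hp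
  have hne : S.Nonempty := ⟨(0,0), by simp [hS]⟩
  obtain ⟨c, hcT, hc⟩ := hTc.exists_isMaxOn (hne.image _) (hf.continuousOn.mono hTV).norm
  set D : ℝ := (w₁ * starRingEnd ℂ w₂).im with hD
  set cs : ℂ → ℝ := fun z => (z * starRingEnd ℂ w₂).im / D with hcs
  set ct : ℂ → ℝ := fun z => -(z * starRingEnd ℂ w₁).im / D with hct
  have hcoord : ∀ z : ℂ, P (cs z, ct z) = z := by
    intro z
    apply Complex.ext <;> simp [hP, hcs, hct] <;> field_simp <;> simp [hD] <;> ring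
  have hcs' : ∀ s t : ℝ, cs (P (s, t)) = s := by
    intro s t
    simp only [hP, hcs]
    rw [div_eq_iff hw]
    simp [hD]; ring
  have hct' : ∀ s t : ℝ, ct (P (s, t)) = t := by
    intro s t
    simp only [hP, hct]
    rw [div_eq_iff hw]
    simp [hD]; ring
  have hcsc : Continuous cs := by fun_prop
  have hctc : Continuous ct := by fun_prop
  obtain ⟨δ, hδ, hthick⟩ := hSc.exists_thickening_subset_open (hV.preimage hPc) hPS
  set e : ℝ := min (δ/2) (1/2) with he
  have he0 : 0 < e := by positivity
  have heδ : e < δ := (min_le_left _ _).trans_lt (by linarith)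
  have he1 : e ≤ 1/2 := min_le_right _ _
  have hPV : ∀ s t : ℝ, |s| < 1/2 + e → |t| < 1/2 + e → P (s, t) ∈ V := by
    intro s t hs ht
    apply hthick
    rw [Metric.mem_thickening_iff]
    have key : ∀ x : ℝ, |x| < 1/2 + e → ∃ y ∈ Icc (-(1/2):ℝ) (1/2), |x - y| < δ := by
      intro x hx
      rw [abs_lt] at hx
      by_cases h : 1/2 < x
      · exact ⟨1/2, ⟨by norm_num, le_rfl⟩, abs_lt.mpr ⟨by linarith, by linarith⟩⟩
      by_cases h' : x < -(1/2)
      · exact ⟨-(1/2), ⟨le_rfl, by norm_num⟩, abs_lt.mpr ⟨by linarith, by linarith⟩⟩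
      exact ⟨x, ⟨by linarith, by linarith⟩, by simpa using hδ⟩
    obtain ⟨s', hs', hs''⟩ := key s hs
    obtain ⟨t', ht', ht''⟩ := key t ht
    exact ⟨(s', t'), ⟨hs', ht'⟩, by rw [Prod.dist_eq, max_lt_iff]; exact ⟨hs'', ht''⟩⟩
  have red : ∀ w : ℂ, (∀ z ∈ V, z + w ∈ V → f (z + w) = f z) →
      ∀ z ∈ V, z - w ∈ V → f z = f (z - w) := by
    intro w hw z hz hz'
    have := hw (z - w) hz' (by simpa using hz)
    simpa using this
  have hbd2 : ∀ s t : ℝ, |s| ≤ 1/2 → |t| < 1/2 + e → ‖f (P (s, t))‖ ≤ ‖f c‖ := by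
    intro s t hs ht
    have hV0 := hPV s t (by linarith) ht
    have hT' : ∀ t', |t'| ≤ 1/2 → ‖f (P (s, t'))‖ ≤ ‖f c‖ := fun t' ht' =>
      hc ⟨(s, t'), ⟨⟨(abs_le.mp hs).1, (abs_le.mp hs).2⟩, (abs_le.mp ht').1, (abs_le.mp ht').2⟩, rfl⟩
    rw [abs_lt] at ht
    by_cases h1 : 1/2 < t
    · have hh : |t - 1| ≤ 1/2 := abs_le.mpr ⟨by linarith, by linarith⟩
      have e1 : P (s, t) - w₂ = P (s, t - 1) := by simp [hP]; ring
      rw [red w₂ h₂ _ hV0 (e1 ▸ hPV s (t-1) (by linarith) (by linarith)), e1]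
      exact hT' _ hh
    by_cases h2 : t < -(1/2)
    · have hh : |t + 1| ≤ 1/2 := abs_le.mpr ⟨by linarith, by linarith⟩
      have e1 : P (s, t) + w₂ = P (s, t + 1) := by simp [hP]; ring
      rw [← h₂ _ hV0 (e1 ▸ hPV s (t+1) (by linarith) (by linarith)), e1]
      exact hT' _ hh
    exact hT' t (abs_le.mpr ⟨by linarith, by linarith⟩)
  have hbd : ∀ s t : ℝ, |s| < 1/2 + e → |t| < 1/2 + e → ‖f (P (s, t))‖ ≤ ‖f c‖ := by
    intro s t hs ht
    have hV0 := hPV s t hs ht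
    rw [abs_lt] at hs
    by_cases h1 : 1/2 < s
    · have hh : |s - 1| ≤ 1/2 := abs_le.mpr ⟨by linarith, by linarith⟩
      have e1 : P (s, t) - w₁ = P (s - 1, t) := by simp [hP]; ring
      rw [red w₁ h₁ _ hV0 (e1 ▸ hPV (s-1) t (by linarith) ht), e1]
      exact hbd2 _ _ hh ht
    by_cases h2 : s < -(1/2)
    · have hh : |s + 1| ≤ 1/2 := abs_le.mpr ⟨by linarith, by linarith⟩
      have e1 : P (s, t) + w₁ = P (s + 1, t) := by simp [hP]; ring
      rw [← h₁ _ hV0 (e1 ▸ hPV (s+1) t (by linarith) ht), e1]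
      exact hbd2 _ _ hh ht
    exact hbd2 s t (abs_le.mpr ⟨by linarith, by linarith⟩) ht
  have hcV : c ∈ V := hTV hcT
  have hloc : IsLocalMax (norm ∘ f) c := by
    obtain ⟨⟨s, t⟩, ⟨hs, ht⟩, rfl⟩ := hcT
    have o1 : IsOpen {z | |cs z| < 1/2 + e ∧ |ct z| < 1/2 + e} :=
      (isOpen_lt hcsc.abs continuous_const).inter (isOpen_lt hctc.abs continuous_const)
    have m1 : P (s, t) ∈ {z | |cs z| < 1/2 + e ∧ |ct z| < 1/2 + e} := by
      simp only [mem_ofPred_eq, hcs', hct']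
      have a1 : |s| ≤ 1/2 := abs_le.mpr ⟨hs.1, hs.2⟩
      have a2 : |t| ≤ 1/2 := abs_le.mpr ⟨ht.1, ht.2⟩
      constructor <;> linarith
    filter_upwards [o1.mem_nhds m1] with z hz
    have := hbd _ _ hz.1 hz.2
    rwa [hcoord z] at this
  have hev := Complex.eventually_eq_of_isLocalMax_norm (hf.eventually_differentiableAt (hV.mem_nhds hcV)) hloc
  have hconst : EqOn f (fun _ => f c) V :=
    (hf.analyticOnNhd hV).eqOn_of_preconnected_of_eventuallyEq
      (analyticOnNhd_const) hVc.isPreconnected hcV hev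
  have h0V : (0:ℂ) ∈ V := by simpa using hsub 0 0 (by norm_num) (by norm_num)
  intro z hz
  rw [hconst hz, hconst h0V]

/-- `∏_{i<j} f(uᵢ,uⱼ)`. -/
def pairProd {R S : Type*} [CommMonoid S] {n : ℕ} (f : R → R → S) (u : Fin n → R) : S :=
  ∏ i, ∏ j ∈ Finset.Ioi i, f (u i) (u j)

theorem pairProd_cons {R S : Type*} [CommMonoid S] {n : ℕ} (f : R → R → S) (z : R) (u : Fin n → R) :
    pairProd f (Fin.cons z u : Fin (n+1) → R) = (∏ j, f z (u j)) * pairProd f u := by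
  simp only [pairProd, Fin.prod_univ_succ, Fin.prod_Ioi_zero, Fin.prod_Ioi_succ, Fin.cons_zero,
    Fin.cons_succ]

theorem pairProd_congr {R S R' : Type*} [CommMonoid S] {n : ℕ} {f : R → R → S} {g : R' → R' → S}
    {u : Fin n → R} {w : Fin n → R'} (h : ∀ i j, f (u i) (u j) = g (w i) (w j)) :
    pairProd f u = pairProd g w :=
  Finset.prod_congr rfl fun i _ => Finset.prod_congr rfl fun j _ => h i j

theorem pairProd_mul {R S : Type*} [CommMonoid S] {n : ℕ} (f g : R → R → S) (u : Fin n → R) :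
    pairProd (fun x y => f x y * g x y) u = pairProd f u * pairProd g u := by
  simp only [pairProd, Finset.prod_mul_distrib]

theorem pairProd_comp_perm {R : Type*} {n : ℕ} (f : R → R → ℂ) (hf : ∀ x y, f x y = -f y x)
    (u : Fin n → R) (τ : Equiv.Perm (Fin n)) :
    pairProd f (u ∘ τ) = (Equiv.Perm.sign τ : ℂ) * pairProd f u :=
  τ.prod_Ioi_comp_eq_sign_mul_prod (f := fun i j => f (u i) (u j)) (fun _ _ => hf _ _)

/-- `x ↦ 2 sinh x`. -/
def ssinh (x : ℂ) : ℂ := Complex.exp x - Complex.exp (-x)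

theorem ssinh_neg (x : ℂ) : ssinh (-x) = -ssinh x := by simp [ssinh]

theorem ssinh_neg_mul_neg (x y : ℂ) : ssinh (-x) * ssinh (-y) = ssinh x * ssinh y := by
  rw [ssinh_neg, ssinh_neg]; ring

theorem ssinh_zero : ssinh 0 = 0 := by simp [ssinh]

theorem ssinh_add_pi_I (x : ℂ) : ssinh (x + Real.pi * Complex.I) = -ssinh x := by
  simp [ssinh, Complex.exp_add, Complex.exp_neg]; ring

theorem ssinh_eq (x : ℂ) : ssinh x = 2 * Complex.sinh x := by
  rw [ssinh, Complex.sinh]; ring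

/-- Action of sign vectors. -/
def sgnAct {n : ℕ} (σ : Fin n → ℤˣ) (v : Fin n → ℂ) : Fin n → ℂ := fun i => ((σ i : ℤ) : ℂ) * v i

/-- The character `∏ σᵢ` of sign vectors. -/
def sgnChar {n : ℕ} (σ : Fin n → ℤˣ) : ℂ := ∏ i, ((σ i : ℤ) : ℂ)

theorem sgnChar_mul {n : ℕ} (σ τ : Fin n → ℤˣ) : sgnChar (σ * τ) = sgnChar σ * sgnChar τ := by
  simp [sgnChar, Finset.prod_mul_distrib]

theorem sgnAct_mul {n : ℕ} (σ τ : Fin n → ℤˣ) (v : Fin n → ℂ) :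
    sgnAct (σ * τ) v = sgnAct σ (sgnAct τ v) := by
  funext i; simp [sgnAct, mul_assoc]

theorem sgn_mul_self {n : ℕ} (σ : Fin n → ℤˣ) : σ * σ = 1 := by
  funext i; exact Int.units_mul_self _

theorem sum_sgn_cons {n : ℕ} (f : (Fin (n+1) → ℤˣ) → ℂ) :
    ∑ σ, f σ = ∑ σ : Fin n → ℤˣ, (f (Fin.cons 1 σ) + f (Fin.cons (-1) σ)) := by
  rw [← (Fin.consEquiv (fun _ : Fin (n+1) => ℤˣ)).sum_comp, Fintype.sum_prod_type_right]
  refine Finset.sum_congr rfl fun σ _ => ?_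
  rw [UnitsInt.univ, Finset.sum_pair (by decide)]
  rfl

/-- The summand of the sign-symmetrisation identity. -/
def symTerm {n : ℕ} (a b t : ℂ) (u : Fin n → ℂ) : ℂ :=
  (∏ i, (ssinh (u i + a) * ssinh (u i + b))) *
    pairProd (fun x y => ssinh (x + y + t) * ssinh (x - y)) u

/-- The antisymmetrised sum. -/
def symSum {n : ℕ} (a b t : ℂ) (v : Fin n → ℂ) : ℂ :=
  ∑ σ : Fin n → ℤˣ, sgnChar σ * symTerm a b t (sgnAct σ v)

/-- The Weyl denominator of type `C`. -/
def weylDen {n : ℕ} (v : Fin n → ℂ) : ℂ :=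
  (∏ i, ssinh (2 * v i)) * pairProd (fun x y => ssinh (x + y) * ssinh (x - y)) v

theorem symTerm_cons {n : ℕ} (a b t z : ℂ) (u : Fin n → ℂ) :
    symTerm a b t (Fin.cons z u : Fin (n+1) → ℂ) = ssinh (z + a) * ssinh (z + b) *
      (∏ j, ssinh (z + u j + t) * ssinh (z - u j)) * symTerm a b t u := by
  simp only [symTerm, pairProd_cons, Fin.prod_univ_succ, Fin.cons_zero, Fin.cons_succ]
  ring

theorem weylDen_cons {n : ℕ} (z : ℂ) (u : Fin n → ℂ) :
    weylDen (Fin.cons z u : Fin (n+1) → ℂ) = ssinh (2 * z) *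
      (∏ j, ssinh (z + u j) * ssinh (z - u j)) * weylDen u := by
  simp only [weylDen, pairProd_cons, Fin.prod_univ_succ, Fin.cons_zero, Fin.cons_succ]
  ring

theorem symSum_sgnAct {n : ℕ} (a b t : ℂ) (τ : Fin n → ℤˣ) (v : Fin n → ℂ) :
    symSum a b t (sgnAct τ v) = sgnChar τ * symSum a b t v := by
  rw [symSum, symSum, ← Equiv.sum_comp (Equiv.mulRight τ), Finset.mul_sum]
  refine Finset.sum_congr rfl fun σ _ => ?_
  simp only [Equiv.coe_mulRight]
  rw [← sgnAct_mul, mul_assoc σ τ τ, sgn_mul_self, mul_one, sgnChar_mul]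
  ring

theorem symTerm_comp_perm {n : ℕ} (a b t : ℂ) (u : Fin n → ℂ) (τ : Equiv.Perm (Fin n)) :
    symTerm a b t (u ∘ τ) = (Equiv.Perm.sign τ : ℂ) * symTerm a b t u := by
  rw [symTerm, pairProd_comp_perm, symTerm]
  · have : ∏ i, (ssinh ((u ∘ τ) i + a) * ssinh ((u ∘ τ) i + b)) =
        ∏ i, (ssinh (u i + a) * ssinh (u i + b)) :=
      Equiv.prod_comp τ (fun i => ssinh (u i + a) * ssinh (u i + b))
    rw [this]; ring
  · intro x y
    rw [← neg_sub x y, ssinh_neg, add_comm y x]; ring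

theorem symSum_eq_zero_of_eq {n : ℕ} (a b t : ℂ) (v : Fin n → ℂ) {i j : Fin n} (hij : i ≠ j)
    (h : v i = v j) : symSum a b t v = 0 := by
  have key : symSum a b t v = -symSum a b t v := by
    conv_lhs => rw [symSum]
    rw [← (Equiv.arrowCongr (Equiv.swap i j) (Equiv.refl ℤˣ)).sum_comp, symSum,
      ← Finset.sum_neg_distrib]
    refine Finset.sum_congr rfl fun σ _ => ?_
    have e1 : (Equiv.arrowCongr (Equiv.swap i j) (Equiv.refl ℤˣ)) σ = σ ∘ Equiv.swap i j := by
      funext k; simp [Equiv.arrowCongr]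
    have e2 : sgnAct (σ ∘ Equiv.swap i j) v = sgnAct σ v ∘ Equiv.swap i j := by
      funext k
      have : v (Equiv.swap i j k) = v k := by
        rcases eq_or_ne k i with rfl | h1
        · simp [h]
        rcases eq_or_ne k j with rfl | h2
        · simp [h]
        rw [Equiv.swap_apply_of_ne_of_ne h1 h2]
      simp [sgnAct, this]
    have e3 : sgnChar (σ ∘ Equiv.swap i j) = sgnChar σ :=
      Equiv.prod_comp (Equiv.swap i j) (fun k => ((σ k : ℤ) : ℂ))
    rw [e1, e2, e3, symTerm_comp_perm, Equiv.Perm.sign_swap hij]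
    push_cast; ring
  linear_combination key / 2

/-- Flip of the sign at position `j`. -/
def sgnFlip {n : ℕ} (j : Fin n) : Fin n → ℤˣ := Function.update 1 j (-1)

theorem sgnChar_sgnFlip {n : ℕ} (j : Fin n) : sgnChar (sgnFlip j) = -1 := by
  rw [sgnChar, Finset.prod_eq_single j] <;> simp +contextual [sgnFlip, Function.update_of_ne]

theorem symSum_eq_zero_of_eq_neg {n : ℕ} (a b t : ℂ) (v : Fin n → ℂ) {i j : Fin n} (hij : i ≠ j)
    (h : v i = -v j) : symSum a b t v = 0 := by
  have h1 := symSum_sgnAct a b t (sgnFlip j) v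
  rw [symSum_eq_zero_of_eq a b t _ hij, sgnChar_sgnFlip] at h1
  · linear_combination h1
  · simp [sgnAct, sgnFlip, Function.update_of_ne hij, h]

theorem symSum_eq_zero_of_zero {n : ℕ} (a b t : ℂ) (v : Fin n → ℂ) {j : Fin n}
    (h : v j = 0) : symSum a b t v = 0 := by
  have h1 := symSum_sgnAct a b t (sgnFlip j) v
  have h2 : sgnAct (sgnFlip j) v = v := by
    funext k
    rcases eq_or_ne k j with rfl | hk <;> simp_all [sgnAct, sgnFlip, Function.update_of_ne]
  rw [h2, sgnChar_sgnFlip] at h1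
  linear_combination h1 / 2

theorem sgnAct_cons {n : ℕ} (e : ℤˣ) (σ : Fin n → ℤˣ) (z : ℂ) (y : Fin n → ℂ) :
    sgnAct (Fin.cons e σ : Fin (n+1) → ℤˣ) (Fin.cons z y) = Fin.cons (((e:ℤ):ℂ) * z) (sgnAct σ y) := by
  funext k
  refine Fin.cases ?_ (fun k => ?_) k <;> simp [sgnAct]

theorem symSum_cons {n : ℕ} (a b t z : ℂ) (y : Fin n → ℂ) :
    symSum a b t (Fin.cons z y : Fin (n+1) → ℂ) = ∑ σ : Fin n → ℤˣ,
      sgnChar σ * symTerm a b t (sgnAct σ y) *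
      (ssinh (z + a) * ssinh (z + b) * (∏ j, ssinh (z + sgnAct σ y j + t) * ssinh (z - sgnAct σ y j))
       - ssinh (z - a) * ssinh (z - b) *
        (∏ j, ssinh (z - sgnAct σ y j - t) * ssinh (z + sgnAct σ y j))) := by
  rw [symSum, sum_sgn_cons]
  refine Finset.sum_congr rfl fun σ _ => ?_
  have e1 : ∀ e : ℤˣ, sgnChar (Fin.cons e σ : Fin (n+1) → ℤˣ) = ((e:ℤ):ℂ) * sgnChar σ := by
    intro e; simp [sgnChar, Fin.prod_univ_succ]
  have e2 : ∏ j, ssinh (-z + sgnAct σ y j + t) * ssinh (-z - sgnAct σ y j) =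
      ∏ j, ssinh (z - sgnAct σ y j - t) * ssinh (z + sgnAct σ y j) := by
    refine Finset.prod_congr rfl fun j _ => ?_
    rw [← ssinh_neg_mul_neg]; congr 2 <;> ring
  have e3 : ssinh (-z + a) * ssinh (-z + b) = ssinh (z - a) * ssinh (z - b) := by
    rw [← ssinh_neg_mul_neg]; congr 2 <;> ring
  simp only [e1, sgnAct_cons, symTerm_cons]
  simp only [Units.val_one, Int.cast_one, one_mul, Units.val_neg, Int.cast_neg, neg_mul]
  rw [e2, e3]; ring

open Polynomial in
/-- Quadratic polynomial with value `e^{2z} ssinh(z+a) ssinh(z+b)` at `e^{2z}`. -/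
def quadPoly (a b : ℂ) : Polynomial ℂ :=
  (C (Complex.exp a) * X - C (Complex.exp (-a))) * (C (Complex.exp b) * X - C (Complex.exp (-b)))

theorem quadPoly_eval (a b z : ℂ) : (quadPoly a b).eval (Complex.exp (2*z)) =
    Complex.exp (2*z) * (ssinh (z + a) * ssinh (z + b)) := by
  have h : ∀ c, Complex.exp c * Complex.exp (2*z) - Complex.exp (-c) =
      Complex.exp z * ssinh (z + c) := by
    intro c
    rw [ssinh, mul_sub, ← Complex.exp_add, ← Complex.exp_add, ← Complex.exp_add]
    congr 2 <;> ring
  simp only [quadPoly, Polynomial.eval_mul, Polynomial.eval_sub, Polynomial.eval_C,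
    Polynomial.eval_X, h]
  rw [two_mul, Complex.exp_add]; ring

theorem quadPoly_natDegree (a b : ℂ) : (quadPoly a b).natDegree ≤ 2 := by
  rw [quadPoly]; compute_degree

theorem quadPoly_coeff (a b : ℂ) : (quadPoly a b).coeff 2 = Complex.exp (a + b) := by
  have : quadPoly a b = Polynomial.C (Complex.exp (a+b)) * Polynomial.X^2 +
    Polynomial.C (-(Complex.exp (a-b)) - Complex.exp (b-a)) * Polynomial.X +
    Polynomial.C (Complex.exp (-a-b)) := by
    simp only [quadPoly, sub_eq_add_neg, Complex.exp_add, Polynomial.C_mul, Polynomial.C_add,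
      Polynomial.C_neg]
    ring
  rw [this]
  simp [Polynomial.coeff_X, Polynomial.coeff_C]

theorem prod_quadPoly_natDegree {n : ℕ} (A B : Fin n → ℂ) :
    (∏ j, quadPoly (A j) (B j)).natDegree ≤ n * 2 := by
  refine (Polynomial.natDegree_prod_le _ _).trans ?_
  refine (Finset.sum_le_card_nsmul _ _ 2 fun j _ => quadPoly_natDegree _ _).trans ?_
  simp

theorem prod_quadPoly_coeff {n : ℕ} (A B : Fin n → ℂ) :
    (∏ j, quadPoly (A j) (B j)).coeff (n * 2) = Complex.exp (∑ j, (A j + B j)) := by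
  have := Polynomial.coeff_prod_of_natDegree_le (s := Finset.univ)
    (fun j => quadPoly (A j) (B j)) 2 (fun p _ => quadPoly_natDegree _ _)
  rw [Finset.card_univ, Fintype.card_fin] at this
  rw [this, Complex.exp_sum]
  exact Finset.prod_congr rfl fun j _ => quadPoly_coeff _ _

theorem prod_quadPoly_eval {n : ℕ} (A B : Fin n → ℂ) (z : ℂ) :
    (∏ j, quadPoly (A j) (B j)).eval (Complex.exp (2*z)) =
      Complex.exp (2*z) ^ n * ∏ j, ssinh (z + A j) * ssinh (z + B j) := by
  rw [Polynomial.eval_prod]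
  simp only [quadPoly_eval]
  rw [Finset.prod_mul_distrib]; simp

/-- Genericity of a point for the sign symmetrisation. -/
def GenericPt {n : ℕ} (v : Fin n → ℂ) : Prop :=
  (∀ i, Complex.exp (2 * v i) ≠ 1 ∧ Complex.exp (2 * v i) ≠ -1) ∧
  (∀ i j, Complex.exp (2 * v i) * Complex.exp (2 * v j) = 1 → False) ∧
  Function.Injective fun i => Complex.exp (2 * v i)

theorem symSum_of_generic {n : ℕ} (a b t : ℂ) (v : Fin n → ℂ) (hv : GenericPt v) :
    symSum a b t v = (∏ j ∈ Finset.range n, ssinh (a + b + j * t)) * weylDen v := by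
  induction n with
  | zero => simp [symSum, symTerm, weylDen, pairProd, sgnChar]
  | succ n ih =>
    obtain ⟨z, y, rfl⟩ : ∃ z y, v = Fin.cons z y := ⟨v 0, Fin.tail v, (Fin.cons_self_tail v).symm⟩
    obtain ⟨hv1, hv2, hv3⟩ := hv
    have hy1 : ∀ i, Complex.exp (2 * y i) ≠ 1 ∧ Complex.exp (2 * y i) ≠ -1 :=
      fun i => by simpa using hv1 i.succ
    have hy2 : ∀ i j, Complex.exp (2 * y i) * Complex.exp (2 * y j) = 1 → False :=
      fun i j => by simpa using hv2 i.succ j.succ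
    have hy3 : Function.Injective fun i => Complex.exp (2 * y i) := fun i j h => by
      have := @hv3 i.succ j.succ (by simpa using h)
      simpa using this
    have IH := ih y ⟨hy1, hy2, hy3⟩
    set c : ℂ := (∏ j ∈ Finset.range (n+1), ssinh (a + b + j * t)) * weylDen y with hc
    let P : Polynomial ℂ := ∑ σ : Fin n → ℤˣ, Polynomial.C (sgnChar σ * symTerm a b t (sgnAct σ y)) *
      (quadPoly a b * (∏ j, quadPoly (sgnAct σ y j + t) (-sgnAct σ y j))
       - quadPoly (-a) (-b) * (∏ j, quadPoly (-sgnAct σ y j - t) (sgnAct σ y j)))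
    let R : Polynomial ℂ := Polynomial.C c *
      ((Polynomial.X^2 - 1) * ∏ j, quadPoly (y j) (-y j))
    have hPe : ∀ z, P.eval (Complex.exp (2*z)) = Complex.exp (2*z) ^ (n+1) *
        symSum a b t (Fin.cons z y : Fin (n+1) → ℂ) := by
      intro z
      rw [symSum_cons, Finset.mul_sum, Polynomial.eval_finsetSum]
      refine Finset.sum_congr rfl fun σ _ => ?_
      simp only [Polynomial.eval_mul, Polynomial.eval_sub, Polynomial.eval_C, quadPoly_eval,
        prod_quadPoly_eval, ← sub_eq_add_neg, ← add_assoc, ← add_sub_assoc]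
      ring
    have hRe : ∀ z, R.eval (Complex.exp (2*z)) = Complex.exp (2*z) ^ (n+1) *
        ((∏ j ∈ Finset.range (n+1), ssinh (a + b + j * t)) *
          weylDen (Fin.cons z y : Fin (n+1) → ℂ)) := by
      intro z
      have h2 : Complex.exp (2*z) ^ 2 - 1 = Complex.exp (2*z) * ssinh (2*z) := by
        rw [ssinh, mul_sub, ← Complex.exp_add, ← Complex.exp_add, ← Complex.exp_nat_mul]
        simp; ring_nf
      simp only [R, Polynomial.eval_mul, Polynomial.eval_sub, Polynomial.eval_C,
        prod_quadPoly_eval, Polynomial.eval_pow, Polynomial.eval_X, Polynomial.eval_one, h2,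
        weylDen_cons, hc, ← sub_eq_add_neg]
      ring
    have hcoefP : P.coeff (2 + n * 2) = c := by
      have hh : ∀ σ : Fin n → ℤˣ, (quadPoly a b * (∏ j, quadPoly (sgnAct σ y j + t) (-sgnAct σ y j))
       - quadPoly (-a) (-b) * (∏ j, quadPoly (-sgnAct σ y j - t) (sgnAct σ y j))).coeff (2 + n * 2)
          = ssinh (a + b + n * t) := by
        intro σ
        rw [Polynomial.coeff_sub, Polynomial.coeff_mul_add_eq_of_natDegree_le (quadPoly_natDegree _ _)
          (prod_quadPoly_natDegree _ _), Polynomial.coeff_mul_add_eq_of_natDegree_le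
          (quadPoly_natDegree _ _) (prod_quadPoly_natDegree _ _), quadPoly_coeff, quadPoly_coeff,
          prod_quadPoly_coeff, prod_quadPoly_coeff, ssinh, ← Complex.exp_add, ← Complex.exp_add]
        congr 2
        · simp
        · have h1 : ∀ j, -sgnAct σ y j - t + sgnAct σ y j = -t := fun j => by ring
          simp only [h1, Finset.sum_const, Finset.card_univ, Fintype.card_fin, nsmul_eq_mul]
          ring_nf
      simp only [P, Polynomial.finsetSum_coeff, Polynomial.coeff_C_mul, hh]
      rw [← Finset.sum_mul]
      have : ∑ σ : Fin n → ℤˣ, sgnChar σ * symTerm a b t (sgnAct σ y) = symSum a b t y := rfl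
      rw [this, IH, hc, Finset.prod_range_succ]; ring
    have hcoefR : R.coeff (2 + n * 2) = c := by
      have hX : (Polynomial.X^2 - 1 : Polynomial ℂ).natDegree ≤ 2 := by compute_degree
      simp only [R, Polynomial.coeff_C_mul]
      rw [Polynomial.coeff_mul_add_eq_of_natDegree_le hX (prod_quadPoly_natDegree _ _),
        prod_quadPoly_coeff]
      simp [Polynomial.coeff_one]
    have hdegP : P.natDegree ≤ 2 + n * 2 := by
      refine Polynomial.natDegree_sum_le_of_forall_le _ _ fun σ _ => ?_
      refine Polynomial.natDegree_C_mul_le _ _ |>.trans ((Polynomial.natDegree_sub_le _ _).trans (max_le ?_ ?_)) <;>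
      exact Polynomial.natDegree_mul_le_of_le (quadPoly_natDegree _ _) (prod_quadPoly_natDegree _ _)
    have hdegR : R.natDegree ≤ 2 + n * 2 := by
      have hX : (Polynomial.X^2 - 1 : Polynomial ℂ).natDegree ≤ 2 := by compute_degree
      exact Polynomial.natDegree_C_mul_le _ _ |>.trans
        (Polynomial.natDegree_mul_le_of_le hX (prod_quadPoly_natDegree _ _))
    -- interpolation nodes
    let node : Option (Fin n) × Bool → ℂ := fun p => match p with
      | (none, false) => 0
      | (none, true) => Real.pi / 2 * Complex.I
      | (some m, false) => y m
      | (some m, true) => -y m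
    have hnode0 : Complex.exp (2 * (Real.pi / 2 * Complex.I)) = -1 := by
      rw [show 2 * (Real.pi / 2 * Complex.I) = Real.pi * Complex.I by ring, Complex.exp_pi_mul_I]
    have hPR : P = R := by
      refine Polynomial.eq_of_degree_sub_lt_of_eval_index_eq (s := Finset.univ)
        (v := fun p => Complex.exp (2 * node p)) ?_ ?_ ?_
      · rintro ⟨p, e⟩ _ ⟨p', e'⟩ _ h
        simp only at h
        have hneg : ∀ i, Complex.exp (2 * -y i) = (Complex.exp (2 * y i))⁻¹ := fun i => by
          rw [mul_neg, Complex.exp_neg]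
        have h0 := fun i => Complex.exp_ne_zero (2 * y i)
        rcases p with _ | m <;> rcases p' with _ | m' <;> cases e <;> cases e' <;>
          simp only [node, hnode0, mul_zero, Complex.exp_zero, hneg] at h
        · rfl
        · norm_num at h
        · norm_num at h
        · rfl
        · exact absurd h.symm (hy1 _).1
        · exact absurd (inv_eq_one.mp h.symm) (hy1 _).1
        · exact absurd h.symm (hy1 _).2
        · exact absurd (inv_eq_iff_eq_inv.mp h.symm) (by norm_num; exact (hy1 _).2)
        · exact absurd h (hy1 _).1
        · exact absurd h (hy1 _).2
        · exact absurd (inv_eq_one.mp h) (hy1 _).1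
        · exact absurd (inv_eq_iff_eq_inv.mp h) (by norm_num; exact (hy1 _).2)
        · rw [hy3 h]
        · exact (hy2 m m' (by rw [h, inv_mul_cancel₀ (h0 _)])).elim
        · exact (hy2 m m' (by rw [← h, mul_inv_cancel₀ (h0 _)])).elim
        · rw [hy3 (inv_injective h)]
      · have hcard : (Finset.univ : Finset (Option (Fin n) × Bool)).card = 2 + n * 2 := by
          simp; ring
        rw [hcard, Polynomial.degree_lt_iff_coeff_zero]
        intro m hm
        rw [Polynomial.coeff_sub]
        rcases hm.eq_or_lt with rfl | hm
        · rw [hcoefP, hcoefR, sub_self]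
        · rw [Polynomial.coeff_eq_zero_of_natDegree_lt (hdegP.trans_lt hm),
            Polynomial.coeff_eq_zero_of_natDegree_lt (hdegR.trans_lt hm), sub_self]
      · rintro ⟨p, e⟩ _
        simp only [hPe, hRe]
        have hs0 : symSum a b t (Fin.cons (node (p, e)) y : Fin (n+1) → ℂ) = 0 := by
          rcases p with _ | m <;> cases e <;> simp only [node]
          · exact symSum_eq_zero_of_zero a b t _ (j := 0) rfl
          · have h1 := symSum_sgnAct a b t (sgnFlip 0)
              (Fin.cons (Real.pi / 2 * Complex.I) y : Fin (n+1) → ℂ)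
            have h2 : sgnAct (sgnFlip 0) (Fin.cons (Real.pi / 2 * Complex.I) y : Fin (n+1) → ℂ) =
                Fin.cons (-(Real.pi / 2 * Complex.I)) y := by
              funext k
              refine Fin.cases ?_ (fun k => ?_) k <;> simp [sgnAct, sgnFlip]
            have h3 : ∀ w, symSum a b t (Fin.cons (w + Real.pi * Complex.I) y : Fin (n+1) → ℂ) =
                symSum a b t (Fin.cons w y : Fin (n+1) → ℂ) := by
              intro w
              have hs : ∀ c, ssinh (w + Real.pi * Complex.I + c) = -ssinh (w + c) := fun c => by
                rw [← ssinh_add_pi_I]; ring_nf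
              simp only [symSum_cons, sub_eq_add_neg, add_assoc (w + Real.pi * Complex.I), hs,
                neg_mul_neg]
              simp only [add_assoc]
            have h4 := h3 (-(Real.pi / 2 * Complex.I))
            rw [show -(Real.pi / 2 * Complex.I) + Real.pi * Complex.I = Real.pi / 2 * Complex.I by ring]
              at h4
            rw [h2, sgnChar_sgnFlip, ← h4] at h1
            linear_combination h1 / 2
          · exact symSum_eq_zero_of_eq a b t _ (i := 0) (j := m.succ) (Fin.succ_ne_zero m).symm
              (by simp)
          · exact symSum_eq_zero_of_eq_neg a b t _ (i := 0) (j := m.succ) (Fin.succ_ne_zero m).symm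
              (by simp)
        have hw0 : weylDen (Fin.cons (node (p, e)) y : Fin (n+1) → ℂ) = 0 := by
          rw [weylDen_cons]
          rcases p with _ | m <;> cases e <;> simp only [node]
          · simp [ssinh_zero]
          · simp [ssinh, Complex.exp_neg, hnode0]
          · rw [Finset.prod_eq_zero (Finset.mem_univ m)] <;> simp [ssinh_zero]
          · rw [Finset.prod_eq_zero (Finset.mem_univ m)] <;> simp [ssinh_zero]
        rw [hs0, hw0]; ring
    have := hPe z
    rw [hPR, hRe z] at this
    exact (mul_left_cancel₀ (pow_ne_zero _ (Complex.exp_ne_zero _)) this).symm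

theorem pairProd_eq_zero {R S : Type*} [CommMonoidWithZero S] {n : ℕ} {f : R → R → S}
    {u : Fin n → R} {i j : Fin n} (hij : i < j) (h : f (u i) (u j) = 0) : pairProd f u = 0 :=
  Finset.prod_eq_zero (Finset.mem_univ i) (Finset.prod_eq_zero (Finset.mem_Ioi.mpr hij) h)

/-- Sign symmetrisation at real points scaled by `c` with `Re c ≠ 0`. -/
theorem symSum_real {n : ℕ} (a b t c : ℂ) (hc : c.re ≠ 0) (x : Fin n → ℝ) :
    symSum a b t (fun i => c * x i) =
      (∏ j ∈ Finset.range n, ssinh (a + b + j * t)) * weylDen (fun i => c * x i) := by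
  have hexp : ∀ y : ℝ, ∀ e : ℂ, ‖e‖ = 1 → Complex.exp (2 * (c * y)) = e → y = 0 := by
    intro y e he h
    have := congrArg (fun z => ‖z‖) h
    simp only [Complex.norm_exp, he, Real.exp_eq_one_iff] at this
    simp at this
    tauto
  by_cases h1 : ∃ i, x i = 0
  · obtain ⟨i, hi⟩ := h1
    rw [symSum_eq_zero_of_zero (j := i) _ _ _ _ (by simp [hi]), weylDen,
      Finset.prod_eq_zero (Finset.mem_univ i) (by simp [hi, ssinh_zero])]
    ring
  by_cases h2 : ∃ i j, i < j ∧ x i = x j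
  · obtain ⟨i, j, hij, h⟩ := h2
    rw [symSum_eq_zero_of_eq _ _ _ _ hij.ne (by simp [h]), weylDen,
      pairProd_eq_zero hij (by simp [h, ssinh_zero])]
    ring
  by_cases h3 : ∃ i j, i < j ∧ x i = -x j
  · obtain ⟨i, j, hij, h⟩ := h3
    rw [symSum_eq_zero_of_eq_neg _ _ _ _ hij.ne (by simp [h]), weylDen,
      pairProd_eq_zero hij (by simp [h, ssinh_zero])]
    ring
  push Not at h1 h2 h3
  refine symSum_of_generic a b t _ ⟨fun i => ⟨fun h => h1 i (hexp _ 1 (by simp) h),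
    fun h => h1 i (hexp _ (-1) (by simp) h)⟩, fun i j h => ?_, fun i j h => ?_⟩
  · have hh : x i + x j = 0 := by
      refine hexp _ 1 (by simp) ?_
      rw [← h, ← Complex.exp_add]; push_cast; ring_nf
    rcases lt_trichotomy i j with hij | rfl | hij
    · exact h3 i j hij (by linarith)
    · exact h1 i (by linarith)
    · exact h3 j i hij (by linarith)
  · have hh : x i - x j = 0 := by
      refine hexp _ 1 (by simp) ?_
      have h' : Complex.exp (2 * (c * x i)) = Complex.exp (2 * (c * x j)) := h
      push_cast
      rw [mul_sub, mul_sub, Complex.exp_sub, h', div_self (Complex.exp_ne_zero _)]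
    rcases lt_trichotomy i j with hij | rfl | hij
    · exact absurd (by linarith) (h2 i j hij)
    · rfl
    · exact absurd (by linarith) (h2 j i hij)

theorem norm_sinh_sub_le (w : ℂ) : ‖Complex.sinh w - w‖ ≤ ‖w‖^3 * Real.exp ‖w‖ := by
  have h1 := Complex.norm_exp_sub_sum_le_norm_mul_exp w 3
  have h2 := Complex.norm_exp_sub_sum_le_norm_mul_exp (-w) 3
  rw [norm_neg] at h2
  have e : Complex.sinh w - w = ((Complex.exp w - ∑ m ∈ Finset.range 3, w^m / m.factorial) -
      (Complex.exp (-w) - ∑ m ∈ Finset.range 3, (-w)^m / m.factorial)) / 2 := by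
    simp [Complex.sinh, Finset.sum_range_succ]; ring
  rw [e, norm_div, Complex.norm_ofNat]
  linarith [norm_sub_le (Complex.exp w - ∑ m ∈ Finset.range 3, w^m / m.factorial)
      (Complex.exp (-w) - ∑ m ∈ Finset.range 3, (-w)^m / m.factorial)]

theorem norm_sin_sub_le (w : ℂ) : ‖Complex.sin w - w‖ ≤ ‖w‖^3 * Real.exp ‖w‖ := by
  have h := norm_sinh_sub_le (w * Complex.I)
  rw [Complex.sinh_mul_I, ← sub_mul, norm_mul, norm_mul, Complex.norm_I, mul_one, mul_one] at h
  exact h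

theorem sinh_re_le_norm_sinh (w : ℂ) : Real.sinh w.re ≤ ‖Complex.sinh w‖ := by
  rw [Complex.sinh, norm_div, Complex.norm_ofNat, Real.sinh_eq]
  have := norm_sub_norm_le (Complex.exp w) (Complex.exp (-w))
  rw [Complex.norm_exp, Complex.norm_exp, Complex.neg_re] at this
  linarith

theorem norm_sin_le_exp (w : ℂ) : ‖Complex.sin w‖ ≤ Real.exp |w.im| := by
  rw [Complex.sin, norm_div, norm_mul, Complex.norm_I, Complex.norm_ofNat, mul_one]
  have := norm_sub_le (Complex.exp (-w * Complex.I)) (Complex.exp (w * Complex.I))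
  rw [Complex.norm_exp, Complex.norm_exp] at this
  have h1 : (-w * Complex.I).re = w.im := by simp
  have h2 : (w * Complex.I).re = -w.im := by simp
  rw [h1, h2] at this
  have := Real.exp_le_exp.mpr (le_abs_self w.im)
  have := Real.exp_le_exp.mpr (neg_le_abs w.im)
  linarith

theorem norm_cos_le_exp (w : ℂ) : ‖Complex.cos w‖ ≤ Real.exp |w.im| := by
  rw [Complex.cos, norm_div, Complex.norm_ofNat]
  have := norm_add_le (Complex.exp (w * Complex.I)) (Complex.exp (-w * Complex.I))
  rw [Complex.norm_exp, Complex.norm_exp] at this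
  have h1 : (-w * Complex.I).re = w.im := by simp
  have h2 : (w * Complex.I).re = -w.im := by simp
  rw [h1, h2] at this
  have := Real.exp_le_exp.mpr (le_abs_self w.im)
  have := Real.exp_le_exp.mpr (neg_le_abs w.im)
  linarith

/-- The integrand of the hyperbolic gamma function. -/
def hgKer (op om z : ℂ) (y : ℝ) : ℂ :=
  (1/(y:ℂ)) * (Complex.sin (2*(y:ℂ)*z) /
        (2 * Complex.sinh (op*(y:ℂ)) * Complex.sinh (om*(y:ℂ)))
      - z/(op*om*(y:ℂ)))

theorem mul_le_norm_sinh {op : ℂ} {m y : ℝ} (hm : 0 ≤ m) (hop : m ≤ op.re) (hy : 0 ≤ y) :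
    m * y ≤ ‖Complex.sinh (op * y)‖ := by
  refine le_trans ?_ (sinh_re_le_norm_sinh _)
  have h1 : m * y ≤ (op * y).re := by
    rw [Complex.re_mul_ofReal]; exact mul_le_mul_of_nonneg_right hop hy
  exact h1.trans (Real.self_le_sinh_iff.mpr ((mul_nonneg hm hy).trans h1))

theorem exp_le_norm_sinh {op : ℂ} {m y : ℝ} (hm : 0 ≤ m) (hop : m ≤ op.re) (hy : 1 ≤ y) :
    (1 - Real.exp (-2*m)) / 2 * Real.exp (op.re * y) ≤ ‖Complex.sinh (op * y)‖ := by
  refine le_trans ?_ (sinh_re_le_norm_sinh _)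
  rw [Complex.re_mul_ofReal, Real.sinh_eq]
  have h : Real.exp (-(op.re*y)) ≤ Real.exp (-2*m) * Real.exp (op.re * y) := by
    rw [← Real.exp_add]
    apply Real.exp_le_exp.mpr
    nlinarith
  linarith

set_option maxHeartbeats 1000000 in
theorem exists_hgKer_bound (R m δ : ℝ) (hm : 0 < m) (hδ : 0 < δ) : ∃ C : ℝ, 0 ≤ C ∧
    ∀ op om z : ℂ, ‖op‖ ≤ R → ‖om‖ ≤ R → ‖z‖ ≤ R → m ≤ op.re → m ≤ om.re →
      |z.im| ≤ (op.re + om.re)/2 - δ → ∀ y : ℝ, 0 < y →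
      ‖hgKer op om z y‖ ≤ C * (Real.exp (-2*δ*y) + 1/(1+y^2)) := by
  set E : ℝ := R^3 * Real.exp R with hE
  set C1 : ℝ := 8 * R^3 * Real.exp (2*R) * R^2 + 2 * R * (2 * R * E + E^2) with hC1
  set q : ℝ := (1 - Real.exp (-2*m)) / 2 with hq
  have hq0 : 0 < q := by
    have : Real.exp (-2*m) < 1 := Real.exp_lt_one_iff.mpr (by linarith)
    rw [hq]; linarith
  refine ⟨max 0 (max (C1/m^4) (max (1/(2*q^2)) (2*R/m^2))), le_max_left _ _, ?_⟩
  intro op om z hop hom hz hop' hom' him y hy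
  set C := max 0 (max (C1/m^4) (max (1/(2*q^2)) (2*R/m^2))) with hC
  have hCa : C1/m^4 ≤ C := (le_max_left _ _).trans (le_max_right _ _)
  have hCb : 1/(2*q^2) ≤ C := (le_max_left _ _).trans ((le_max_right _ _).trans (le_max_right _ _))
  have hCc : 2*R/m^2 ≤ C := (le_max_right _ _).trans ((le_max_right _ _).trans (le_max_right _ _))
  have hC0 : 0 ≤ C := le_max_left _ _
  have hR : 0 ≤ R := (norm_nonneg _).trans hz
  have hop0 : op ≠ 0 := by rintro rfl; simp at hop'; linarith
  have hom0 : om ≠ 0 := by rintro rfl; simp at hom'; linarith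
  have hy0 : (y:ℂ) ≠ 0 := by exact_mod_cast hy.ne'
  have hyn : ‖(y:ℂ)‖ = y := by rw [Complex.norm_real, Real.norm_of_nonneg hy.le]
  have hsp := mul_le_norm_sinh hm.le hop' hy.le
  have hsm := mul_le_norm_sinh hm.le hom' hy.le
  have hopm : m ≤ ‖op‖ := hop'.trans (Complex.re_le_norm _)
  have homm : m ≤ ‖om‖ := hom'.trans (Complex.re_le_norm _)
  have hmy : 0 < m * y := by positivity
  have hsp0 : Complex.sinh (op * y) ≠ 0 := norm_pos_iff.mp (hmy.trans_le hsp)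
  have hsm0 : Complex.sinh (om * y) ≠ 0 := norm_pos_iff.mp (hmy.trans_le hsm)
  rcases le_total y 1 with hy1 | hy1
  · set e1 := Complex.sin (2*(y:ℂ)*z) - 2*(y:ℂ)*z with he1
    set e2 := Complex.sinh (op*y) - op*y with he2
    set e3 := Complex.sinh (om*y) - om*y with he3
    have b23 : ∀ p : ℂ, ‖p‖ ≤ R → ‖Complex.sinh (p*y) - p*y‖ ≤ E * y^3 := by
      intro p hp
      refine (norm_sinh_sub_le _).trans ?_
      have hn : ‖p*y‖ ≤ R * y := by
        rw [norm_mul, hyn]; exact mul_le_mul_of_nonneg_right hp hy.le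
      have hn' : ‖p*y‖ ≤ R := hn.trans (mul_le_of_le_one_right hR hy1)
      calc _ ≤ (R*y)^3 * Real.exp R := by gcongr
        _ = _ := by rw [hE]; ring
    have b1 : ‖e1‖ ≤ 8 * R^3 * Real.exp (2*R) * y^3 := by
      refine (norm_sin_sub_le _).trans ?_
      have hn : ‖2*(y:ℂ)*z‖ ≤ 2*R * y := by
        rw [norm_mul, norm_mul, hyn, Complex.norm_ofNat]
        nlinarith
      have hn' : ‖2*(y:ℂ)*z‖ ≤ 2*R := hn.trans (mul_le_of_le_one_right (by linarith) hy1)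
      calc _ ≤ (2*R*y)^3 * Real.exp (2*R) := by gcongr
        _ = _ := by ring
    have b2 := b23 op hop
    have b3 := b23 om hom
    have hform : hgKer op om z y = (1/(y:ℂ)) * ((e1*op*om*y - 2*z*(op*y*e3 + om*y*e2 + e2*e3)) /
        (2 * Complex.sinh (op*y) * Complex.sinh (om*y) * op * om * y)) := by
      rw [hgKer]
      congr 1
      rw [div_sub_div _ _ (by simp [hsp0, hsm0]) (by simp [hop0, hom0, hy0]), he1, he2, he3]
      rw [div_eq_div_iff (by simp [hsp0, hsm0, hop0, hom0, hy0])
        (by simp [hsp0, hsm0, hop0, hom0, hy0])]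
      ring
    have hE0 : 0 ≤ E := by positivity
    have hnum : ‖e1*op*om*y - 2*z*(op*y*e3 + om*y*e2 + e2*e3)‖ ≤ C1 * y^4 := by
      have hop1 : ‖op * y‖ ≤ R * y := by rw [norm_mul, hyn]; gcongr
      have hom1 : ‖om * y‖ ≤ R * y := by rw [norm_mul, hyn]; gcongr
      have t1 : ‖e1*op*om*y‖ ≤ (8 * R^3 * Real.exp (2*R) * y^3) * R * R * y := by
        rw [norm_mul, norm_mul, norm_mul, hyn]; gcongr
      have t2 : ‖2*z*(op*y*e3 + om*y*e2 + e2*e3)‖ ≤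
          2 * R * (R*y*(E*y^3) + R*y*(E*y^3) + (E*y^3)*(E*y^3)) := by
        rw [norm_mul, norm_mul, Complex.norm_ofNat]
        gcongr
        refine (norm_add₃_le).trans ?_
        rw [norm_mul _ e3, norm_mul _ e2, norm_mul e2]
        gcongr
      have hy6 : y^6 ≤ y^4 := pow_le_pow_of_le_one hy.le hy1 (by norm_num)
      calc _ ≤ _ := norm_sub_le _ _
        _ ≤ _ := add_le_add t1 t2
        _ = (8 * R^3 * Real.exp (2*R) * R^2 + 2*R*(2*R*E)) * y^4 + 2*R*E^2*y^6 := by ring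
        _ ≤ (8 * R^3 * Real.exp (2*R) * R^2 + 2*R*(2*R*E)) * y^4 + 2*R*E^2*y^4 := by gcongr
        _ = _ := by rw [hC1]; ring
    have hC10 : 0 ≤ C1 := by positivity
    have hden : 2 * m^4 * y^3 ≤ ‖2 * Complex.sinh (op*y) * Complex.sinh (om*y) * op * om * y‖ := by
      simp only [norm_mul, hyn, Complex.norm_ofNat]
      calc 2 * m^4*y^3 = 2 * (m*y) * (m*y) * m * m * y := by ring
        _ ≤ _ := by gcongr
    have : ‖hgKer op om z y‖ ≤ C1/m^4/2 := by
      rw [hform, norm_mul, norm_div, norm_div, hyn, norm_one]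
      calc _ ≤ 1/y * (C1*y^4/(2 * m^4*y^3)) := by gcongr
        _ = _ := by field_simp
    refine this.trans ?_
    have h2 : (1:ℝ)/2 ≤ 1/(1+y^2) := by
      apply one_div_le_one_div_of_le (by positivity); nlinarith
    have h3 := Real.exp_nonneg (-2*δ*y)
    calc C1/m^4/2 ≤ C/2 := by linarith
      _ = C * (1/2) := by ring
      _ ≤ _ := by gcongr; linarith
  · have hs1 := exp_le_norm_sinh hm.le hop' hy1
    have hs2 := exp_le_norm_sinh hm.le hom' hy1
    have hsin : ‖Complex.sin (2*(y:ℂ)*z)‖ ≤ Real.exp (-2*δ*y) * (Real.exp (op.re*y) * Real.exp (om.re*y)) := by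
      refine (norm_sin_le_exp _).trans ?_
      rw [← Real.exp_add, ← Real.exp_add]
      apply Real.exp_le_exp.mpr
      have : (2*(y:ℂ)*z).im = 2*y*z.im := by
        rw [show (2*(y:ℂ)*z) = ((2*y:ℝ):ℂ) * z by push_cast; ring, Complex.im_ofReal_mul]
      rw [this, abs_mul, abs_of_pos (by positivity : 0 < 2*y)]
      have := mul_le_mul_of_nonneg_left him (by positivity : 0 ≤ 2*y)
      linarith
    have t1 : ‖Complex.sin (2*(y:ℂ)*z) / (2 * Complex.sinh (op*y) * Complex.sinh (om*y))‖ ≤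
        1/(2*q^2) * Real.exp (-2*δ*y) := by
      rw [norm_div, norm_mul, norm_mul, Complex.norm_ofNat]
      calc _ ≤ Real.exp (-2*δ*y) * (Real.exp (op.re*y) * Real.exp (om.re*y)) /
            (2 * (q * Real.exp (op.re*y)) * (q * Real.exp (om.re*y))) := by gcongr
        _ = _ := by field_simp
    have t2 : ‖z/(op*om*(y:ℂ))‖ ≤ R/m^2 / y := by
      rw [norm_div, norm_mul, norm_mul, hyn]
      calc _ ≤ R/(m*m*y) := by gcongr
        _ = _ := by field_simp
    rw [hgKer, norm_mul, norm_div, norm_one, hyn]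
    have hy' : 1/y ≤ 1 := by rw [div_le_one hy]; exact hy1
    have h5 : R/m^2 / y * (1/y) ≤ 2*R/m^2 * (1/(1+y^2)) := by
      have : 1/y*(1/y) ≤ 2 * (1/(1+y^2)) := by
        rw [div_mul_div_comm, one_mul, mul_one_div, div_le_div_iff₀ (by positivity) (by positivity)]
        nlinarith
      calc R/m^2 / y * (1/y) = R/m^2 * (1/y*(1/y)) := by ring
        _ ≤ R/m^2 * (2 * (1/(1+y^2))) := by gcongr
        _ = _ := by ring
    calc 1/y * _ ≤ 1/y * (1/(2*q^2) * Real.exp (-2*δ*y) + R/m^2 / y) := by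
          gcongr; exact (norm_sub_le _ _).trans (add_le_add t1 t2)
      _ = 1/y * (1/(2*q^2) * Real.exp (-2*δ*y)) + R/m^2 / y * (1/y) := by ring
      _ ≤ 1 * (1/(2*q^2) * Real.exp (-2*δ*y)) + 2*R/m^2 * (1/(1+y^2)) := by gcongr
      _ ≤ C * Real.exp (-2*δ*y) + C * (1/(1+y^2)) := by
          rw [one_mul]; gcongr
      _ = _ := by ring

theorem hypGammaInt_eq (op om z : ℂ) : hypGammaInt op om z =
    Complex.exp (Complex.I * ∫ y in Set.Ioi (0:ℝ), hgKer op om z y) := rfl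

theorem integrableOn_ker_dom (δ : ℝ) (hδ : 0 < δ) :
    IntegrableOn (fun y : ℝ => Real.exp (-2*δ*y) + 1/(1+y^2)) (Ioi 0) := by
  refine Integrable.add ?_ ?_
  · exact exp_neg_integrableOn_Ioi 0 (by positivity : 0 < 2*δ) |>.congr_fun
      (fun y _ => by simp) measurableSet_Ioi
  · simpa [one_div] using integrable_inv_one_add_sq.restrict

theorem exists_hgKer_dom {om op₀ z₀ : ℂ} (hom : 0 < om.re) (hop : 0 < op₀.re)
    (hz : |z₀.im| < ((op₀+om)/2).re) : ∃ b : ℝ → ℝ, IntegrableOn b (Ioi 0) ∧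
      ∀ᶠ p : ℂ × ℂ in 𝓝 (op₀, z₀), ∀ y : ℝ, 0 < y → ‖hgKer p.1 om p.2 y‖ ≤ b y := by
  set R := ‖op₀‖ + ‖om‖ + ‖z₀‖ + 1 with hR
  set m := min (op₀.re/2) om.re with hm
  set δ := (((op₀+om)/2).re - |z₀.im|)/2 with hδ
  have hm0 : 0 < m := lt_min (by linarith) hom
  have hδ0 : 0 < δ := by rw [hδ]; linarith
  obtain ⟨C, hC, hb⟩ := exists_hgKer_bound R m δ hm0 hδ0
  refine ⟨_, (integrableOn_ker_dom δ hδ0).const_mul C, ?_⟩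
  have n1 := norm_nonneg op₀
  have n2 := norm_nonneg om
  have n3 := norm_nonneg z₀
  have e1 : ∀ᶠ p : ℂ × ℂ in 𝓝 (op₀, z₀), ‖p.1‖ < R :=
    (continuous_fst.norm.tendsto (op₀, z₀)).eventually_lt_const (by simp [hR]; linarith)
  have e2 : ∀ᶠ p : ℂ × ℂ in 𝓝 (op₀, z₀), ‖p.2‖ < R :=
    (continuous_snd.norm.tendsto (op₀, z₀)).eventually_lt_const (by simp [hR]; linarith)
  have e3 : ∀ᶠ p : ℂ × ℂ in 𝓝 (op₀, z₀), op₀.re/2 < p.1.re :=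
    ((Complex.continuous_re.comp continuous_fst).tendsto (op₀, z₀)).eventually_const_lt
      (by simp; linarith)
  have e4 : ∀ᶠ p : ℂ × ℂ in 𝓝 (op₀, z₀), |p.2.im| - (p.1.re+om.re)/2 + δ < 0 := by
    have hc : Continuous fun p : ℂ × ℂ => |p.2.im| - (p.1.re+om.re)/2 + δ := by fun_prop
    refine (hc.tendsto (op₀, z₀)).eventually_lt_const ?_
    have : ((op₀+om)/2).re = (op₀.re + om.re)/2 := by simp
    have hδ' := hδ
    rw [this] at hδ' hz
    linarith
  filter_upwards [e1, e2, e3, e4] with p h1 h2 h3 h4 y hy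
  exact hb p.1 om p.2 h1.le (by linarith) h2.le ((min_le_left _ _).trans h3.le)
    (min_le_right _ _) (by linarith) y hy

theorem continuous_hgKer_param {op om : ℂ} {y : ℝ} (hop : 0 < op.re) (hom : 0 < om.re) (hy : 0 < y)
    (z : ℂ) : ContinuousAt (fun p : ℂ × ℂ => hgKer p.1 om p.2 y) (op, z) := by
  have h1 : Complex.sinh (op * y) ≠ 0 := norm_pos_iff.mp
    ((mul_pos hop hy).trans_le (mul_le_norm_sinh hop.le le_rfl hy.le))
  have h2 : Complex.sinh (om * y) ≠ 0 := norm_pos_iff.mp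
    ((mul_pos hom hy).trans_le (mul_le_norm_sinh hom.le le_rfl hy.le))
  have h3 : op ≠ 0 := by rintro rfl; simp at hop
  have h4 : om ≠ 0 := by rintro rfl; simp at hom
  have h5 : (y:ℂ) ≠ 0 := by exact_mod_cast hy.ne'
  unfold hgKer
  refine ContinuousAt.mul continuousAt_const (ContinuousAt.sub ?_ ?_)
  · refine ContinuousAt.div (by fun_prop) (by fun_prop) (by simp [h1, h2])
  · refine ContinuousAt.div (by fun_prop) (by fun_prop) (by simp [h3, h4, h5])

theorem differentiable_hgKer (op om : ℂ) (y : ℝ) : Differentiable ℂ fun z => hgKer op om z y := by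
  unfold hgKer
  fun_prop

theorem continuousOn_hgKer {op om : ℂ} (hop : 0 < op.re) (hom : 0 < om.re) (z : ℂ) :
    ContinuousOn (hgKer op om z) (Ioi 0) := by
  intro y hy
  have hy : 0 < y := hy
  have h1 : Complex.sinh (op * y) ≠ 0 := norm_pos_iff.mp
    ((mul_pos hop hy).trans_le (mul_le_norm_sinh hop.le le_rfl hy.le))
  have h2 : Complex.sinh (om * y) ≠ 0 := norm_pos_iff.mp
    ((mul_pos hom hy).trans_le (mul_le_norm_sinh hom.le le_rfl hy.le))
  have h3 : op ≠ 0 := by rintro rfl; simp at hop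
  have h4 : om ≠ 0 := by rintro rfl; simp at hom
  have h5 : (y:ℂ) ≠ 0 := by exact_mod_cast hy.ne'
  refine ContinuousAt.continuousWithinAt ?_
  unfold hgKer
  refine ContinuousAt.mul (ContinuousAt.div (by fun_prop) (by fun_prop) h5) (ContinuousAt.sub ?_ ?_)
  · refine ContinuousAt.div (by fun_prop) (by fun_prop) (by simp [h1, h2])
  · refine ContinuousAt.div (by fun_prop) (by fun_prop) (by simp [h3, h4, h5])

theorem aesm_hgKer {op om : ℂ} (hop : 0 < op.re) (hom : 0 < om.re) (z : ℂ) :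
    AEStronglyMeasurable (hgKer op om z) (volume.restrict (Ioi 0)) :=
  (continuousOn_hgKer hop hom z).aestronglyMeasurable measurableSet_Ioi

theorem integrableOn_hgKer {op om z : ℂ} (hop : 0 < op.re) (hom : 0 < om.re)
    (hz : |z.im| < ((op+om)/2).re) : IntegrableOn (hgKer op om z) (Ioi 0) := by
  obtain ⟨b, hb, he⟩ := exists_hgKer_dom hom hop hz
  exact Integrable.mono' hb (aesm_hgKer hop hom z)
    ((ae_restrict_iff' measurableSet_Ioi).mpr (Eventually.of_forall he.self_of_nhds))

/-- Joint continuity of the integral representation in `(ω₊, z)`. -/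
theorem continuousAt_hypGammaInt {om op₀ z₀ : ℂ} (hom : 0 < om.re) (hop : 0 < op₀.re)
    (hz : |z₀.im| < ((op₀+om)/2).re) :
    ContinuousAt (fun p : ℂ × ℂ => hypGammaInt p.1 om p.2) (op₀, z₀) := by
  obtain ⟨b, hb, he⟩ := exists_hgKer_dom hom hop hz
  simp only [hypGammaInt_eq]
  refine Complex.continuous_exp.continuousAt.comp (continuousAt_const.mul ?_)
  have e3 : ∀ᶠ p : ℂ × ℂ in 𝓝 (op₀, z₀), 0 < p.1.re :=
    ((Complex.continuous_re.comp continuous_fst).tendsto (op₀, z₀)).eventually_const_lt hop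
  refine continuousAt_of_dominated (bound := b) ?_ ?_ hb ?_
  · filter_upwards [e3] with p hp using aesm_hgKer hp hom _
  · filter_upwards [he] with p hp
    exact (ae_restrict_iff' measurableSet_Ioi).mpr (Eventually.of_forall hp)
  · exact (ae_restrict_iff' measurableSet_Ioi).mpr
      (Eventually.of_forall fun y hy => continuous_hgKer_param hop hom hy z₀)

theorem differentiableAt_hypGammaInt {om op z₀ : ℂ} (hom : 0 < om.re) (hop : 0 < op.re)
    (hz : |z₀.im| < ((op+om)/2).re) : DifferentiableAt ℂ (hypGammaInt op om) z₀ := by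
  obtain ⟨b, hb, he⟩ := exists_hgKer_dom hom hop hz
  have he' : ∀ᶠ z in 𝓝 z₀, ∀ y : ℝ, 0 < y → ‖hgKer op om z y‖ ≤ b y :=
    (Continuous.prodMk_right op).tendsto z₀ |>.eventually he
  obtain ⟨r, hr, hball⟩ := Metric.eventually_nhds_iff_ball.mp he'
  have : DifferentiableAt ℂ (fun z => ∫ y in Ioi 0, hgKer op om z y) z₀ :=
    differentiableAt_integral_of_local_bound hr (fun z _ => aesm_hgKer hop hom z)
      ((ae_restrict_iff' measurableSet_Ioi).mpr (Eventually.of_forall fun y hy z hz => hball z hz y hy))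
      hb (Eventually.of_forall fun y => (differentiable_hgKer op om y).differentiableOn)
  exact (this.const_mul Complex.I).cexp

theorem hgKer_neg (op om z : ℂ) (y : ℝ) : hgKer op om (-z) y = -hgKer op om z y := by
  simp only [hgKer, mul_neg, Complex.sin_neg]; ring

theorem hypGammaInt_neg (op om z : ℂ) : hypGammaInt op om z * hypGammaInt op om (-z) = 1 := by
  rw [hypGammaInt_eq, hypGammaInt_eq, ← Complex.exp_add]
  simp only [hgKer_neg, integral_neg]
  simp

theorem hgKer_swap (op om z : ℂ) (y : ℝ) : hgKer op om z y = hgKer om op z y := by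
  simp only [hgKer]; ring_nf

theorem hypGammaInt_swap (op om z : ℂ) : hypGammaInt op om z = hypGammaInt om op z := by
  simp only [hypGammaInt_eq, hgKer_swap op om]

/-- Duplication in the second period. -/
theorem hypGammaInt_dup {op om z : ℂ} (hop : 0 < op.re) (hom : 0 < om.re)
    (hz : |z.im| < ((op+om/2)/2).re) :
    hypGammaInt op (om/2) z =
      hypGammaInt op om (z - Complex.I*om/4) * hypGammaInt op om (z + Complex.I*om/4) := by
  have hh : ((op+om/2)/2).re = (op.re+om.re/2)/2 := by simp
  have hh' : ((op+om)/2).re = (op.re+om.re)/2 := by simp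
  have him : (Complex.I*om/4).im = om.re/4 := by simp
  rw [hh, abs_lt] at hz
  rw [hypGammaInt_eq, hypGammaInt_eq, hypGammaInt_eq, ← Complex.exp_add, ← mul_add,
    ← integral_add (integrableOn_hgKer hop hom (by rw [hh', abs_lt, Complex.sub_im, him]; constructor <;> linarith))
     (integrableOn_hgKer hop hom (by rw [hh', abs_lt, Complex.add_im, him]; constructor <;> linarith))]
  congr 2
  refine setIntegral_congr_fun measurableSet_Ioi fun y hy => ?_
  have hy : 0 < y := hy
  have h1 : Complex.sinh (op * y) ≠ 0 := norm_pos_iff.mp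
    ((mul_pos hop hy).trans_le (mul_le_norm_sinh hop.le le_rfl hy.le))
  have h2 : Complex.sinh (om/2 * y) ≠ 0 := norm_pos_iff.mp
    ((mul_pos (by simpa using hom : 0 < (om/2).re) hy).trans_le (mul_le_norm_sinh (by simp; linarith) le_rfl hy.le))
  have h2' : Complex.sinh (om * y) ≠ 0 := norm_pos_iff.mp
    ((mul_pos hom hy).trans_le (mul_le_norm_sinh hom.le le_rfl hy.le))
  have h4 : om ≠ 0 := by rintro rfl; simp at hom
  have e1 : om * y = 2 * (om/2*y) := by ring
  have e2 : Complex.sin (2*y*(z - Complex.I*om/4)) + Complex.sin (2*y*(z+Complex.I*om/4)) =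
      2 * Complex.sin (2*y*z) * Complex.cosh (om/2*y) := by
    rw [show 2*y*(z - Complex.I*om/4) = 2*y*z - (om/2*y)*Complex.I by ring,
      show 2*y*(z + Complex.I*om/4) = 2*y*z + (om/2*y)*Complex.I by ring, Complex.sin_add,
      Complex.sin_sub, Complex.cos_mul_I]; ring
  have h2'' := h2'
  rw [e1, Complex.sinh_two_mul] at h2''
  have h3 : Complex.cosh (om/2*y) ≠ 0 := fun h => h2'' (by rw [h, mul_zero])
  have e3 : Complex.sin (2*y*z) / (2 * Complex.sinh (op*y) * Complex.sinh (om/2*y)) =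
     Complex.sin (2*y*(z - Complex.I*om/4)) / (2 * Complex.sinh (op*y) * Complex.sinh (om*y)) +
     Complex.sin (2*y*(z + Complex.I*om/4)) / (2 * Complex.sinh (op*y) * Complex.sinh (om*y)) := by
    rw [← add_div, e2, e1, Complex.sinh_two_mul]
    generalize Complex.cosh (om/2*y) = A at *
    generalize Complex.sinh (om/2*y) = B at *
    field_simp
  simp only [hgKer, e3]
  have h6 : z/(op*(om/2)*y) = (z - Complex.I*om/4)/(op*om*y) + (z + Complex.I*om/4)/(op*om*y) := by
    rw [← add_div]
    have hop0 : op ≠ 0 := by rintro rfl; simp at hop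
    have hy0 : (y:ℂ) ≠ 0 := by exact_mod_cast hy.ne'
    field_simp; ring
  rw [h6]; ring

theorem ne_zero_of_re_pos {a : ℂ} (ha : 0 < a.re) : a ≠ 0 := by
  rintro rfl; simp at ha

theorem half_add_re (a b : ℂ) : ((a+b)/2).re = (a.re+b.re)/2 := by simp

theorem hypGammaPoles_swap (op om : ℂ) : hypGammaPoles op om = hypGammaPoles om op := by
  ext z
  constructor <;> rintro ⟨m, n, rfl⟩ <;> exact ⟨n, m, by ring⟩

theorem IsHypGamma.swap {op om : ℂ} {g : ℂ → ℂ} (h : IsHypGamma op om g) : IsHypGamma om op g where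
  strip z hz := by rw [hypGammaInt_swap]; exact h.strip z (by rwa [add_comm])
  funEqm := h.funEqp
  funEqp := h.funEqm
  cont := by rw [hypGammaPoles_swap]; exact h.cont

theorem hypGammaPoles_im_le {op om z : ℂ} (hop : 0 < op.re) (hom : 0 < om.re)
    (hz : z ∈ hypGammaPoles op om) : z.im ≤ -(op.re+om.re)/2 := by
  obtain ⟨m, n, rfl⟩ := hz
  have h1 : (0:ℝ) ≤ m * op.re := by positivity
  have h2 : (0:ℝ) ≤ n * om.re := by positivity
  simp
  linarith

theorem IsHypGamma.continuousAt {op om z : ℂ} {g : ℂ → ℂ} (h : IsHypGamma op om g)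
    (hop : 0 < op.re) (hom : 0 < om.re) (hz : -(op.re+om.re)/2 < z.im) : ContinuousAt g z := by
  refine h.cont.continuousAt (mem_of_superset
    ((isOpen_lt continuous_const Complex.continuous_im).mem_nhds hz) fun w hw hp => ?_)
  exact absurd (hypGammaPoles_im_le hop hom hp) (not_le.mpr hw)

theorem eventually_cosh_ne_zero {om : ℂ} (hom : om ≠ 0) (z : ℂ) :
    ∀ᶠ w in 𝓝[≠] z, Complex.cosh (Real.pi * w / om) ≠ 0 := by
  have hc : Continuous fun w : ℂ => Complex.cosh (Real.pi * w / om) := by fun_prop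
  by_cases h0 : Complex.cosh (Real.pi * z / om) = 0
  · have hd : HasDerivAt (fun w : ℂ => Complex.cosh (Real.pi * w / om))
        (Complex.sinh (Real.pi * z / om) * (Real.pi * 1 / om)) z :=
      (((hasDerivAt_id z).const_mul _).div_const om).ccosh
    refine hd.eventually_ne (mul_ne_zero (fun hs => ?_) ?_)
    · have := Complex.cosh_sq_sub_sinh_sq (Real.pi * z / om)
      rw [h0, hs] at this; norm_num at this
    · simp [hom, Real.pi_ne_zero]
  · exact (hc.continuousAt.eventually_ne h0).filter_mono nhdsWithin_le_nhds

/-- The functional equation on the half plane of holomorphy, including at zeros of `cosh`. -/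
theorem IsHypGamma.shift {op om z : ℂ} {g : ℂ → ℂ} (h : IsHypGamma op om g)
    (hop : 0 < op.re) (hom : 0 < om.re) (hz : -(op.re+om.re)/2 < z.im) :
    g (z + Complex.I*op) = 2 * Complex.cosh (Real.pi * (z + Complex.I*op/2) / om) * g z := by
  have hc1 : ContinuousAt (fun w => g (w + Complex.I*op/2)) (z + Complex.I*op/2) := by
    refine ContinuousAt.comp (g := g) (f := fun w => w + Complex.I*op/2) ?_ (by fun_prop)
    refine h.continuousAt hop hom ?_
    simp; linarith
  have hc2 : ContinuousAt (fun w => 2 * Complex.cosh (Real.pi * w / om) * g (w - Complex.I*op/2))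
      (z + Complex.I*op/2) := by
    refine ContinuousAt.mul (by fun_prop)
      (ContinuousAt.comp (g := g) (f := fun w => w - Complex.I*op/2) ?_ (by fun_prop))
    refine h.continuousAt hop hom ?_
    simp; linarith
  have he : (fun w => g (w + Complex.I*op/2)) =ᶠ[𝓝[≠] (z + Complex.I*op/2)]
      fun w => 2 * Complex.cosh (Real.pi * w / om) * g (w - Complex.I*op/2) :=
    (eventually_cosh_ne_zero (ne_zero_of_re_pos hom) _).mono fun w hw => h.funEqp w hw
  have := tendsto_nhds_unique_of_eventuallyEq (hc1.tendsto.mono_left nhdsWithin_le_nhds)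
    (hc2.tendsto.mono_left nhdsWithin_le_nhds) he
  rwa [add_sub_cancel_right, add_assoc, add_halves] at this

/-- `shift` read downwards. -/
theorem IsHypGamma.unshift {op om z : ℂ} {g : ℂ → ℂ} (h : IsHypGamma op om g)
    (hop : 0 < op.re) (hom : 0 < om.re) (hz : (op.re-om.re)/2 < z.im) :
    g z = 2 * Complex.cosh (Real.pi * (z - Complex.I*op/2) / om) * g (z - Complex.I*op) := by
  have := h.shift (z := z - Complex.I*op) hop hom (by simp; linarith)
  rw [sub_add_cancel] at this
  rw [this]
  ring_nf

/-- Induction on the imaginary part, in steps of `Re ω₊`, starting from the strip. -/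
theorem halfPlane_induction {op om : ℂ} (hop : 0 < op.re) (hom : 0 < om.re) {P : ℂ → Prop}
    (h0 : ∀ z : ℂ, |z.im| < (op.re+om.re)/2 → P z)
    (h1 : ∀ z : ℂ, (op.re+om.re)/2 ≤ z.im → P (z - Complex.I*op) → P z)
    {z : ℂ} (hz : -(op.re+om.re)/2 < z.im) : P z := by
  have key : ∀ N : ℕ, ∀ z : ℂ, -(op.re+om.re)/2 < z.im → z.im < (op.re+om.re)/2 + N*op.re → P z := by
    intro N
    induction N with
    | zero =>
      intro z hz hz'
      refine h0 z (abs_lt.mpr ⟨by linarith, by simpa using hz'⟩)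
    | succ N ih =>
      intro z hz hz'
      rcases lt_or_ge z.im ((op.re+om.re)/2) with hlt | hge
      · exact h0 z (abs_lt.mpr ⟨by linarith, hlt⟩)
      · refine h1 z hge (ih _ ?_ ?_)
        · simp; linarith
        · push_cast at hz'; simp; linarith
  obtain ⟨N, hN⟩ := exists_nat_gt ((z.im - (op.re+om.re)/2)/op.re)
  rw [div_lt_iff₀ hop] at hN
  exact key N z hz (by linarith)

theorem IsHypGamma.differentiableAt {op om z : ℂ} {g : ℂ → ℂ} (h : IsHypGamma op om g)
    (hop : 0 < op.re) (hom : 0 < om.re) (hz : -(op.re+om.re)/2 < z.im) :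
    DifferentiableAt ℂ g z := by
  refine halfPlane_induction hop hom (P := fun z => DifferentiableAt ℂ g z) ?_ ?_ hz
  · intro z hz
    have ho : IsOpen {w : ℂ | |w.im| < (op.re+om.re)/2} :=
      isOpen_lt (by fun_prop) continuous_const
    refine (differentiableAt_hypGammaInt hom hop (by rwa [half_add_re])).congr_of_eventuallyEq ?_
    filter_upwards [ho.mem_nhds hz] with w hw
    exact h.strip w (by rw [half_add_re]; exact hw)
  · intro z hz ih
    have ho : IsOpen {w : ℂ | (op.re-om.re)/2 < w.im} :=
      isOpen_lt continuous_const (by fun_prop)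
    have hz' : (op.re-om.re)/2 < z.im := by linarith
    have : DifferentiableAt ℂ (fun w =>
        2 * Complex.cosh (Real.pi * (w - Complex.I*op/2) / om) * g (w - Complex.I*op)) z :=
      DifferentiableAt.mul (by fun_prop)
        (DifferentiableAt.comp z (g := g) (f := fun w => w - Complex.I*op) ih (by fun_prop))
    refine this.congr_of_eventuallyEq ?_
    filter_upwards [ho.mem_nhds hz'] with w hw
    exact h.unshift hop hom hw

/-- Joint continuity in the first period and the argument. -/
theorem continuousAt_hypGamma {G : ℂ → ℂ → ℂ → ℂ}
    (hG : ∀ a b : ℂ, 0 < a.re → 0 < b.re → IsHypGamma a b (G a b)) {op om z : ℂ}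
    (hop : 0 < op.re) (hom : 0 < om.re) (hz : -(op.re+om.re)/2 < z.im) :
    ContinuousAt (fun p : ℂ × ℂ => G p.1 om p.2) (op, z) := by
  have hpos : ∀ z, ∀ᶠ p : ℂ × ℂ in 𝓝 (op, z), 0 < p.1.re := fun z =>
    ((Complex.continuous_re.comp continuous_fst).tendsto (op, z)).eventually_const_lt hop
  refine halfPlane_induction hop hom
    (P := fun z => ContinuousAt (fun p : ℂ × ℂ => G p.1 om p.2) (op, z)) ?_ ?_ hz
  · intro z hz
    have ho : IsOpen {p : ℂ × ℂ | |p.2.im| < (p.1.re+om.re)/2} :=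
      isOpen_lt (by fun_prop) (by fun_prop)
    refine (continuousAt_hypGammaInt hom hop (by rwa [half_add_re])).congr ?_
    filter_upwards [ho.mem_nhds hz, hpos z] with p hp hp1
    exact ((hG p.1 om hp1 hom).strip p.2 (by rw [half_add_re]; exact hp)).symm
  · intro z hz ih
    have ho : IsOpen {p : ℂ × ℂ | (p.1.re-om.re)/2 < p.2.im} :=
      isOpen_lt (by fun_prop) (by fun_prop)
    have hz' : (op.re-om.re)/2 < z.im := by linarith
    have : ContinuousAt (fun p : ℂ × ℂ =>
        2 * Complex.cosh (Real.pi * (p.2 - Complex.I*p.1/2) / om) * G p.1 om (p.2 - Complex.I*p.1))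
        (op, z) :=
      ContinuousAt.mul (by fun_prop)
        (ContinuousAt.comp (x := (op, z)) (g := fun p : ℂ × ℂ => G p.1 om p.2)
          (f := fun p : ℂ × ℂ => (p.1, p.2 - Complex.I*p.1)) ih (by fun_prop))
    refine this.congr ?_
    filter_upwards [ho.mem_nhds hz', hpos z] with p hp hp1
    exact ((hG p.1 om hp1 hom).unshift hp1 hom hp).symm

theorem IsHypGamma.mul_neg_strip {op om z : ℂ} {g : ℂ → ℂ} (h : IsHypGamma op om g)
    (hz : |z.im| < (op.re+om.re)/2) : g z * g (-z) = 1 := by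
  rw [h.strip z (by rwa [half_add_re]), h.strip (-z) (by rw [half_add_re]; simpa using hz),
    hypGammaInt_neg]

theorem cosh_eq_zero_iff_exists {w om : ℂ} (hom : om ≠ 0) (h : Complex.cosh (Real.pi * w / om) = 0) :
    ∃ k : ℤ, w = Complex.I * om * (k + 1/2) := by
  rw [← Complex.cos_mul_I, Complex.cos_eq_zero_iff] at h
  obtain ⟨k, hk⟩ := h
  refine ⟨-k-1, ?_⟩
  have hpi : (Real.pi : ℂ) ≠ 0 := by exact_mod_cast Real.pi_ne_zero
  field_simp at hk
  have : w * Complex.I * Complex.I = om * (2*k+1) / 2 * Complex.I := by linear_combination Complex.I/2 * hk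
  rw [mul_assoc, Complex.I_mul_I] at this
  push_cast
  linear_combination -this

/-- Reflection equation on the half plane, away from the zeros of `g`. -/
theorem IsHypGamma.mul_neg {op om z : ℂ} {g : ℂ → ℂ} (h : IsHypGamma op om g)
    (hop : 0 < op.re) (hom : 0 < om.re) (hz : -(op.re+om.re)/2 < z.im)
    (hz' : ∀ m n : ℕ, z ≠ Complex.I*((op+om)/2 + m*op + n*om)) : g z * g (-z) = 1 := by
  revert hz'
  refine halfPlane_induction hop hom (P := fun z =>
    (∀ m n : ℕ, z ≠ Complex.I*((op+om)/2 + m*op + n*om)) → g z * g (-z) = 1) ?_ ?_ hz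
  · exact fun z hz _ => h.mul_neg_strip hz
  · intro z hz ih hz'
    have hc : Complex.cosh (Real.pi * (z - Complex.I*op/2) / om) ≠ 0 := by
      intro h0
      obtain ⟨k, hk⟩ := cosh_eq_zero_iff_exists (ne_zero_of_re_pos hom) h0
      have hk' : z = Complex.I*((op+om)/2 + (0:ℕ)*op + k*om) := by
        push_cast; linear_combination hk
      have hk0 : 0 ≤ k := by
        by_contra hneg
        have hkk : k ≤ -1 := by omega
        have : (k:ℝ) ≤ -1 := by exact_mod_cast hkk
        rw [hk'] at hz
        simp at hz
        nlinarith
      lift k to ℕ using hk0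
      exact hz' 0 k (by simpa using hk')
    have e1 := h.unshift (z := z) hop hom (by linarith)
    have e2 := h.funEqp (-z + Complex.I*op/2) (by
      rwa [show (Real.pi:ℂ) * (-z + Complex.I*op/2) / om = -(Real.pi * (z - Complex.I*op/2) / om) by ring,
        Complex.cosh_neg])
    rw [show (Real.pi:ℂ) * (-z + Complex.I*op/2) / om = -(Real.pi * (z - Complex.I*op/2) / om) by ring,
        Complex.cosh_neg, add_sub_cancel_right,
        show -z + Complex.I*op/2 + Complex.I*op/2 = -(z - Complex.I*op) by ring] at e2
    have e3 := ih fun m n hmn => hz' (m+1) n (by push_cast; linear_combination hmn)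
    rw [e2] at e3
    rw [e1, ← e3]; ring

/-- `Re (z / (ω₊ω₋))`. -/
def ell (op om z : ℂ) : ℝ := (z/(op*om)).re

theorem ell_add (op om z w : ℂ) : ell op om (z+w) = ell op om z + ell op om w := by
  simp [ell, add_div]

theorem ell_sub (op om z w : ℂ) : ell op om (z-w) = ell op om z - ell op om w := by
  simp [ell, sub_div]

theorem ell_neg (op om z : ℂ) : ell op om (-z) = -ell op om z := by
  simp [ell, neg_div]

theorem ell_real_mul (op om z : ℂ) (t : ℝ) : ell op om (t*z) = t*ell op om z := by
  simp only [ell, mul_div_assoc, Complex.re_ofReal_mul]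

theorem ell_nat_mul (op om z : ℂ) (t : ℕ) : ell op om (t*z) = t*ell op om z := by
  exact_mod_cast ell_real_mul op om z t

theorem ell_half (op om z : ℂ) : ell op om (z/2) = ell op om z/2 := by
  have := ell_real_mul op om z (1/2)
  push_cast at this
  rw [show z/2 = 1/2*z by ring, this]; ring

theorem inv_re_pos {a : ℂ} (ha : 0 < a.re) : 0 < (a⁻¹).re := by
  rw [Complex.inv_re]
  exact div_pos ha (Complex.normSq_pos.mpr (ne_zero_of_re_pos ha))

theorem ell_op {op om : ℂ} (hop : 0 < op.re) : ell op om op = (om⁻¹).re := by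
  have := ne_zero_of_re_pos hop
  simp only [ell]
  rw [div_mul_cancel_left₀ this]

theorem ell_om {op om : ℂ} (hom : 0 < om.re) : ell op om om = (op⁻¹).re := by
  have := ne_zero_of_re_pos hom
  simp only [ell]
  rw [div_mul_cancel_right₀ this]

theorem IsHypGamma.mul_neg_of_ell {op om A : ℂ} {g : ℂ → ℂ} (h : IsHypGamma op om g)
    (hop : 0 < op.re) (hom : 0 < om.re) (hA : A.re < 0) (hA' : 0 < ell op om (op+om+A)) :
    g (-Complex.I*((op+om)/2+A)) * g (Complex.I*((op+om)/2+A)) = 1 := by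
  have := h.mul_neg (z := -Complex.I*((op+om)/2+A)) hop hom (by simp; linarith) ?_
  · simpa using this
  · intro m n hmn
    have e : op+om+A = -(m*op) - n*om := by
      refine mul_left_cancel₀ Complex.I_ne_zero ?_
      linear_combination -hmn
    rw [e, ell_sub, ell_neg, ell_nat_mul, ell_nat_mul, ell_op hop, ell_om hom] at hA'
    have h1 : 0 ≤ m * (om⁻¹).re := mul_nonneg (by positivity) (inv_re_pos hom).le
    have h2 : 0 ≤ n * (op⁻¹).re := mul_nonneg (by positivity) (inv_re_pos hop).le
    linarith

theorem IsHypGamma.ne_zero_of_ell {op om A : ℂ} {g : ℂ → ℂ} (h : IsHypGamma op om g)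
    (hop : 0 < op.re) (hom : 0 < om.re) (hA : A.re < 0) (hA' : 0 < ell op om (op+om+A)) :
    g (-Complex.I*((op+om)/2+A)) ≠ 0 :=
  left_ne_zero_of_mul_eq_one (h.mul_neg_of_ell hop hom hA hA')

theorem cosh_add_pi_I_div_two (u : ℂ) :
    Complex.cosh (u + Real.pi*Complex.I/2) = Complex.I * Complex.sinh u := by
  rw [Complex.cosh_add, show (Real.pi:ℂ)*Complex.I/2 = (Real.pi/2)*Complex.I by ring,
    Complex.cosh_mul_I, Complex.sinh_mul_I, Complex.cos_pi_div_two, Complex.sin_pi_div_two]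
  ring

/-- Shift by a full period written with `sinh`. -/
theorem IsHypGamma.shift_sinh {op om A : ℂ} {g : ℂ → ℂ} (h : IsHypGamma op om g)
    (hop : 0 < op.re) (hom : 0 < om.re) (hA : A.re < 0) :
    g (-Complex.I*((op+om)/2+(A-op))) =
      2 * Complex.I * Complex.sinh (Real.pi * (Complex.I*A) / om) *
        g (-Complex.I*((op+om)/2+A)) := by
  have h2 := ne_zero_of_re_pos hom
  have := h.shift (z := -Complex.I*((op+om)/2+A)) hop hom (by simp; linarith)
  rw [show (Real.pi:ℂ)*(-Complex.I*((op+om)/2+A) + Complex.I*op/2)/om =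
      -(Real.pi*(Complex.I*A)/om + Real.pi*Complex.I/2) by field_simp; ring,
    Complex.cosh_neg, cosh_add_pi_I_div_two] at this
  rw [show -Complex.I*((op+om)/2+(A-op)) = -Complex.I*((op+om)/2+A) + Complex.I*op by ring, this]
  ring

theorem IsHypGamma.mul_top {op om : ℂ} {g : ℂ → ℂ} (h : IsHypGamma op om g)
    (hop : 0 < op.re) (hom : 0 < om.re) {x : ℂ} (hx : x.im = 0) :
    g (x + Complex.I*((op+om)/2)) * g (-x + Complex.I*((op+om)/2)) =
      4 * Complex.sinh (Real.pi*x/op) * Complex.sinh (Real.pi*x/om) := by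
  have h1 := ne_zero_of_re_pos hop
  have h2 := ne_zero_of_re_pos hom
  have e1 := h.unshift (z := x + Complex.I*((op+om)/2)) hop hom (by simp [hx]; linarith)
  have e2 := h.swap.unshift (z := -x + Complex.I*((op+om)/2)) hom hop (by simp [hx]; linarith)
  rw [e1, e2, show (Real.pi:ℂ)*(x + Complex.I*((op+om)/2) - Complex.I*op/2)/om =
      Real.pi*x/om + Real.pi*Complex.I/2 by field_simp; ring,
    show (Real.pi:ℂ)*(-x + Complex.I*((op+om)/2) - Complex.I*om/2)/op =
      -(Real.pi*x/op) + Real.pi*Complex.I/2 by field_simp; ring,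
    cosh_add_pi_I_div_two, cosh_add_pi_I_div_two, Complex.sinh_neg]
  have e3 := h.mul_neg_strip (z := x + Complex.I*((op+om)/2) - Complex.I*op) (by
    simp [hx, abs_lt]; constructor <;> linarith)
  rw [show -(x + Complex.I*((op+om)/2) - Complex.I*op) = -x + Complex.I*((op+om)/2) - Complex.I*om by ring] at e3
  linear_combination 4 * Complex.sinh (Real.pi*x/op) * Complex.sinh (Real.pi*x/om) * e3 -
    4 * Complex.sinh (Real.pi*x/op) * Complex.sinh (Real.pi*x/om) *
      g (x + Complex.I*((op+om)/2) - Complex.I*op) * g (-x + Complex.I*((op+om)/2) - Complex.I*om) *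
      Complex.I_mul_I

theorem mul_mem_slitPlane {a b : ℂ} (ha : 0 < a.re) (hb : 0 < b.re) : a*b ∈ Complex.slitPlane := by
  rw [Complex.mem_slitPlane_iff, or_iff_not_imp_right, not_not, Complex.mul_im, Complex.mul_re]
  intro h
  have : a.re * (a.re*b.re - a.im*b.im) = (a.re^2 + a.im^2)*b.re := by linear_combination -a.im*h
  have h2 : 0 < a.re * (a.re*b.re - a.im*b.im) := by rw [this]; positivity
  exact (mul_pos_iff_of_pos_left ha).mp h2

theorem mul_cosh_quarter (X : ℂ) : (2 * Complex.cosh (X - Real.pi*Complex.I/4)) *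
    (2 * Complex.cosh (X + Real.pi*Complex.I/4)) = 2 * Complex.cosh (2*X) := by
  have h1 : (Real.pi:ℂ)*Complex.I/4 = (Real.pi/4)*Complex.I := by ring
  have h2 := Complex.cosh_sq_sub_sinh_sq X
  have h3 := Complex.cos_two_mul (Real.pi/4)
  have h4 := Complex.sin_sq_add_cos_sq (Real.pi/4)
  rw [show 2*((Real.pi:ℂ)/4) = Real.pi/2 by ring, Complex.cos_pi_div_two] at h3
  rw [h1, Complex.cosh_add, Complex.cosh_sub, Complex.cosh_mul_I, Complex.sinh_mul_I,
    Complex.cosh_two_mul]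
  linear_combination (-2*(Complex.cosh X)^2 + 2*(Complex.sinh X)^2) * h3 +
    4*(Complex.sinh X)^2*h4 -4 * (Complex.sinh X)^2*(Complex.sin (Real.pi/4))^2 * Complex.I_sq

/-- Duplication formula on the half plane. -/
theorem IsHypGamma.dup {op om z : ℂ} {g G : ℂ → ℂ} (h : IsHypGamma op om g)
    (H : IsHypGamma op (om/2) G) (hop : 0 < op.re) (hom : 0 < om.re)
    (hz : -(op.re+om.re/2)/2 < z.im) :
    G z = g (z - Complex.I*om/4) * g (z + Complex.I*om/4) := by
  have hom2 : (om/2).re = om.re/2 := by simp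
  have hom0 := ne_zero_of_re_pos hom
  refine halfPlane_induction (op := op) (om := om/2) hop (by rw [hom2]; linarith)
    (P := fun z => G z = g (z - Complex.I*om/4) * g (z + Complex.I*om/4)) ?_ ?_ (by rwa [hom2])
  · intro z hz
    rw [hom2, abs_lt] at hz
    rw [H.strip z (by rw [half_add_re, hom2, abs_lt]; exact hz), hypGammaInt_dup hop hom
      (by rw [half_add_re, hom2, abs_lt]; exact hz),
      h.strip _ (by rw [half_add_re, abs_lt]; simp; constructor <;> linarith),
      h.strip _ (by rw [half_add_re, abs_lt]; simp; constructor <;> linarith)]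
  · intro z hz ih
    rw [hom2] at hz
    rw [H.unshift hop (by rw [hom2]; linarith) (by rw [hom2]; linarith), ih,
      h.unshift (z := z - Complex.I*om/4) hop hom (by simp; linarith),
      h.unshift (z := z + Complex.I*om/4) hop hom (by simp; linarith)]
    have := mul_cosh_quarter (Real.pi*(z - Complex.I*op/2)/om)
    rw [show (Real.pi:ℂ)*(z - Complex.I*om/4 - Complex.I*op/2)/om =
      Real.pi*(z - Complex.I*op/2)/om - Real.pi*Complex.I/4 by field_simp; ring,
      show (Real.pi:ℂ)*(z + Complex.I*om/4 - Complex.I*op/2)/om =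
      Real.pi*(z - Complex.I*op/2)/om + Real.pi*Complex.I/4 by field_simp; ring,
      show (Real.pi:ℂ)*(z - Complex.I*op/2)/(om/2) = 2*(Real.pi*(z - Complex.I*op/2)/om) by field_simp,
      ← this]
    ring_nf

/-- `g(z+iω)` through the half-period shifts. -/
theorem IsHypGamma.shift_top {op om z : ℂ} {g : ℂ → ℂ} (h : IsHypGamma op om g)
    (hop : 0 < op.re) (hom : 0 < om.re) (hz : -om.re < z.im) :
    g (z + Complex.I*((op+om)/2)) =
      2 * Complex.I * Complex.sinh (Real.pi*z/om) * g (z + Complex.I*(om-op)/2) := by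
  have h2 := ne_zero_of_re_pos hom
  rw [h.unshift (z := z + Complex.I*((op+om)/2)) hop hom (by simp; linarith),
    show (Real.pi:ℂ)*(z + Complex.I*((op+om)/2) - Complex.I*op/2)/om =
      Real.pi*z/om + Real.pi*Complex.I/2 by field_simp; ring, cosh_add_pi_I_div_two,
    show z + Complex.I*((op+om)/2) - Complex.I*op = z + Complex.I*(om-op)/2 by ring]
  ring

theorem hasDerivAt_sinh_mul {c : ℂ} {f : ℂ → ℂ} (hf : DifferentiableAt ℂ f 0) :
    HasDerivAt (fun z => Complex.sinh (c*z) * f z) (c * f 0) 0 := by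
  have h1 : HasDerivAt (fun z => Complex.sinh (c*z)) (Complex.cosh (c*0) * (c*1)) 0 :=
    ((hasDerivAt_id (0:ℂ)).const_mul c).csinh
  refine (h1.mul hf.hasDerivAt).congr_deriv ?_
  simp

theorem IsHypGamma.sq_value {op om : ℂ} {g : ℂ → ℂ} (h : IsHypGamma op om g)
    (hop : 0 < op.re) (hom : 0 < om.re) : (g (Complex.I*(op-om)/2))^2 * om = op := by
  have h1 := ne_zero_of_re_pos hop
  have h2 := ne_zero_of_re_pos hom
  have d1 : DifferentiableAt ℂ (fun z => g (z + Complex.I*(om-op)/2)) 0 :=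
    DifferentiableAt.comp 0 (g := g) (f := fun z => z + Complex.I*(om-op)/2)
      (h.differentiableAt hop hom (by simp; linarith)) (by fun_prop)
  have d2 : DifferentiableAt ℂ (fun z => g (z + Complex.I*(op-om)/2)) 0 :=
    DifferentiableAt.comp 0 (g := g) (f := fun z => z + Complex.I*(op-om)/2)
      (h.differentiableAt hop hom (by simp; linarith)) (by fun_prop)
  have e1 := hasDerivAt_sinh_mul (c := Real.pi/om) d1
  have e2 := hasDerivAt_sinh_mul (c := Real.pi/op) d2
  have heq : (fun z => Complex.sinh (Real.pi/om*z) * g (z + Complex.I*(om-op)/2)) =ᶠ[𝓝 0]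
      fun z => Complex.sinh (Real.pi/op*z) * g (z + Complex.I*(op-om)/2) := by
    have o1 : ∀ᶠ z : ℂ in 𝓝 0, -om.re < z.im :=
      (Complex.continuous_im.tendsto 0).eventually_const_lt (by simpa using hom)
    have o2 : ∀ᶠ z : ℂ in 𝓝 0, -op.re < z.im :=
      (Complex.continuous_im.tendsto 0).eventually_const_lt (by simpa using hop)
    filter_upwards [o1, o2] with z hz1 hz2
    have a1 := h.shift_top hop hom hz1
    have a2 := h.swap.shift_top hom hop hz2
    rw [add_comm om op, a1] at a2
    rw [div_mul_eq_mul_div, div_mul_eq_mul_div]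
    have : 2*Complex.I ≠ 0 := by simp
    refine mul_left_cancel₀ this ?_
    linear_combination a2
  have hd := (e1.congr_of_eventuallyEq heq.symm).unique e2
  simp only [zero_add] at hd
  have hr := h.mul_neg_strip (z := Complex.I*(op-om)/2) (by simp [abs_lt]; constructor <;> linarith)
  rw [show -(Complex.I*(op-om)/2) = Complex.I*(om-op)/2 by ring] at hr
  have hpi : (Real.pi : ℂ) ≠ 0 := by exact_mod_cast Real.pi_ne_zero
  field_simp at hd
  linear_combination -(g (Complex.I*(op-om)/2))*hd + op*hr

theorem hypGammaInt_zero (op om : ℂ) : hypGammaInt op om 0 = 1 := by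
  rw [hypGammaInt_eq]
  simp [hgKer]

theorem hypGamma_value {G : ℂ → ℂ → ℂ → ℂ}
    (hG : ∀ a b : ℂ, 0 < a.re → 0 < b.re → IsHypGamma a b (G a b)) {op om : ℂ}
    (hop : 0 < op.re) (hom : 0 < om.re) :
    G op om (Complex.I*(op-om)/2) * om = (op*om)^((1:ℂ)/2) := by
  have hconv : Convex ℝ {a : ℂ | 0 < a.re} := convex_halfSpace_re_gt 0
  have hsq : ∀ z : ℂ, (z^((1:ℂ)/2))^2 = z := fun z => by
    have := Complex.cpow_nat_inv_pow z (n := 2) two_ne_zero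
    simpa using this
  refine hconv.isPreconnected.eq_of_sq_eq (f := fun a : ℂ => G a om (Complex.I*(a-om)/2) * om)
    (g := fun a : ℂ => (a*om)^((1:ℂ)/2)) ?_ ?_ ?_ ?_ (y := om) hom ?_ hop
  · intro a ha
    have ha : 0 < a.re := ha
    refine ContinuousAt.continuousWithinAt (ContinuousAt.mul ?_ continuousAt_const)
    exact ContinuousAt.comp (x := a) (g := fun p : ℂ × ℂ => G p.1 om p.2)
          (f := fun a : ℂ => (a, Complex.I*(a-om)/2))
          (continuousAt_hypGamma hG ha hom (by simp; linarith)) (by fun_prop)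
  · intro a ha
    have ha : 0 < a.re := ha
    exact ContinuousAt.continuousWithinAt
      ((continuousAt_id.mul continuousAt_const).cpow continuousAt_const (mul_mem_slitPlane ha hom))
  · intro a ha
    have := (hG a om ha hom).sq_value ha hom
    simp only [Pi.pow_apply, hsq]
    linear_combination om*this
  · intro a ha
    simp [ne_zero_of_re_pos ha, ne_zero_of_re_pos hom]
  · simp only [sub_self, mul_zero, zero_div]
    rw [(hG om om hom hom).strip 0 (by simpa using hom), hypGammaInt_zero]
    have := Complex.sq_cpow_two_inv hom
    rw [one_mul, ← sq, one_div]
    exact this.symm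

/-- The Fejér-type kernel `(1 - cos 2yx)/y²`. -/
def fejerKer (x y : ℝ) : ℝ := (1 - Real.cos (2*y*x))/y^2

theorem fejerKer_nonneg (x y : ℝ) : 0 ≤ fejerKer x y :=
  div_nonneg (by linarith [Real.cos_le_one (2*y*x)]) (sq_nonneg y)

theorem fejerKer_le (x : ℝ) {y : ℝ} (hy : 0 < y) :
    fejerKer x y ≤ (2*x^2+2) * (2/(1+y^2)) := by
  rw [fejerKer, mul_div_assoc', div_le_div_iff₀ (by positivity) (by positivity)]
  have h1 := Real.one_sub_sq_div_two_le_cos (x := 2*y*x)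
  have h2 := Real.neg_one_le_cos (2*y*x)
  have h3 := Real.cos_le_one (2*y*x)
  nlinarith [mul_nonneg (sq_nonneg y) (sub_nonneg.mpr h3), sq_nonneg (x*y), sq_nonneg y]

theorem integrableOn_inv_one_add_sq : IntegrableOn (fun y : ℝ => 1/(1+y^2)) (Ioi 0) := by
  simpa [one_div] using integrable_inv_one_add_sq.integrableOn

theorem integrableOn_fejerKer (x : ℝ) : IntegrableOn (fejerKer x) (Ioi 0) := by
  refine Integrable.mono' ((integrableOn_inv_one_add_sq.const_mul 2).const_mul (2*x^2+2)) ?_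
    ((ae_restrict_iff' measurableSet_Ioi).mpr (Eventually.of_forall fun y hy => ?_))
  · exact (Measurable.div (by fun_prop) (by fun_prop)).aestronglyMeasurable
  · rw [Real.norm_of_nonneg (fejerKer_nonneg x y)]
    simpa [div_eq_mul_inv] using fejerKer_le x hy

theorem integral_fejerKer (x : ℝ) :
    ∫ y in Ioi (0:ℝ), fejerKer x y = |x| * ∫ y in Ioi (0:ℝ), fejerKer 1 y := by
  rcases eq_or_ne x 0 with rfl | hx
  · simp [fejerKer]
  have hx' : 0 < |x| := abs_pos.mpr hx
  have h := integral_comp_mul_left_Ioi' (fun y => fejerKer 1 y) 0 hx'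
  rw [mul_zero] at h
  rw [← h, smul_eq_mul, ← mul_assoc, ← integral_const_mul]
  congr 1
  ext y
  simp only [fejerKer, mul_one]
  rw [show Real.cos (2*(|x| * y)) = Real.cos (2*y*x) by
    rcases abs_choice x with h | h <;> rw [h]
    · ring_nf
    · rw [← Real.cos_neg]; ring_nf]
  rw [mul_pow, sq_abs]
  have : |x| * |x| = x^2 := by rw [abs_mul_abs_self, sq]
  rw [this]
  field_simp

def coshKer (op om a b : ℂ) (y : ℝ) : ℂ :=
  (Complex.cosh (2*y*a) - Complex.cosh (2*y*b)) /
    (2*y*(Complex.sinh (op*y) * Complex.sinh (om*y)))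

theorem hgKer_pair (op om a b : ℂ) (x : ℝ) {y : ℝ} (hy : 0 < y) :
    Complex.I * (hgKer op om (x - Complex.I*a) y + hgKer op om (-x - Complex.I*b) y) =
      Real.cos (2*y*x) * (Complex.I * hgKer op om (-Complex.I*a) y +
        Complex.I * hgKer op om (-Complex.I*b) y) - (a+b)/(op*om) * fejerKer x y +
      Complex.I * (Real.sin (2*y*x) * coshKer op om a b y) := by
  have hy0 : (y:ℂ) ≠ 0 := by exact_mod_cast hy.ne'
  have e1 : ∀ c : ℂ, Complex.sin (2*y*(-Complex.I*c)) = -(Complex.sinh (2*y*c) * Complex.I) := by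
    intro c
    rw [show 2*(y:ℂ)*(-Complex.I*c) = -(2*y*c*Complex.I) by ring, Complex.sin_neg,
      Complex.sin_mul_I]
  have e2 : ∀ s c : ℂ, Complex.sin (2*y*(s - Complex.I*c)) = Complex.sin (2*y*s) * Complex.cosh (2*y*c)
      - Complex.cos (2*y*s) * (Complex.sinh (2*y*c) * Complex.I) := by
    intro s c
    rw [show 2*(y:ℂ)*(s - Complex.I*c) = 2*y*s - 2*y*c*Complex.I by ring, Complex.sin_sub,
      Complex.cos_mul_I, Complex.sin_mul_I]
  simp only [hgKer, coshKer, fejerKer, e1, e2]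
  push_cast
  rw [show (2:ℂ)*y*(-x) = -(2*y*x) by ring, Complex.sin_neg, Complex.cos_neg]
  generalize Complex.sin (2*y*x) = s
  generalize Complex.cos (2*y*x) = c
  generalize Complex.sinh (2*y*a) = sa
  generalize Complex.sinh (2*y*b) = sb
  generalize Complex.cosh (2*y*a) = ca
  generalize Complex.cosh (2*y*b) = cb
  simp only [div_eq_mul_inv, mul_inv]
  generalize (Complex.sinh (op*y))⁻¹ = S
  generalize (Complex.sinh (om*y))⁻¹ = S'
  generalize op⁻¹ = P
  generalize om⁻¹ = P'
  generalize hz : (y:ℂ)⁻¹ = z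
  rw [show ((y:ℂ)^2)⁻¹ = z^2 by rw [← hz, inv_pow]]
  linear_combination (1-c)*(a+b)*P*P'*z^2*Complex.I_sq

theorem norm_sinh_le_of_norm_le {w : ℂ} {R : ℝ} (hw : ‖w‖ ≤ R) :
    ‖Complex.sinh w‖ ≤ ‖w‖ * (1 + R^2*Real.exp R) := by
  have h := norm_sinh_sub_le w
  have h2 : ‖Complex.sinh w‖ ≤ ‖Complex.sinh w - w‖ + ‖w‖ := by
    simpa using norm_add_le (Complex.sinh w - w) w
  have h3 : ‖w‖^2 * Real.exp ‖w‖ ≤ R^2 * Real.exp R := by gcongr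
  nlinarith [norm_nonneg w]

theorem norm_cosh_le_exp (w : ℂ) : ‖Complex.cosh w‖ ≤ Real.exp |w.re| := by
  rw [← Complex.cos_mul_I]
  simpa using norm_cos_le_exp (w * Complex.I)

theorem exists_coshKer_bound (R m δ : ℝ) (hm : 0 < m) (hδ : 0 < δ) : ∃ C : ℝ, 0 < C ∧
    ∀ op om a b : ℂ, ‖a‖ ≤ R → ‖b‖ ≤ R → m ≤ op.re → m ≤ om.re →
      |a.re| ≤ (op.re + om.re)/2 - δ → |b.re| ≤ (op.re + om.re)/2 - δ → ∀ y : ℝ, 0 < y →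
      ‖coshKer op om a b y‖ ≤ C * Real.exp (-2*δ*y) / y := by
  set q : ℝ := (1 - Real.exp (-2*m)) / 2 with hq
  have hq0 : 0 < q := by
    have : Real.exp (-2*m) < 1 := Real.exp_lt_one_iff.mpr (by linarith)
    rw [hq]; linarith
  set L : ℝ := R*(1+R^2*Real.exp R) with hL
  set C1 := 2*L^2/m^2*Real.exp (2*δ) with hC1
  set C2 := 1/q^2 with hC2
  have hC2p : 0 < C2 := by positivity
  have hC1p : 0 ≤ C1 := by positivity
  refine ⟨C1 + C2, by positivity, ?_⟩
  intro op om a b ha hb hop hom har hbr y hy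
  have hyn : ‖(y:ℂ)‖ = y := by rw [Complex.norm_real, Real.norm_of_nonneg hy.le]
  have hsp := mul_le_norm_sinh hm.le hop hy.le
  have hsm := mul_le_norm_sinh hm.le hom hy.le
  have hmy : 0 < m * y := by positivity
  have hR : 0 ≤ R := (norm_nonneg _).trans ha
  have key : ‖Complex.cosh (2*y*a) - Complex.cosh (2*y*b)‖ ≤ 2 * ((C1 + C2) * Real.exp (-2*δ*y)) *
      (‖Complex.sinh (op*y)‖ * ‖Complex.sinh (om*y)‖) := by
    rcases le_total y 1 with hy1 | hy1
    · have e1 : ∀ c : ℂ, Complex.cosh (2*y*c) - 1 = 2*Complex.sinh (y*c)^2 := fun c => by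
        rw [show 2*(y:ℂ)*c = 2*(y*c) by ring, Complex.cosh_two_mul]
        linear_combination Complex.cosh_sq_sub_sinh_sq (y*c)
      have e2 : ∀ c : ℂ, ‖c‖ ≤ R → ‖Complex.cosh (2*y*c) - 1‖ ≤ 2*(y*L)^2 := fun c hc => by
        rw [e1, norm_mul, norm_pow]
        have hn : ‖(y:ℂ)*c‖ ≤ y*R := by rw [norm_mul, hyn]; gcongr
        have hn1 : ‖(y:ℂ)*c‖ ≤ R := hn.trans (mul_le_of_le_one_left hR hy1)
        have h3 : ‖Complex.sinh (y*c)‖ ≤ y*L := by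
          refine (norm_sinh_le_of_norm_le hn1).trans ?_
          rw [hL, ← mul_assoc]; gcongr
        rw [Complex.norm_two]
        gcongr
      have e3 : ‖Complex.cosh (2*y*a) - Complex.cosh (2*y*b)‖ ≤ 4*(y*L)^2 := by
        rw [show Complex.cosh (2*y*a) - Complex.cosh (2*y*b) =
          (Complex.cosh (2*y*a) - 1) - (Complex.cosh (2*y*b) - 1) by ring]
        refine (norm_sub_le _ _).trans ?_
        linarith [e2 a ha, e2 b hb]
      have e4 : C1 * Real.exp (-2*δ*y) ≥ 2*L^2/m^2 := by
        rw [hC1, mul_assoc, ← Real.exp_add]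
        refine le_mul_of_one_le_right (by positivity) (Real.one_le_exp ?_)
        nlinarith
      have e5 : m*y*(m*y) ≤ ‖Complex.sinh (op*y)‖ * ‖Complex.sinh (om*y)‖ := by gcongr
      have e6 : 2*L^2/m^2 ≤ (C1+C2) * Real.exp (-2*δ*y) := by
        have := Real.exp_pos (-2*δ*y)
        nlinarith
      calc _ ≤ 4*(y*L)^2 := e3
        _ = 2*(2*L^2/m^2)*(m*y*(m*y)) := by field_simp; ring
        _ ≤ _ := by gcongr
    · have e1 : ∀ c : ℂ, |c.re| ≤ (op.re+om.re)/2 - δ →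
          ‖Complex.cosh (2*y*c)‖ ≤ Real.exp (-2*δ*y) * (Real.exp (op.re*y) * Real.exp (om.re*y)) := by
        intro c hc
        refine (norm_cosh_le_exp _).trans ?_
        rw [← Real.exp_add, ← Real.exp_add]
        apply Real.exp_le_exp.mpr
        have : (2*(y:ℂ)*c).re = 2*y*c.re := by simp
        rw [this, abs_mul, abs_of_pos (by positivity)]
        nlinarith
      have h1 := exp_le_norm_sinh hm.le hop hy1
      have h2 := exp_le_norm_sinh hm.le hom hy1
      rw [← hq] at h1 h2
      have e5 : q*Real.exp (op.re*y)*(q*Real.exp (om.re*y)) ≤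
        ‖Complex.sinh (op*y)‖ * ‖Complex.sinh (om*y)‖ := by gcongr
      calc _ ≤ ‖Complex.cosh (2*y*a)‖ + ‖Complex.cosh (2*y*b)‖ := norm_sub_le _ _
        _ ≤ 2*(Real.exp (-2*δ*y) * (Real.exp (op.re*y) * Real.exp (om.re*y))) := by
          linarith [e1 a har, e1 b hbr]
        _ = 2*(C2*Real.exp (-2*δ*y))*(q*Real.exp (op.re*y)*(q*Real.exp (om.re*y))) := by
          rw [hC2]; field_simp
        _ ≤ _ := by gcongr; linarith
  have hS : 0 < ‖Complex.sinh (op*y)‖ * ‖Complex.sinh (om*y)‖ :=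
    mul_pos (hmy.trans_le hsp) (hmy.trans_le hsm)
  rw [coshKer, norm_div, norm_mul, norm_mul, norm_mul, hyn, Complex.norm_two,
    div_le_div_iff₀ (by positivity) hy]
  nlinarith

theorem hypGammaInt_pair {op om a b : ℂ} (hop : 0 < op.re) (hom : 0 < om.re)
    (ha : |a.re| < (op.re+om.re)/2) (hb : |b.re| < (op.re+om.re)/2) (x : ℝ) :
    IntegrableOn (fun y => Complex.I * (hgKer op om (x - Complex.I*a) y +
      hgKer op om (-x - Complex.I*b) y)) (Ioi 0) ∧
    ‖hypGammaInt op om (x - Complex.I*a) * hypGammaInt op om (-x - Complex.I*b)‖ =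
      Real.exp (∫ y in Ioi (0:ℝ), (Complex.I * (hgKer op om (x - Complex.I*a) y +
        hgKer op om (-x - Complex.I*b) y)).re) := by
  have i1 : IntegrableOn (hgKer op om (x - Complex.I*a)) (Ioi 0) :=
    integrableOn_hgKer hop hom (by rw [half_add_re]; simpa using ha)
  have i2 : IntegrableOn (hgKer op om (-x - Complex.I*b)) (Ioi 0) :=
    integrableOn_hgKer hop hom (by rw [half_add_re]; simpa using hb)
  have i3 := (i1.add i2).const_mul Complex.I
  refine ⟨i3, ?_⟩
  rw [hypGammaInt_eq, hypGammaInt_eq, ← Complex.exp_add, ← mul_add, ← integral_add i1 i2,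
    ← integral_const_mul, Complex.norm_exp]
  congr 1
  exact (integral_re (𝕜 := ℂ) i3).symm

theorem re_pair_eq (op om a b : ℂ) (x : ℝ) {y : ℝ} (hy : 0 < y) :
    (Complex.I * (hgKer op om (x - Complex.I*a) y + hgKer op om (-x - Complex.I*b) y)).re =
      Real.cos (2*y*x) * (Complex.I * hgKer op om (-Complex.I*a) y +
        Complex.I * hgKer op om (-Complex.I*b) y).re - ell op om (a+b) * fejerKer x y +
      Real.sin (2*y*x) * (Complex.I * coshKer op om a b y).re := by
  rw [hgKer_pair op om a b x hy, Complex.add_re, Complex.sub_re, Complex.re_ofReal_mul,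
    Complex.re_mul_ofReal, mul_left_comm, Complex.re_ofReal_mul]
  rfl

theorem integral_fejerKer_one {G : ℂ → ℂ → ℂ → ℂ}
    (hG : ∀ a b : ℂ, 0 < a.re → 0 < b.re → IsHypGamma a b (G a b)) :
    ∫ y in Ioi (0:ℝ), fejerKer 1 y = Real.pi := by
  set D := ∫ y in Ioi (0:ℝ), fejerKer 1 y with hD
  have h1 : (0:ℝ) < (1:ℂ).re := by simp
  have h := hG 1 1 h1 h1
  have hhalf : |(1/2:ℂ).re| < ((1:ℂ).re+(1:ℂ).re)/2 := by norm_num [abs_lt]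
  set M := ∫ y in Ioi (0:ℝ), ‖Complex.I * hgKer 1 1 (-Complex.I*(1/2)) y +
        Complex.I * hgKer 1 1 (-Complex.I*(1/2)) y‖ with hM
  have hik : IntegrableOn (hgKer 1 1 (-Complex.I*(1/2))) (Ioi 0) :=
    integrableOn_hgKer h1 h1 (by norm_num [abs_lt])
  have hi2 := (hik.const_mul Complex.I).add (hik.const_mul Complex.I)
  have hval : ∀ x : ℝ, ‖G 1 1 (x - Complex.I*(1/2)) * G 1 1 (-x - Complex.I*(1/2))‖ =
      1/(2*Real.cosh (Real.pi*x)) := by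
    intro x
    have e1 := h.shift (z := x - Complex.I*(1/2)) h1 h1 (by norm_num)
    have e2 := h.mul_neg_strip (z := -x - Complex.I*(1/2)) (by norm_num [abs_lt])
    rw [show -(-(x:ℂ) - Complex.I*(1/2)) = x - Complex.I*(1/2) + Complex.I*1 by ring, e1,
      show (Real.pi:ℂ) * (x - Complex.I*(1/2) + Complex.I*1/2)/1 = ((Real.pi*x:ℝ):ℂ) by
        push_cast; ring, ← Complex.ofReal_cosh] at e2
    have e3 : G 1 1 (x - Complex.I*(1/2)) * G 1 1 (-x - Complex.I*(1/2)) =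
        ((1/(2*Real.cosh (Real.pi*x)) : ℝ) : ℂ) := by
      have : ((Real.cosh (Real.pi*x) : ℝ) : ℂ) ≠ 0 := by
        exact_mod_cast (Real.cosh_pos _).ne'
      push_cast at this e2 ⊢
      generalize G 1 1 (-x - Complex.I*(1/2)) = A at *
      generalize G 1 1 (x - Complex.I*(1/2)) = B at *
      rw [eq_div_iff (by simpa using this)]
      linear_combination e2
    rw [e3, Complex.norm_real, Real.norm_of_nonneg]
    have := Real.cosh_pos (Real.pi*x)
    positivity
  have hexp : ∀ x : ℝ, ∃ r : ℝ, |r| ≤ M ∧ 1/(2*Real.cosh (Real.pi*x)) = Real.exp (r - |x| * D) := by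
    intro x
    refine ⟨∫ y in Ioi (0:ℝ), Real.cos (2*y*x) * (Complex.I * hgKer 1 1 (-Complex.I*(1/2)) y +
        Complex.I * hgKer 1 1 (-Complex.I*(1/2)) y).re, ?_, ?_⟩
    · rw [← Real.norm_eq_abs]
      refine norm_integral_le_of_norm_le hi2.norm (Eventually.of_forall fun y => ?_)
      rw [norm_mul, Real.norm_eq_abs, Real.norm_eq_abs]
      exact (mul_le_of_le_one_left (abs_nonneg _) (Real.abs_cos_le_one _)).trans
        (Complex.abs_re_le_norm _)
    · rw [← hval, h.strip _ (by norm_num [abs_lt]), h.strip _ (by norm_num [abs_lt]),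
        (hypGammaInt_pair h1 h1 hhalf hhalf x).2, hD, ← integral_fejerKer, ← integral_sub]
      · congr 1
        refine setIntegral_congr_fun measurableSet_Ioi fun y hy => ?_
        rw [re_pair_eq _ _ _ _ _ hy]
        simp [ell, coshKer]
        norm_num
      · refine Integrable.mono hi2 ?_ (Eventually.of_forall fun y => ?_)
        · refine AEStronglyMeasurable.mul (by fun_prop) ?_
          exact Complex.continuous_re.comp_aestronglyMeasurable hi2.1
        · rw [norm_mul, Real.norm_eq_abs, Real.norm_eq_abs]
          exact (mul_le_of_le_one_left (abs_nonneg _) (Real.abs_cos_le_one _)).trans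
            (Complex.abs_re_le_norm _)
      · exact integrableOn_fejerKer x
  have hb : ∀ x : ℝ, 0 < x → |D - Real.pi| * x ≤ M + 1 := by
    intro x hx
    obtain ⟨r, hr, he⟩ := hexp x
    rw [abs_of_pos hx] at he
    have hc : 0 < 2*Real.cosh (Real.pi*x) := by have := Real.cosh_pos (Real.pi*x); positivity
    have l1 : 2*Real.cosh (Real.pi*x) = Real.exp (x*D - r) := by
      rw [show x*D - r = -(r - x*D) by ring, Real.exp_neg, ← he]; simp
    have l2 : Real.exp (Real.pi*x) ≤ Real.exp (x*D - r) := by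
      rw [← l1, Real.cosh_eq]; have := Real.exp_pos (-(Real.pi*x)); linarith
    have l3 : Real.exp (x*D - r) ≤ Real.exp (Real.pi*x + 1) := by
      rw [← l1, Real.cosh_eq, Real.exp_add]
      have a1 := Real.add_one_le_exp (1:ℝ)
      have a2 : Real.exp (-(Real.pi*x)) ≤ Real.exp (Real.pi*x) :=
        Real.exp_le_exp.mpr (by have := mul_pos Real.pi_pos hx; linarith)
      nlinarith [Real.exp_pos (Real.pi*x)]
    rw [Real.exp_le_exp] at l2 l3
    rw [abs_le] at hr
    rw [show |D - Real.pi| * x = |(D - Real.pi)*x| by rw [abs_mul, abs_of_pos hx], abs_le]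
    constructor <;> nlinarith
  by_contra hne
  have hpos : 0 < |D - Real.pi| := abs_pos.mpr (sub_ne_zero.mpr hne)
  have hM0 : 0 ≤ M := integral_nonneg fun _ => norm_nonneg _
  have := hb ((M+2)/|D - Real.pi|) (by positivity)
  rw [mul_div_cancel₀ _ hpos.ne'] at this
  linarith

/-- Exponential decay of the pair product in the strip, locally uniform in the parameters. -/
theorem exists_hypGammaInt_pair_bound {G : ℂ → ℂ → ℂ → ℂ}
    (hG : ∀ a b : ℂ, 0 < a.re → 0 < b.re → IsHypGamma a b (G a b)) {op₀ om a₀ b₀ : ℂ}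
    (hop : 0 < op₀.re) (hom : 0 < om.re) (ha : |a₀.re| < (op₀.re+om.re)/2)
    (hb : |b₀.re| < (op₀.re+om.re)/2) {ρ : ℝ} (hρ : ρ < ell op₀ om (a₀+b₀)) :
    ∃ C : ℝ, ∀ᶠ p : ℂ × ℂ × ℂ in 𝓝 (op₀, a₀, b₀), ∀ x : ℝ,
      ‖hypGammaInt p.1 om (x - Complex.I*p.2.1) * hypGammaInt p.1 om (-x - Complex.I*p.2.2)‖ ≤
        C * Real.exp (-(Real.pi*ρ*|x|)) := by
  set R := ‖op₀‖ + ‖om‖ + ‖a₀‖ + ‖b₀‖ + 1 with hR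
  set m := min (op₀.re/2) om.re with hm
  set δ := ((op₀.re+om.re)/2 - max |a₀.re| |b₀.re|)/2 with hδ
  have hm0 : 0 < m := lt_min (by linarith) hom
  have hδ0 : 0 < δ := by
    have := max_lt ha hb
    rw [hδ]; linarith
  obtain ⟨C, hC, hCb⟩ := exists_hgKer_bound R m δ hm0 hδ0
  obtain ⟨T, hT, hTb⟩ := exists_coshKer_bound R m δ hm0 hδ0
  set ρ' := (ρ + ell op₀ om (a₀+b₀))/2 with hρ'
  have hρρ : ρ < ρ' := by rw [hρ']; linarith
  set η := Real.pi*(ρ'-ρ)/(2*T) with hη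
  have hη0 : 0 < η := div_pos (mul_pos Real.pi_pos (by linarith)) (by positivity)
  set dom : ℝ → ℝ := fun y => C * (Real.exp (-2*δ*y) + 1/(1+y^2)) with hdom
  have hdomi : IntegrableOn dom (Ioi 0) := (integrableOn_ker_dom δ hδ0).const_mul C
  have hexpi : IntegrableOn (fun y : ℝ => T/η * Real.exp (-2*δ*y)) (Ioi 0) :=
    ((exp_neg_integrableOn_Ioi 0 (by positivity : 0 < 2*δ)).congr_fun
      (fun y _ => by simp) measurableSet_Ioi).const_mul _
  set M := (∫ y in Ioi (0:ℝ), dom y) + (∫ y in Ioi (0:ℝ), dom y) +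
    ∫ y in Ioi (0:ℝ), T/η * Real.exp (-2*δ*y) with hM
  refine ⟨Real.exp M, ?_⟩
  have n1 := norm_nonneg op₀
  have n2 := norm_nonneg om
  have n3 := norm_nonneg a₀
  have n4 := norm_nonneg b₀
  have ev : ∀ {f : ℂ × ℂ × ℂ → ℝ}, ContinuousAt f (op₀,a₀,b₀) → ∀ {c : ℝ}, f (op₀,a₀,b₀) < c →
      ∀ᶠ p in 𝓝 (op₀,a₀,b₀), f p < c := fun hf _ h => hf.eventually_lt_const h
  have e1 := ev (f := fun p => ‖p.1‖) (by fun_prop) (c := R) (by simp only [hR]; linarith)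
  have e2 := ev (f := fun p => ‖p.2.1‖) (by fun_prop) (c := R) (by simp only [hR]; linarith)
  have e3 := ev (f := fun p => ‖p.2.2‖) (by fun_prop) (c := R) (by simp only [hR]; linarith)
  have e4 := ev (f := fun p => -p.1.re) (by fun_prop) (c := -(op₀.re/2)) (by simp; linarith)
  have hmx1 := le_max_left |a₀.re| |b₀.re|
  have hmx2 := le_max_right |a₀.re| |b₀.re|
  have hmx := max_lt ha hb
  have e5 := ev (f := fun p => |p.2.1.re| - (p.1.re+om.re)/2) (by fun_prop) (c := -δ)
    (by simp only [hδ]; linarith)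
  have e6 := ev (f := fun p => |p.2.2.re| - (p.1.re+om.re)/2) (by fun_prop) (c := -δ)
    (by simp only [hδ]; linarith)
  have hop0 := ne_zero_of_re_pos hop
  have hom0 := ne_zero_of_re_pos hom
  have e7 := ev (f := fun p => -ell p.1 om (p.2.1+p.2.2))
    (by
      unfold ell
      refine (Complex.continuous_re.continuousAt.comp (ContinuousAt.div (by fun_prop) (by fun_prop) ?_)).neg
      simp [hop0, hom0]) (c := -ρ') (by simp only [hρ']; linarith)
  filter_upwards [e1, e2, e3, e4, e5, e6, e7] with p h1 h2 h3 h4 h5 h6 h7 x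
  obtain ⟨op, a, b⟩ := p
  dsimp only at *
  have hop' : m ≤ op.re := (min_le_left _ _).trans (by linarith)
  have hopp : 0 < op.re := by linarith
  have hom' : m ≤ om.re := min_le_right _ _
  obtain ⟨hi, hv⟩ := hypGammaInt_pair hopp hom (a := a) (b := b) (by linarith) (by linarith) x
  rw [hv, ← Real.exp_add, Real.exp_le_exp]
  have hind : IntegrableOn (fun y : ℝ => (Ioc 0 η).indicator (fun _ => 2*|x| * T) y) (Ioi 0) := by
    refine Integrable.integrableOn ?_
    rw [integrable_indicator_iff measurableSet_Ioc]
    exact integrableOn_const (by simp)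
  have hbnd : ∀ y ∈ Ioi (0:ℝ), (Complex.I * (hgKer op om (x - Complex.I*a) y +
      hgKer op om (-x - Complex.I*b) y)).re ≤ dom y + dom y - ρ' * fejerKer x y +
        ((Ioc 0 η).indicator (fun _ => 2*|x| * T) y + T/η * Real.exp (-2*δ*y)) := by
    intro y hy
    have hy : 0 < y := hy
    rw [re_pair_eq op om a b x hy]
    have hom1 : ‖om‖ ≤ R := by simp only [hR]; linarith
    have b1 := hCb op om (-Complex.I*a) h1.le hom1 (by simpa using h2.le) hop' hom'
      (by simpa using by linarith) y hy
    have b2 := hCb op om (-Complex.I*b) h1.le hom1 (by simpa using h3.le) hop' hom'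
      (by simpa using by linarith) y hy
    have b3 := hTb op om a b h2.le h3.le hop' hom' (by linarith) (by linarith) y hy
    refine add_le_add (sub_le_sub ?_ ?_) ?_
    · refine (le_abs_self _).trans ?_
      rw [abs_mul]
      refine (mul_le_of_le_one_left (abs_nonneg _) (Real.abs_cos_le_one _)).trans ?_
      refine (Complex.abs_re_le_norm _).trans ((norm_add_le _ _).trans ?_)
      rw [norm_mul, norm_mul, Complex.norm_I, one_mul, one_mul]
      exact add_le_add b1 b2
    · exact mul_le_mul_of_nonneg_right (by linarith) (fejerKer_nonneg x y)
    · refine (le_abs_self _).trans ?_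
      rw [abs_mul]
      have b4 : |(Complex.I * coshKer op om a b y).re| ≤ T * Real.exp (-2*δ*y) / y := by
        refine (Complex.abs_re_le_norm _).trans ?_
        rw [norm_mul, Complex.norm_I, one_mul]; exact b3
      have hE : 0 < Real.exp (-2*δ*y) := Real.exp_pos _
      have hE1 : Real.exp (-2*δ*y) ≤ 1 := Real.exp_le_one_iff.mpr (by nlinarith)
      rcases le_or_gt y η with hle | hgt
      · rw [indicator_of_mem (show y ∈ Ioc 0 η from ⟨hy, hle⟩)]
        have hs : |Real.sin (2*y*x)| ≤ 2*y*|x| := by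
          refine Real.abs_sin_le_abs.trans ?_
          rw [abs_mul, abs_of_pos (by positivity : 0 < 2*y)]
        calc |Real.sin (2*y*x)| * |(Complex.I * coshKer op om a b y).re|
            ≤ (2*y*|x|) * (T * Real.exp (-2*δ*y) / y) := by gcongr
          _ = 2*|x| * T*Real.exp (-2*δ*y) := by field_simp
          _ ≤ 2*|x| * T*1 := by gcongr
          _ ≤ _ := by rw [mul_one]; exact le_add_of_nonneg_right (by positivity)
      · rw [indicator_of_notMem (fun h => absurd h.2 (not_le.mpr hgt)), zero_add]
        refine (mul_le_of_le_one_left (abs_nonneg _) (Real.abs_sin_le_one _)).trans (b4.trans ?_)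
        rw [div_mul_eq_mul_div]
        gcongr
  have hint := setIntegral_mono_on hi.re (((hdomi.add hdomi).sub
    ((integrableOn_fejerKer x).const_mul ρ')).add (hind.add hexpi)) measurableSet_Ioi hbnd
  refine hint.trans ?_
  rw [integral_add' ((hdomi.add hdomi).sub ((integrableOn_fejerKer x).const_mul ρ')) (hind.add hexpi),
    integral_sub' (hdomi.add hdomi) ((integrableOn_fejerKer x).const_mul ρ'),
    integral_add' hdomi hdomi, integral_add' hind hexpi,
    integral_const_mul ρ', integral_fejerKer,
    integral_fejerKer_one hG]
  have hindv : ∫ y in Ioi (0:ℝ), (Ioc 0 η).indicator (fun _ => 2*|x| * T) y = η * (2*|x| * T) := by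
    rw [setIntegral_indicator measurableSet_Ioc, inter_eq_self_of_subset_right
      Ioc_subset_Ioi_self]
    simp [hη0.le]
  rw [hindv]
  have : η * (2*|x| * T) = Real.pi*(ρ'-ρ)*|x| := by rw [hη]; field_simp
  rw [this]
  apply le_of_eq
  rw [hM]; ring

/-- Locally uniform exponential decay of `g(x-ia) g(-x-ib)` at every rate below
`π Re((a+b)/(ω₊ω₋))`. -/
def PairDecay (G : ℂ → ℂ → ℂ → ℂ) (op om a b : ℂ) : Prop :=
  ∀ ρ : ℝ, ρ < ell op om (a+b) → ∃ C : ℝ, 0 ≤ C ∧ ∀ᶠ p : ℂ × ℂ × ℂ in 𝓝 (op, a, b), ∀ x : ℝ,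
    ‖G p.1 om (x - Complex.I*p.2.1) * G p.1 om (-x - Complex.I*p.2.2)‖ ≤
      C * Real.exp (-(Real.pi*ρ*|x|))

theorem PairDecay.symm {G : ℂ → ℂ → ℂ → ℂ} {op om a b : ℂ} (h : PairDecay G op om a b) :
    PairDecay G op om b a := by
  intro ρ hρ
  obtain ⟨C, hC0, hC⟩ := h ρ (by rwa [add_comm])
  have ht : Tendsto (fun p : ℂ × ℂ × ℂ => (p.1, p.2.2, p.2.1)) (𝓝 (op,b,a)) (𝓝 (op,a,b)) :=
    Continuous.tendsto (by fun_prop) _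
  refine ⟨C, hC0, (ht.eventually hC).mono fun p hp x => ?_⟩
  have := hp (-x)
  rw [abs_neg, mul_comm] at this
  simpa using this

theorem norm_cosh_shift_le {om : ℂ} (hom : 0 < om.re) (x : ℝ) (w : ℂ) :
    ‖Complex.cosh (Real.pi*(x - w)/om)‖ ≤
      Real.exp (Real.pi*‖w/om‖) * Real.exp (Real.pi*(om⁻¹).re*|x|) := by
  refine (norm_cosh_le_exp _).trans ?_
  rw [← Real.exp_add, Real.exp_le_exp]
  have e : (Real.pi*(x - w)/om : ℂ) = ((Real.pi*x:ℝ):ℂ)*om⁻¹ - ((Real.pi:ℝ):ℂ)*(w/om) := by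
    push_cast; ring
  rw [e, Complex.sub_re, Complex.re_ofReal_mul, Complex.re_ofReal_mul]
  refine (abs_sub _ _).trans ?_
  rw [abs_mul, abs_mul, abs_mul, abs_of_pos Real.pi_pos, abs_of_pos (inv_re_pos hom)]
  have := mul_le_mul_of_nonneg_left (Complex.abs_re_le_norm (w/om)) Real.pi_pos.le
  nlinarith

theorem PairDecay.step {G : ℂ → ℂ → ℂ → ℂ}
    (hG : ∀ a b : ℂ, 0 < a.re → 0 < b.re → IsHypGamma a b (G a b)) {op om a b : ℂ}
    (hop : 0 < op.re) (hom : 0 < om.re) (ha : a.re ≤ -(op.re+om.re)/2)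
    (h : PairDecay G op om (a+op) b) : PairDecay G op om a b := by
  intro ρ hρ
  obtain ⟨C, hC0, hC⟩ := h (ρ + (om⁻¹).re) (by
    rw [show a+op+b = a+b+op by ring, ell_add, ell_op hop]; linarith)
  set M := ‖(Complex.I*a + Complex.I*op/2)/om‖ + 1 with hM
  have ht : Tendsto (fun p : ℂ × ℂ × ℂ => (p.1, p.2.1 + p.1, p.2.2)) (𝓝 (op,a,b)) (𝓝 (op,a+op,b)) :=
    Continuous.tendsto' (by fun_prop) _ _ rfl
  have e1 : ∀ᶠ p : ℂ × ℂ × ℂ in 𝓝 (op,a,b), 0 < p.1.re :=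
    (show ContinuousAt (fun p : ℂ × ℂ × ℂ => p.1.re) _ by fun_prop).eventually_const_lt hop
  have e2 : ∀ᶠ p : ℂ × ℂ × ℂ in 𝓝 (op,a,b), (p.1.re-om.re)/2 + p.2.1.re < 0 :=
    (show ContinuousAt (fun p : ℂ × ℂ × ℂ => (p.1.re-om.re)/2 + p.2.1.re) _ by
      fun_prop).eventually_lt_const (by simp only; linarith)
  have e3 : ∀ᶠ p : ℂ × ℂ × ℂ in 𝓝 (op,a,b), ‖(Complex.I*p.2.1 + Complex.I*p.1/2)/om‖ < M :=
    (show ContinuousAt (fun p : ℂ × ℂ × ℂ => ‖(Complex.I*p.2.1 + Complex.I*p.1/2)/om‖) _ by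
      fun_prop).eventually_lt_const (by simp only [hM]; linarith)
  refine ⟨2*Real.exp (Real.pi*M)*C, by positivity, ?_⟩
  filter_upwards [ht.eventually hC, e1, e2, e3] with p hp h1 h2 h3 x
  obtain ⟨o, a', b'⟩ := p
  dsimp only at *
  rw [(hG o om h1 hom).unshift (z := x - Complex.I*a') h1 hom (by simp; linarith),
    show (x:ℂ) - Complex.I*a' - Complex.I*o/2 = x - (Complex.I*a' + Complex.I*o/2) by ring,
    show (x:ℂ) - Complex.I*a' - Complex.I*o = x - Complex.I*(a'+o) by ring, mul_assoc, norm_mul,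
    norm_mul, Complex.norm_two]
  have b1 := norm_cosh_shift_le hom x (Complex.I*a' + Complex.I*o/2)
  have b2 : Real.exp (Real.pi*‖(Complex.I*a' + Complex.I*o/2)/om‖) ≤ Real.exp (Real.pi*M) :=
    Real.exp_le_exp.mpr (mul_le_mul_of_nonneg_left h3.le Real.pi_pos.le)
  calc _ ≤ 2 * (Real.exp (Real.pi*M) * Real.exp (Real.pi*(om⁻¹).re*|x|)) *
        (C * Real.exp (-(Real.pi*(ρ + (om⁻¹).re)*|x|))) := by
        refine mul_le_mul (mul_le_mul_of_nonneg_left (b1.trans ?_) two_pos.le) (hp x)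
          (norm_nonneg _) (by positivity)
        gcongr
    _ = 2*Real.exp (Real.pi*M)*C * (Real.exp (Real.pi*(om⁻¹).re*|x|) *
          Real.exp (-(Real.pi*(ρ + (om⁻¹).re)*|x|))) := by ring
    _ = _ := by rw [← Real.exp_add]; congr 2; ring

theorem pairDecay {G : ℂ → ℂ → ℂ → ℂ}
    (hG : ∀ a b : ℂ, 0 < a.re → 0 < b.re → IsHypGamma a b (G a b)) {op om a b : ℂ}
    (hop : 0 < op.re) (hom : 0 < om.re) (ha : a.re < (op.re+om.re)/2)
    (hb : b.re < (op.re+om.re)/2) : PairDecay G op om a b := by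
  have hz : ∀ c : ℂ, Complex.I*(-Complex.I*c) = c := fun c => by
    rw [← mul_assoc, mul_neg, Complex.I_mul_I]; ring
  have base : ∀ a b : ℂ, |a.re| < (op.re+om.re)/2 → |b.re| < (op.re+om.re)/2 →
      PairDecay G op om a b := by
    intro a b ha hb ρ hρ
    obtain ⟨C, hC⟩ := exists_hypGammaInt_pair_bound hG hop hom ha hb hρ
    have e1 : ∀ᶠ p : ℂ × ℂ × ℂ in 𝓝 (op,a,b), 0 < p.1.re :=
      (show ContinuousAt (fun p : ℂ × ℂ × ℂ => p.1.re) _ by fun_prop).eventually_const_lt hop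
    have e2 : ∀ᶠ p : ℂ × ℂ × ℂ in 𝓝 (op,a,b), |p.2.1.re| - (p.1.re+om.re)/2 < 0 :=
      (show ContinuousAt (fun p : ℂ × ℂ × ℂ => |p.2.1.re| - (p.1.re+om.re)/2) _ by
        fun_prop).eventually_lt_const (by simp only; linarith)
    have e3 : ∀ᶠ p : ℂ × ℂ × ℂ in 𝓝 (op,a,b), |p.2.2.re| - (p.1.re+om.re)/2 < 0 :=
      (show ContinuousAt (fun p : ℂ × ℂ × ℂ => |p.2.2.re| - (p.1.re+om.re)/2) _ by
        fun_prop).eventually_lt_const (by simp only; linarith)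
    refine ⟨max C 0, le_max_right _ _, ?_⟩
    filter_upwards [hC, e1, e2, e3] with p hp h1 h2 h3 x
    rw [(hG p.1 om h1 hom).strip _ (by rw [half_add_re]; simp; linarith),
      (hG p.1 om h1 hom).strip _ (by rw [half_add_re]; simp; linarith)]
    exact (hp x).trans (mul_le_mul_of_nonneg_right (le_max_left _ _) (Real.exp_pos _).le)
  have half : ∀ a b : ℂ, a.re < (op.re+om.re)/2 → |b.re| < (op.re+om.re)/2 →
      PairDecay G op om a b := by
    intro a b ha hb
    have := halfPlane_induction hop hom (P := fun z => PairDecay G op om (Complex.I*z) b)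
      (fun z hz' => base _ _ (by simpa using hz') hb)
      (fun z hz' ih => PairDecay.step hG hop hom (by simp; linarith) (by
        rwa [show Complex.I*(z - Complex.I*op) = Complex.I*z + op by
          rw [mul_sub, ← mul_assoc, Complex.I_mul_I]; ring] at ih))
      (z := -Complex.I*a) (by simp; linarith)
    rwa [hz] at this
  have := halfPlane_induction hop hom (P := fun z => PairDecay G op om (Complex.I*z) a)
      (fun z hz' => (half _ _ ha (by simpa using hz')).symm)
      (fun z hz' ih => PairDecay.step hG hop hom (by simp; linarith) (by
        rwa [show Complex.I*(z - Complex.I*op) = Complex.I*z + op by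
          rw [mul_sub, ← mul_assoc, Complex.I_mul_I]; ring] at ih))
      (z := -Complex.I*b) (by simp; linarith)
  rw [hz] at this
  exact this.symm

theorem integrable_exp_neg_mul_abs' {c : ℝ} (hc : 0 < c) :
    Integrable fun x : ℝ => Real.exp (-(c*|x|)) := by
  rw [← integrableOn_univ, ← Iic_union_Ioi (a := (0:ℝ))]
  have h := exp_neg_integrableOn_Ioi 0 hc
  refine IntegrableOn.union ?_ (h.congr_fun (fun x hx => ?_) measurableSet_Ioi)
  · rw [integrableOn_Iic_iff_integrableOn_Iio]
    have h' : IntegrableOn (fun x : ℝ => Real.exp (-c * -x)) (Iio 0) := by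
      have := h
      rw [show (0:ℝ) = -0 by simp] at this
      exact this.comp_neg_Iio
    refine h'.congr_fun (fun x hx => ?_) measurableSet_Iio
    simp only [abs_of_neg (mem_Iio.mp hx), neg_mul]
  · simp only [abs_of_pos (mem_Ioi.mp hx), neg_mul]

/-- The product `∏ᵢ f(vᵢ) ∏_{i<j} p(vᵢ+vⱼ) q(vᵢ-vⱼ)`. -/
def rootProd {n : ℕ} (f p q : ℝ → ℂ) (v : Fin n → ℝ) : ℂ :=
  (∏ i, f (v i)) * pairProd (fun x y => p (x+y) * q (x-y)) v

theorem rootProd_norm_le {n : ℕ} {f p q : ℝ → ℂ} {B : ℝ → ℝ} {P Q : ℝ} (hf : ∀ x, ‖f x‖ ≤ B x)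
    (hp : ∀ x, ‖p x‖ ≤ P) (hq : ∀ x, ‖q x‖ ≤ Q) (v : Fin n → ℝ) :
    ‖rootProd f p q v‖ ≤ (∏ i, B (v i)) * pairProd (fun _ _ => P*Q) v := by
  simp only [rootProd, pairProd, norm_mul, norm_prod]
  have hP : 0 ≤ P := (norm_nonneg _).trans (hp 0)
  have hB : ∀ x, 0 ≤ B x := fun x => (norm_nonneg _).trans (hf x)
  gcongr
  · exact Finset.prod_nonneg fun i _ => hB _
  · exact hf _
  · exact hp _
  · exact hq _

theorem continuous_rootProd {n : ℕ} {f p q : ℝ → ℂ} (hf : Continuous f) (hp : Continuous p)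
    (hq : Continuous q) : Continuous (rootProd (n := n) f p q) := by
  unfold rootProd pairProd; fun_prop

/-- A family of functions that is continuous and has local uniform exponential decay with
rate `r` near the parameter `t₀`. -/
structure DecayFam (t₀ : ℂ) (r : ℝ) (f : ℂ → ℝ → ℂ) : Prop where
  cont : ∀ᶠ t in 𝓝 t₀, ∀ x : ℝ, ContinuousAt (fun p : ℂ × ℝ => f p.1 p.2) (t, x)
  decay : ∀ ρ < r, ∃ C : ℝ, 0 ≤ C ∧ ∀ᶠ t in 𝓝 t₀, ∀ x : ℝ,
    ‖f t x‖ ≤ C * Real.exp (-(Real.pi*ρ*|x|))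

theorem DecayFam.mul {t₀ : ℂ} {r s : ℝ} {f g : ℂ → ℝ → ℂ} (hf : DecayFam t₀ r f)
    (hg : DecayFam t₀ s g) : DecayFam t₀ (r+s) (fun t x => f t x * g t x) where
  cont := by
    filter_upwards [hf.cont, hg.cont] with t h1 h2 x using (h1 x).mul (h2 x)
  decay ρ hρ := by
    obtain ⟨C, hC, h1⟩ := hf.decay (r - (r+s-ρ)/2) (by linarith)
    obtain ⟨D, hD, h2⟩ := hg.decay (s - (r+s-ρ)/2) (by linarith)
    refine ⟨C*D, by positivity, ?_⟩
    filter_upwards [h1, h2] with t h1 h2 x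
    calc ‖f t x * g t x‖ ≤ (C * Real.exp (-(Real.pi*(r - (r+s-ρ)/2)*|x|))) *
          (D * Real.exp (-(Real.pi*(s - (r+s-ρ)/2)*|x|))) := by
          rw [norm_mul]; exact mul_le_mul (h1 x) (h2 x) (norm_nonneg _) (by positivity)
      _ = C * D * Real.exp (-(Real.pi*ρ*|x|)) := by
          rw [mul_mul_mul_comm, ← Real.exp_add]; ring_nf

theorem DecayFam.congr_rate {t₀ : ℂ} {r s : ℝ} {f : ℂ → ℝ → ℂ} (hf : DecayFam t₀ r f) (h : r = s) :
    DecayFam t₀ s f := h ▸ hf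

theorem DecayFam.continuous {t₀ : ℂ} {r : ℝ} {f : ℂ → ℝ → ℂ} (hf : DecayFam t₀ r f) :
    ∀ᶠ t in 𝓝 t₀, Continuous (f t) := by
  filter_upwards [hf.cont] with t ht
  exact continuous_iff_continuousAt.mpr fun x =>
    (ht x).comp (f := fun x : ℝ => (t, x)) (by fun_prop)

theorem exists_rootProd_bound {n : ℕ} {t₀ : ℂ} {r s u : ℝ} {f p q : ℂ → ℝ → ℂ}
    (hf : DecayFam t₀ r f) (hp : DecayFam t₀ s p) (hq : DecayFam t₀ u q) (hr : 0 < r) (hs : 0 < s)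
    (hu : 0 < u) : ∃ B : (Fin n → ℝ) → ℝ, Integrable B ∧ ∀ᶠ t in 𝓝 t₀,
      Continuous (rootProd (n := n) (f t) (p t) (q t)) ∧
      ∀ v, ‖rootProd (f t) (p t) (q t) v‖ ≤ B v := by
  obtain ⟨C, hC, h1⟩ := hf.decay (r/2) (by linarith)
  obtain ⟨P, hP, h2⟩ := hp.decay 0 hs
  obtain ⟨Q, hQ, h3⟩ := hq.decay 0 hu
  simp only [mul_zero, zero_mul, neg_zero, Real.exp_zero, mul_one] at h2 h3
  refine ⟨fun v => (∏ i, C * Real.exp (-(Real.pi*(r/2)*|v i|))) *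
    pairProd (fun _ _ => P*Q) (0 : Fin n → ℝ), ?_, ?_⟩
  · refine Integrable.mul_const (Integrable.fintype_prod
      (f := fun (_ : Fin n) (x : ℝ) => C * Real.exp (-(Real.pi*(r/2)*|x|))) fun i => ?_) _
    exact (integrable_exp_neg_mul_abs' (by positivity)).const_mul C
  · filter_upwards [h1, h2, h3, hf.continuous, hp.continuous, hq.continuous] with t h1 h2 h3 h4 h5 h6
    exact ⟨continuous_rootProd h4 h5 h6, fun v => rootProd_norm_le h1 h2 h3 v⟩

theorem integrable_rootProd {n : ℕ} {t₀ : ℂ} {r s u : ℝ} {f p q : ℂ → ℝ → ℂ}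
    (hf : DecayFam t₀ r f) (hp : DecayFam t₀ s p) (hq : DecayFam t₀ u q) (hr : 0 < r) (hs : 0 < s)
    (hu : 0 < u) : Integrable (rootProd (n := n) (f t₀) (p t₀) (q t₀)) := by
  obtain ⟨B, hB, h⟩ := exists_rootProd_bound (n := n) hf hp hq hr hs hu
  have := h.self_of_nhds
  exact hB.mono' this.1.aestronglyMeasurable (ae_of_all _ this.2)

theorem continuousAt_integral_rootProd {n : ℕ} {t₀ : ℂ} {r s u : ℝ} {f p q : ℂ → ℝ → ℂ}
    (hf : DecayFam t₀ r f) (hp : DecayFam t₀ s p) (hq : DecayFam t₀ u q) (hr : 0 < r) (hs : 0 < s)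
    (hu : 0 < u) :
    ContinuousAt (fun t => ∫ v : Fin n → ℝ, rootProd (f t) (p t) (q t) v) t₀ := by
  obtain ⟨B, hB, h⟩ := exists_rootProd_bound (n := n) hf hp hq hr hs hu
  have key : ∀ {r : ℝ} {f : ℂ → ℝ → ℂ}, DecayFam t₀ r f → ∀ x, ContinuousAt (fun t => f t x) t₀ :=
    fun hf x => (hf.cont.self_of_nhds x).comp (f := fun t => (t, x)) (by fun_prop)
  refine continuousAt_of_dominated (h.mono fun t ht => ht.1.aestronglyMeasurable)
    (h.mono fun t ht => ae_of_all _ ht.2) hB (ae_of_all _ fun v => ?_)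
  simp only [rootProd, pairProd]
  refine ContinuousAt.mul (tendsto_finsetProd _ fun i _ => key hf _)
    (tendsto_finsetProd _ fun i _ => tendsto_finsetProd _ fun j _ => ?_)
  exact (key hp _).mul (key hq _)

theorem differentiableAt_integral_rootProd {n : ℕ} {t₀ : ℂ} {r s u : ℝ} {f p q : ℂ → ℝ → ℂ}
    (hf : DecayFam t₀ r f) (hp : DecayFam t₀ s p) (hq : DecayFam t₀ u q) (hr : 0 < r) (hs : 0 < s)
    (hu : 0 < u) (hf' : ∀ᶠ t in 𝓝 t₀, ∀ x, DifferentiableAt ℂ (fun t => f t x) t)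
    (hp' : ∀ᶠ t in 𝓝 t₀, ∀ x, DifferentiableAt ℂ (fun t => p t x) t)
    (hq' : ∀ᶠ t in 𝓝 t₀, ∀ x, DifferentiableAt ℂ (fun t => q t x) t) :
    DifferentiableAt ℂ (fun t => ∫ v : Fin n → ℝ, rootProd (f t) (p t) (q t) v) t₀ := by
  obtain ⟨B, hB, h⟩ := exists_rootProd_bound (n := n) hf hp hq hr hs hu
  obtain ⟨ε, hε, hball⟩ := Metric.eventually_nhds_iff_ball.mp
    (h.and (hf'.and (hp'.and hq')))
  refine differentiableAt_integral_of_local_bound hε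
    (fun t ht => (hball t ht).1.1.aestronglyMeasurable)
    (ae_of_all _ fun v t ht => (hball t ht).1.2 v) hB
    (ae_of_all _ fun v t ht => DifferentiableAt.differentiableWithinAt ?_)
  obtain ⟨-, h1, h2, h3⟩ := hball t ht
  simp only [rootProd, pairProd]
  refine DifferentiableAt.mul (DifferentiableAt.fun_finsetProd fun i _ => h1 _)
    (DifferentiableAt.fun_finsetProd fun i _ => DifferentiableAt.fun_finsetProd fun j _ => ?_)
  exact (h2 _).mul (h3 _)

theorem Continuous.eventually_lt_nhds {T : Type*} [TopologicalSpace T] {f g : T → ℝ}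
    (hf : Continuous f) (hg : Continuous g) {t : T} (h : f t < g t) : ∀ᶠ s in 𝓝 t, f s < g s :=
  hf.continuousAt.eventually_lt hg.continuousAt h

theorem decayFam_cosh {A B : ℂ → ℂ} (hA : Continuous A) (hB : Continuous B) (t₀ : ℂ) :
    DecayFam t₀ (-|(A t₀).re|) (fun t x => 2 * Complex.cosh (Real.pi * (A t * x + B t))) where
  cont := Eventually.of_forall fun t x => by
    have : Continuous fun p : ℂ × ℝ => 2 * Complex.cosh (Real.pi * (A p.1 * p.2 + B p.1)) := by
      fun_prop
    exact this.continuousAt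
  decay ρ hρ := by
    refine ⟨2 * Real.exp (Real.pi * (|(B t₀).re| + 1)), by positivity, ?_⟩
    have h1 : ∀ᶠ t in 𝓝 t₀, |(A t).re| < -ρ :=
      Continuous.eventually_lt_nhds (by fun_prop) continuous_const (by linarith)
    have h2 : ∀ᶠ t in 𝓝 t₀, |(B t).re| < |(B t₀).re| + 1 :=
      Continuous.eventually_lt_nhds (by fun_prop) continuous_const (by linarith)
    filter_upwards [h1, h2] with t h1 h2 x
    have h3 := norm_cosh_le_exp (Real.pi * (A t * x + B t))
    have h4 : |(Real.pi * (A t * x + B t)).re| ≤ Real.pi * (|(B t₀).re| + 1) + -(Real.pi*ρ*|x|) := by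
      have e : (Real.pi * (A t * x + B t)).re = Real.pi * ((A t).re * x + (B t).re) := by
        simp
      rw [e, abs_mul, abs_of_pos Real.pi_pos]
      have h5 : |(A t).re * x + (B t).re| ≤ |(A t).re| * |x| + |(B t).re| := by
        rw [← abs_mul]; exact abs_add_le _ _
      have h6 : |(A t).re| * |x| ≤ -ρ * |x| := by gcongr
      nlinarith [Real.pi_pos]
    rw [norm_mul, mul_assoc, ← Real.exp_add]
    simp only [Complex.norm_ofNat]
    gcongr
    exact h3.trans (Real.exp_le_exp.mpr h4)

theorem decayFam_sinh {A B : ℂ → ℂ} (hA : Continuous A) (hB : Continuous B) (t₀ : ℂ) :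
    DecayFam t₀ (-|(A t₀).re|) (fun t x => 2 * Complex.sinh (Real.pi * (A t * x + B t))) := by
  have h := (decayFam_cosh hA (B := fun t => B t + Complex.I/2) (by fun_prop) t₀)
  have e : ∀ t (x:ℝ), 2 * Complex.sinh (Real.pi * (A t * x + B t)) =
      -Complex.I * (2 * Complex.cosh (Real.pi * (A t * x + (B t + Complex.I/2)))) := fun t x => by
    rw [show Real.pi * (A t * x + (B t + Complex.I/2)) =
      Real.pi * (A t * x + B t) + Real.pi * Complex.I/2 by ring, cosh_add_pi_I_div_two]
    linear_combination (2 * Complex.sinh (Real.pi * (A t * x + B t))) * Complex.I_sq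
  simp only [e]
  refine ⟨h.cont.mono fun t ht x => continuousAt_const.mul (ht x), fun ρ hρ => ?_⟩
  simpa using h.decay ρ hρ

theorem decayFam_pair {G : ℂ → ℂ → ℂ → ℂ}
    (hG : ∀ a b : ℂ, 0 < a.re → 0 < b.re → IsHypGamma a b (G a b)) {om : ℂ} {op a b : ℂ → ℂ}
    (hop : Continuous op) (ha : Continuous a) (hb : Continuous b) {t₀ : ℂ}
    (hop0 : 0 < (op t₀).re) (hom : 0 < om.re) (ha0 : (a t₀).re < ((op t₀).re+om.re)/2)
    (hb0 : (b t₀).re < ((op t₀).re+om.re)/2) :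
    DecayFam t₀ (ell (op t₀) om (a t₀ + b t₀)) (fun t x =>
      G (op t) om (x - Complex.I * a t) * G (op t) om (-x - Complex.I * b t)) where
  cont := by
    have h0 : ∀ᶠ t in 𝓝 t₀, 0 < (op t).re :=
      Continuous.eventually_lt_nhds (by fun_prop) (by fun_prop) hop0
    have h1 : ∀ᶠ t in 𝓝 t₀, (a t).re < ((op t).re+om.re)/2 :=
      Continuous.eventually_lt_nhds (by fun_prop) (by fun_prop) ha0
    have h2 : ∀ᶠ t in 𝓝 t₀, (b t).re < ((op t).re+om.re)/2 :=
      Continuous.eventually_lt_nhds (by fun_prop) (by fun_prop) hb0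
    filter_upwards [h0, h1, h2] with t h0 h1 h2 x
    refine ContinuousAt.mul ?_ ?_
    · refine ContinuousAt.comp (x := ((t, x) : ℂ × ℝ)) (g := fun q : ℂ × ℂ => G q.1 om q.2)
        (f := fun p : ℂ × ℝ => (op p.1, (p.2:ℂ) - Complex.I * a p.1))
        (continuousAt_hypGamma hG h0 hom ?_) (by fun_prop)
      simp; linarith
    · refine ContinuousAt.comp (x := ((t, x) : ℂ × ℝ)) (g := fun q : ℂ × ℂ => G q.1 om q.2)
        (f := fun p : ℂ × ℝ => (op p.1, -(p.2:ℂ) - Complex.I * b p.1))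
        (continuousAt_hypGamma hG h0 hom ?_) (by fun_prop)
      simp; linarith
  decay ρ hρ := by
    obtain ⟨C, hC, h⟩ := pairDecay hG hop0 hom ha0 hb0 ρ hρ
    refine ⟨C, hC, ?_⟩
    have : Tendsto (fun t => (op t, a t, b t)) (𝓝 t₀) (𝓝 (op t₀, a t₀, b t₀)) := by
      have h : Continuous fun t => (op t, a t, b t) := by fun_prop
      exact h.tendsto t₀
    exact this.eventually h

theorem differentiableAt_pair {g : ℂ → ℂ} {op om : ℂ} (h : IsHypGamma op om g) {a b : ℂ → ℂ}
    (hop : 0 < op.re) (hom : 0 < om.re) (ha : Differentiable ℂ a) (hb : Differentiable ℂ b)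
    {t : ℂ} (ha0 : (a t).re < (op.re+om.re)/2) (hb0 : (b t).re < (op.re+om.re)/2) (x : ℝ) :
    DifferentiableAt ℂ (fun t => g (x - Complex.I * a t) * g (-x - Complex.I * b t)) t := by
  refine DifferentiableAt.mul ?_ ?_
  · refine DifferentiableAt.comp (g := g) (f := fun t => (x:ℂ) - Complex.I * a t) t
      (h.differentiableAt hop hom ?_) (by fun_prop)
    simp; linarith
  · refine DifferentiableAt.comp (g := g) (f := fun t => -(x:ℂ) - Complex.I * b t) t
      (h.differentiableAt hop hom ?_) (by fun_prop)
    simp; linarith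

theorem eventually_differentiableAt_pair {g : ℂ → ℂ} {op om : ℂ} (h : IsHypGamma op om g)
    {a b : ℂ → ℂ} (hop : 0 < op.re) (hom : 0 < om.re) (ha : Differentiable ℂ a)
    (hb : Differentiable ℂ b) {t₀ : ℂ} (ha0 : (a t₀).re < (op.re+om.re)/2)
    (hb0 : (b t₀).re < (op.re+om.re)/2) :
    ∀ᶠ t in 𝓝 t₀, ∀ x : ℝ,
      DifferentiableAt ℂ (fun t => g (x - Complex.I * a t) * g (-x - Complex.I * b t)) t := by
  have h1 : ∀ᶠ t in 𝓝 t₀, (a t).re < (op.re+om.re)/2 :=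
    Continuous.eventually_lt_nhds (Complex.continuous_re.comp ha.continuous) continuous_const ha0
  have h2 : ∀ᶠ t in 𝓝 t₀, (b t).re < (op.re+om.re)/2 :=
    Continuous.eventually_lt_nhds (Complex.continuous_re.comp hb.continuous) continuous_const hb0
  filter_upwards [h1, h2] with t h1 h2 x using differentiableAt_pair h hop hom ha hb h1 h2 x

/-- `g(x-ia) g(-x-ib)`. -/
def gPair (g : ℂ → ℂ) (a b : ℂ) (x : ℝ) : ℂ := g (x - Complex.I*a) * g (-x - Complex.I*b)

/-- Weight attached to the pairs of coordinates. -/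
def wLong (g : ℂ → ℂ) (op om κ : ℂ) (x : ℝ) : ℂ :=
  (2 * Complex.sinh (Real.pi*x/op)) * (2 * Complex.sinh (Real.pi*x/om)) *
    gPair g ((op+om)/2+κ) ((op+om)/2+κ) x

/-- Weight attached to the single coordinates. -/
def wShort (g : ℂ → ℂ) (op om a b c d : ℂ) (x : ℝ) : ℂ :=
  (2 * Complex.sinh (2*Real.pi*x/op)) * (2 * Complex.sinh (2*Real.pi*x/om)) *
    (gPair g ((op+om)/2+a) ((op+om)/2+a) x * gPair g ((op+om)/2+b) ((op+om)/2+b) x *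
     (gPair g ((op+om)/2+c) ((op+om)/2+c) x * gPair g ((op+om)/2+d) ((op+om)/2+d) x))

/-- The integrand with parameters `a, b, c, d` and `κ`. -/
def koorFun (n : ℕ) (g : ℂ → ℂ) (op om a b c d κ : ℂ) (v : Fin n → ℝ) : ℂ :=
  rootProd (wShort g op om a b c d) (wLong g op om κ) (wLong g op om κ) v

/-- The integral with parameters `a, b, c, d` and `κ`. -/
def koorInt (n : ℕ) (g : ℂ → ℂ) (op om a b c d κ : ℂ) : ℂ :=
  ∫ v : Fin n → ℝ, koorFun n g op om a b c d κ v

theorem ell_op_add_om {op om : ℂ} (hop : 0 < op.re) (hom : 0 < om.re) :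
    ell op om (op+om) = (op⁻¹).re + (om⁻¹).re := by
  rw [ell_add, ell_op hop, ell_om hom, add_comm]

theorem decayFam_sinh_div {op : ℂ → ℂ} (hop : Continuous op) (h0 : ∀ t, op t ≠ 0) {t₀ : ℂ}
    (hop0 : 0 < (op t₀).re) {m : ℝ} (hm : 0 < m) :
    DecayFam t₀ (-(m * ((op t₀)⁻¹).re)) (fun t x => 2 * Complex.sinh (m*Real.pi*x/op t)) := by
  have := decayFam_sinh (A := fun t => m * (op t)⁻¹) (B := fun _ => 0)
    (continuous_const.mul (hop.inv₀ h0)) continuous_const t₀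
  simp only [Complex.re_ofReal_mul] at this
  rw [abs_of_pos (mul_pos hm (inv_re_pos hop0))] at this
  have e : ∀ t (x:ℝ), m*Real.pi*x/op t = Real.pi * (m * (op t)⁻¹ * x + 0) := fun t x => by ring
  simpa only [e] using this

theorem decayFam_wLong {G : ℂ → ℂ → ℂ → ℂ}
    (hG : ∀ a b : ℂ, 0 < a.re → 0 < b.re → IsHypGamma a b (G a b)) {om κ : ℂ} {op : ℂ → ℂ}
    (hop : Continuous op) (h0 : ∀ t, op t ≠ 0) {t₀ : ℂ} (hop0 : 0 < (op t₀).re) (hom : 0 < om.re)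
    (hκ : κ.re < 0) : DecayFam t₀ (2 * ell (op t₀) om κ) (fun t => wLong (G (op t) om) (op t) om κ) := by
  have h1 := decayFam_sinh_div hop h0 hop0 one_pos
  have h2 := decayFam_sinh_div (op := fun _ => om) (t₀ := t₀) continuous_const
    (fun _ => ne_zero_of_re_pos hom) hom one_pos
  have h3 := decayFam_pair hG (om := om) (op := op) (a := fun t => (op t+om)/2+κ)
    (b := fun t => (op t+om)/2+κ) hop (by fun_prop) (by fun_prop) (t₀ := t₀) hop0 hom
    (by simp; linarith) (by simp; linarith)
  have h := ((h1.mul h2).mul h3).congr_rate (s := 2 * ell (op t₀) om κ) (by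
    rw [show (op t₀ + om)/2 + κ + ((op t₀ + om)/2 + κ) = (op t₀ + om) + (κ + κ) by ring, ell_add,
      ell_op_add_om hop0 hom, ell_add]; ring)
  simp only [Complex.ofReal_one, one_mul] at h
  exact h

theorem decayFam_wShort {G : ℂ → ℂ → ℂ → ℂ}
    (hG : ∀ a b : ℂ, 0 < a.re → 0 < b.re → IsHypGamma a b (G a b)) {om : ℂ} {op a b c d : ℂ → ℂ}
    (hop : Continuous op) (h0 : ∀ t, op t ≠ 0) (ha : Continuous a) (hb : Continuous b)
    (hc : Continuous c) (hd : Continuous d) {t₀ : ℂ} (hop0 : 0 < (op t₀).re) (hom : 0 < om.re)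
    (ha0 : (a t₀).re < 0) (hb0 : (b t₀).re < 0) (hc0 : (c t₀).re < 0) (hd0 : (d t₀).re < 0) :
    DecayFam t₀ (2 * ell (op t₀) om (op t₀ + om + (a t₀ + b t₀ + c t₀ + d t₀)))
      (fun t => wShort (G (op t) om) (op t) om (a t) (b t) (c t) (d t)) := by
  have h1 := decayFam_sinh_div hop h0 hop0 two_pos
  have h2 := decayFam_sinh_div (op := fun _ => om) (t₀ := t₀) continuous_const
    (fun _ => ne_zero_of_re_pos hom) hom two_pos
  have h3 := fun (γ : ℂ → ℂ) (hγ : Continuous γ) (hγ0 : (γ t₀).re < 0) =>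
    decayFam_pair hG (om := om) (op := op) (a := fun t => (op t+om)/2+γ t)
      (b := fun t => (op t+om)/2+γ t) hop (by fun_prop) (by fun_prop) (t₀ := t₀) hop0 hom
      (by simp; linarith) (by simp; linarith)
  have h := ((h1.mul h2).mul (((h3 a ha ha0).mul (h3 b hb hb0)).mul
    ((h3 c hc hc0).mul (h3 d hd hd0)))).congr_rate
    (s := 2 * ell (op t₀) om (op t₀ + om + (a t₀ + b t₀ + c t₀ + d t₀))) (by
      have e : ∀ γ, ell (op t₀) om ((op t₀ + om)/2 + γ + ((op t₀ + om)/2 + γ)) =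
          ((op t₀)⁻¹).re + (om⁻¹).re + 2 * ell (op t₀) om γ := fun γ => by
        rw [show (op t₀ + om)/2 + γ + ((op t₀ + om)/2 + γ) = (op t₀ + om) + (γ + γ) by ring, ell_add,
          ell_op_add_om hop0 hom, ell_add]; ring
      rw [e, e, e, e, ell_add, ell_op_add_om hop0 hom, ell_add, ell_add, ell_add]; ring)
  simp only [Complex.ofReal_ofNat] at h
  exact h

theorem continuousAt_koorInt {G : ℂ → ℂ → ℂ → ℂ}
    (hG : ∀ a b : ℂ, 0 < a.re → 0 < b.re → IsHypGamma a b (G a b)) (n : ℕ) {om κ : ℂ}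
    {op a b c d : ℂ → ℂ}
    (hop : Continuous op) (h0 : ∀ t, op t ≠ 0) (ha : Continuous a) (hb : Continuous b)
    (hc : Continuous c) (hd : Continuous d) {t₀ : ℂ} (hop0 : 0 < (op t₀).re) (hom : 0 < om.re)
    (ha0 : (a t₀).re < 0) (hb0 : (b t₀).re < 0) (hc0 : (c t₀).re < 0) (hd0 : (d t₀).re < 0)
    (hθ : 0 < ell (op t₀) om (op t₀ + om + (a t₀ + b t₀ + c t₀ + d t₀))) (hκ : κ.re < 0)
    (hκ' : 0 < ell (op t₀) om κ) :
    ContinuousAt (fun t => koorInt n (G (op t) om) (op t) om (a t) (b t) (c t) (d t) κ) t₀ :=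
  continuousAt_integral_rootProd (decayFam_wShort hG hop h0 ha hb hc hd hop0 hom ha0 hb0 hc0 hd0)
    (decayFam_wLong hG hop h0 hop0 hom hκ) (decayFam_wLong hG hop h0 hop0 hom hκ)
    (by linarith) (by linarith) (by linarith)

theorem integrable_koorFun {G : ℂ → ℂ → ℂ → ℂ}
    (hG : ∀ a b : ℂ, 0 < a.re → 0 < b.re → IsHypGamma a b (G a b)) (n : ℕ) {op om a b c d κ : ℂ}
    (hop : 0 < op.re) (hom : 0 < om.re)
    (ha : a.re < 0) (hb : b.re < 0) (hc : c.re < 0) (hd : d.re < 0)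
    (hθ : 0 < ell op om (op + om + (a + b + c + d))) (hκ : κ.re < 0)
    (hκ' : 0 < ell op om κ) : Integrable (koorFun n (G op om) op om a b c d κ) :=
  integrable_rootProd (t₀ := 0) (f := fun _ => wShort (G op om) op om a b c d)
    (p := fun _ => wLong (G op om) op om κ) (q := fun _ => wLong (G op om) op om κ)
    (decayFam_wShort hG (op := fun _ => op) (a := fun _ => a) (b := fun _ => b) (c := fun _ => c)
      (d := fun _ => d) continuous_const (fun _ => ne_zero_of_re_pos hop) continuous_const
      continuous_const continuous_const continuous_const hop hom ha hb hc hd)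
    (decayFam_wLong hG (op := fun _ => op) continuous_const (fun _ => ne_zero_of_re_pos hop) hop
      hom hκ)
    (decayFam_wLong hG (op := fun _ => op) continuous_const (fun _ => ne_zero_of_re_pos hop) hop
      hom hκ)
    (by linarith) (by linarith) (by linarith)

theorem differentiableAt_koorInt {G : ℂ → ℂ → ℂ → ℂ}
    (hG : ∀ a b : ℂ, 0 < a.re → 0 < b.re → IsHypGamma a b (G a b)) (n : ℕ) {op om κ : ℂ}
    {a b c d : ℂ → ℂ} (ha : Differentiable ℂ a) (hb : Differentiable ℂ b)
    (hc : Differentiable ℂ c) (hd : Differentiable ℂ d) {t₀ : ℂ} (hop : 0 < op.re) (hom : 0 < om.re)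
    (ha0 : (a t₀).re < 0) (hb0 : (b t₀).re < 0) (hc0 : (c t₀).re < 0) (hd0 : (d t₀).re < 0)
    (hθ : 0 < ell op om (op + om + (a t₀ + b t₀ + c t₀ + d t₀))) (hκ : κ.re < 0)
    (hκ' : 0 < ell op om κ) :
    DifferentiableAt ℂ (fun t => koorInt n (G op om) op om (a t) (b t) (c t) (d t) κ) t₀ := by
  have h3 := fun (γ : ℂ → ℂ) (hγ : Differentiable ℂ γ) (hγ0 : (γ t₀).re < 0) =>
    eventually_differentiableAt_pair (hG op om hop hom) (a := fun t => (op+om)/2+γ t)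
      (b := fun t => (op+om)/2+γ t) hop hom (by fun_prop) (by fun_prop) (t₀ := t₀)
      (by simp; linarith) (by simp; linarith)
  have hL := decayFam_wLong hG (op := fun _ => op) (t₀ := t₀) continuous_const
    (fun _ => ne_zero_of_re_pos hop) hop hom hκ
  refine differentiableAt_integral_rootProd
    (decayFam_wShort hG (op := fun _ => op) continuous_const (fun _ => ne_zero_of_re_pos hop)
      ha.continuous hb.continuous hc.continuous hd.continuous hop hom ha0 hb0 hc0 hd0)
    hL hL (by linarith) (by linarith) (by linarith) ?_
    (Eventually.of_forall fun t x => differentiableAt_const _)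
    (Eventually.of_forall fun t x => differentiableAt_const _)
  filter_upwards [h3 a ha ha0, h3 b hb hb0, h3 c hc hc0, h3 d hd hd0] with t h1 h2 h3 h4 x
  exact (differentiableAt_const _).mul (((h1 x).mul (h2 x)).mul ((h3 x).mul (h4 x)))

theorem koorInt_swap (n : ℕ) (g : ℂ → ℂ) (op om a b c d κ : ℂ) :
    koorInt n g om op a b c d κ = koorInt n g op om a b c d κ := by
  have h1 : wShort g om op a b c d = wShort g op om a b c d := by
    funext x; simp only [wShort, add_comm om op]; ring
  have h2 : wLong g om op κ = wLong g op om κ := by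
    funext x; simp only [wLong, add_comm om op]; ring
  simp only [koorInt, koorFun, h1, h2]

theorem koorInt_comm₂₃ (n : ℕ) (g : ℂ → ℂ) (op om a b c d κ : ℂ) :
    koorInt n g op om a c b d κ = koorInt n g op om a b c d κ := by
  have h1 : wShort g op om a c b d = wShort g op om a b c d := by
    funext x; simp only [wShort]; ring
  simp only [koorInt, koorFun, h1]

theorem koorInt_comm₂₄ (n : ℕ) (g : ℂ → ℂ) (op om a b c d κ : ℂ) :
    koorInt n g op om a d c b κ = koorInt n g op om a b c d κ := by
  have h1 : wShort g op om a d c b = wShort g op om a b c d := by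
    funext x; simp only [wShort]; ring
  simp only [koorInt, koorFun, h1]

/-- Action of sign vectors on real vectors. -/
def sgnActR {n : ℕ} (σ : Fin n → ℤˣ) (v : Fin n → ℝ) : Fin n → ℝ := fun i => ((σ i : ℤ) : ℝ) * v i

theorem sgnActR_involutive {n : ℕ} (σ : Fin n → ℤˣ) : Function.Involutive (sgnActR σ) := fun v => by
  funext i
  rcases Int.units_eq_one_or (σ i) with h | h <;> simp [sgnActR, h]

theorem measurePreserving_sgnActR {n : ℕ} (σ : Fin n → ℤˣ) :
    MeasurePreserving (sgnActR σ) volume volume := by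
  refine volume_preserving_pi (f := fun i (x:ℝ) => ((σ i : ℤ) : ℝ) * x) fun i => ?_
  rcases Int.units_eq_one_or (σ i) with h | h
  · have e : (fun x : ℝ => ((σ i : ℤ) : ℝ) * x) = id := by funext x; simp [h]
    rw [e]; exact MeasurePreserving.id _
  · simpa [h] using Measure.measurePreserving_neg (volume : Measure ℝ)

/-- `sgnActR σ` as a measurable equivalence. -/
def sgnEquiv {n : ℕ} (σ : Fin n → ℤˣ) : (Fin n → ℝ) ≃ᵐ (Fin n → ℝ) :=
  MeasurableEquiv.ofInvolutive (sgnActR σ) (sgnActR_involutive σ) (measurePreserving_sgnActR σ).measurable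

theorem integral_comp_sgnActR {n : ℕ} (σ : Fin n → ℤˣ) (F : (Fin n → ℝ) → ℂ) :
    ∫ v, F (sgnActR σ v) = ∫ v, F v :=
  MeasurePreserving.integral_comp' (f := sgnEquiv σ) (measurePreserving_sgnActR σ) F

theorem Integrable.comp_sgnActR {n : ℕ} (σ : Fin n → ℤˣ) {F : (Fin n → ℝ) → ℂ}
    (hF : Integrable F) : Integrable fun v => F (sgnActR σ v) :=
  (measurePreserving_sgnActR σ).integrable_comp_of_integrable hF

theorem rootProd_sgnActR {n : ℕ} {f p : ℝ → ℂ} (hf : ∀ x, f (-x) = -f x) (hp : ∀ x, p (-x) = -p x)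
    (σ : Fin n → ℤˣ) (v : Fin n → ℝ) :
    rootProd f p p (sgnActR σ v) = sgnChar σ * rootProd f p p v := by
  have h1 : ∀ i, f (sgnActR σ v i) = ((σ i : ℤ) : ℂ) * f (v i) := fun i => by
    rcases Int.units_eq_one_or (σ i) with h | h <;> simp [sgnActR, h, hf]
  have h2 : pairProd (fun x y => p (x+y) * p (x-y)) (sgnActR σ v) =
      pairProd (fun x y => p (x+y) * p (x-y)) v := by
    refine pairProd_congr fun i j => ?_
    have e1 : ∀ x y, p (x + -y) = p (x - y) := fun x y => by rw [sub_eq_add_neg]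
    have e2 : ∀ x y, p (-x + y) = -p (x - y) := fun x y => by rw [← hp]; ring_nf
    have e3 : ∀ x y, p (-x - y) = -p (x + y) := fun x y => by rw [← hp]; ring_nf
    have e4 : ∀ x y, p (-x + -y) = -p (x + y) := fun x y => by rw [← hp]; ring_nf
    have e5 : ∀ x y, p (-x - -y) = -p (x - y) := fun x y => by rw [← hp]; ring_nf
    rcases Int.units_eq_one_or (σ i) with h | h <;> rcases Int.units_eq_one_or (σ j) with h' | h' <;>
      simp [sgnActR, h, h', e2, e3, e4, e5, mul_comm, ← sub_eq_add_neg]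
  rw [rootProd, h2, Finset.prod_congr rfl fun i _ => h1 i, Finset.prod_mul_distrib, rootProd, sgnChar,
    mul_assoc]

theorem integral_rootProd_mul_symTerm {n : ℕ} {f p : ℝ → ℂ} (hf : ∀ x, f (-x) = -f x)
    (hp : ∀ x, p (-x) = -p x) {c : ℂ} (hc : c.re ≠ 0) (a b t : ℂ)
    (hint : Integrable fun v : Fin n → ℝ => rootProd f p p v * symTerm a b t (fun i => c * v i)) :
    2^n * ∫ v : Fin n → ℝ, rootProd f p p v * symTerm a b t (fun i => c * v i) =
      (∏ j ∈ Finset.range n, ssinh (a + b + j * t)) *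
        ∫ v : Fin n → ℝ, rootProd f p p v * weylDen (fun i => c * v i) := by
  have h1 : ∀ (σ : Fin n → ℤˣ) (v : Fin n → ℝ), rootProd f p p v *
      (sgnChar σ * symTerm a b t (sgnAct σ (fun i => c * v i))) =
      rootProd f p p (sgnActR σ v) * symTerm a b t (fun i => c * sgnActR σ v i) := fun σ v => by
    rw [rootProd_sgnActR hf hp]
    have : sgnAct σ (fun i => c * (v i : ℂ)) = fun i => c * sgnActR σ v i := by
      funext i; simp only [sgnAct, sgnActR]; push_cast; ring
    rw [this]; ring
  have h2 : ∀ σ : Fin n → ℤˣ, ∫ v : Fin n → ℝ, rootProd f p p v *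
      (sgnChar σ * symTerm a b t (sgnAct σ (fun i => c * v i))) =
      ∫ v : Fin n → ℝ, rootProd f p p v * symTerm a b t (fun i => c * v i) := fun σ => by
    simp only [h1]
    exact integral_comp_sgnActR σ fun v => rootProd f p p v * symTerm a b t (fun i => c * v i)
  have h3 : ∑ σ : Fin n → ℤˣ, ∫ v : Fin n → ℝ, rootProd f p p v *
      (sgnChar σ * symTerm a b t (sgnAct σ (fun i => c * v i))) =
      2^n * ∫ v : Fin n → ℝ, rootProd f p p v * symTerm a b t (fun i => c * v i) := by
    simp only [h2, Finset.sum_const, nsmul_eq_mul]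
    congr 1
    simp
  rw [← h3, ← integral_finsetSum, ← integral_const_mul]
  · refine integral_congr_ae (ae_of_all _ fun v => ?_)
    simp only
    rw [← Finset.mul_sum]
    change _ * symSum a b t _ = _
    rw [symSum_real a b t c hc]; ring
  · intro σ _
    simp only [h1]
    exact Integrable.comp_sgnActR σ hint

theorem gPair_neg (g : ℂ → ℂ) (a : ℂ) (x : ℝ) : gPair g a a (-x) = gPair g a a x := by
  simp only [gPair]; push_cast; rw [mul_comm, neg_neg]

theorem sinh_mul_neg (c : ℂ) (x : ℝ) (d : ℂ) :
    Complex.sinh (c * ((-x : ℝ) : ℂ) / d) = -Complex.sinh (c * x / d) := by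
  rw [← Complex.sinh_neg]; push_cast; ring_nf

theorem wLong_neg (g : ℂ → ℂ) (op om κ : ℂ) (x : ℝ) : wLong g op om κ (-x) = wLong g op om κ x := by
  simp only [wLong, gPair_neg, sinh_mul_neg]; ring

/-- Odd factor of `wLong`. -/
def oddLong (g : ℂ → ℂ) (op om κ : ℂ) (x : ℝ) : ℂ :=
  (2 * Complex.sinh (Real.pi*x/op)) * gPair g ((op+om)/2+κ) ((op+om)/2+κ) x

/-- Odd factor of `wShort`. -/
def oddShort (g : ℂ → ℂ) (op om a b c d : ℂ) (x : ℝ) : ℂ :=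
  (2 * Complex.sinh (2*Real.pi*x/op)) *
    (gPair g ((op+om)/2+a) ((op+om)/2+a) x * gPair g ((op+om)/2+b) ((op+om)/2+b) x *
     (gPair g ((op+om)/2+c) ((op+om)/2+c) x * gPair g ((op+om)/2+d) ((op+om)/2+d) x))

theorem koorFun_eq (n : ℕ) (g : ℂ → ℂ) (op om a b c d κ : ℂ) (v : Fin n → ℝ) :
    koorFun n g op om a b c d κ v = rootProd (oddShort g op om a b c d) (oddLong g op om κ)
      (oddLong g op om κ) v * weylDen (fun i => (Real.pi/om) * v i) := by
  have h1 : ∀ x : ℝ, wShort g op om a b c d x =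
      oddShort g op om a b c d x * ssinh (2 * (Real.pi/om * x)) := fun x => by
    rw [wShort, oddShort, ssinh_eq]; ring_nf
  have h2 : ∀ x : ℝ, wLong g op om κ x = oddLong g op om κ x * ssinh (Real.pi/om * x) := fun x => by
    rw [wLong, oddLong, ssinh_eq]; ring_nf
  rw [koorFun, rootProd, rootProd, weylDen, mul_mul_mul_comm, ← Finset.prod_mul_distrib]
  simp only [h1]
  congr 1
  simp only [pairProd, ← Finset.prod_mul_distrib]
  refine Finset.prod_congr rfl fun i _ => Finset.prod_congr rfl fun j _ => ?_
  rw [h2, h2]; push_cast; ring_nf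

/-- Single-coordinate factor of the auxiliary integrand. -/
def shiftShort (g : ℂ → ℂ) (op om a b c d u : ℂ) : ℂ :=
  2 * Complex.cosh (2*Real.pi*u/op) *
  (((g (u - Complex.I*((op+om)/2+a-op/4)) * g (-u - Complex.I*((op+om)/2+a-3*op/4))) *
    (g (u - Complex.I*((op+om)/2+b-op/4)) * g (-u - Complex.I*((op+om)/2+b-3*op/4)))) *
   ((g (u - Complex.I*((op+om)/2+c-op/4)) * g (-u - Complex.I*((op+om)/2+c+op/4))) *
    (g (u - Complex.I*((op+om)/2+d-op/4)) * g (-u - Complex.I*((op+om)/2+d+op/4)))))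

/-- Factor of the auxiliary integrand attached to sums of coordinates. -/
def shiftLong (g : ℂ → ℂ) (op om κ y : ℂ) : ℂ :=
  2 * Complex.cosh (Real.pi*y/op) *
    (g (y - Complex.I*(om/2+κ)) * g (-y - Complex.I*(om/2+κ)))

theorem shiftShort_neg (g : ℂ → ℂ) (op om a b c d u : ℂ) : shiftShort g op om a b c d (-u) =
    shiftShort g op om (c+op/2) (d+op/2) (a-op/2) (b-op/2) u := by
  simp only [shiftShort, neg_neg]
  rw [show 2*(Real.pi:ℂ)*-u/op = -(2*Real.pi*u/op) by ring, Complex.cosh_neg]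
  ring_nf

theorem shiftLong_neg (g : ℂ → ℂ) (op om κ y : ℂ) :
    shiftLong g op om κ (-y) = shiftLong g op om κ y := by
  simp only [shiftLong, neg_neg]
  rw [show (Real.pi:ℂ)*-y/op = -(Real.pi*y/op) by ring, Complex.cosh_neg]
  ring

theorem IsHypGamma.shift_pair {op om : ℂ} {g : ℂ → ℂ} (h : IsHypGamma op om g) (hop : 0 < op.re)
    (hom : 0 < om.re) {γ : ℂ} (hγ : γ.re < 0) (x : ℝ) :
    g (-x - Complex.I*((op+om)/2+γ-op)) = Complex.I * ssinh (Real.pi/om*x + Real.pi/om*(Complex.I*γ)) *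
      g (-x - Complex.I*((op+om)/2+γ)) := by
  have h2 := ne_zero_of_re_pos hom
  have := h.shift (z := -x - Complex.I*((op+om)/2+γ)) hop hom (by simp; linarith)
  rw [show -(x:ℂ) - Complex.I*((op+om)/2+γ-op) = -x - Complex.I*((op+om)/2+γ) + Complex.I*op by ring,
    this, ← Complex.cosh_neg, ssinh_eq]
  rw [show -((Real.pi:ℂ) * (-x - Complex.I*((op+om)/2+γ) + Complex.I*op/2)/om) =
    (Real.pi/om*x + Real.pi/om*(Complex.I*γ)) + Real.pi*Complex.I/2 by field_simp; ring,
    cosh_add_pi_I_div_two]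
  ring

theorem cosh_sub_quarter {op : ℂ} (hop : op ≠ 0) (x : ℂ) :
    Complex.cosh (Real.pi*(x - Complex.I*op/2)/op) = -Complex.I * Complex.sinh (Real.pi*x/op) := by
  rw [← Complex.cosh_neg, show -((Real.pi:ℂ)*(x - Complex.I*op/2)/op) =
    -(Real.pi*x/op) + Real.pi*Complex.I/2 by field_simp; ring, cosh_add_pi_I_div_two, Complex.sinh_neg]
  ring

theorem shiftLong_sub {op om : ℂ} {g : ℂ → ℂ} (h : IsHypGamma op om g) (hop : 0 < op.re)
    (hom : 0 < om.re) {κ : ℂ} (hκ : κ.re < 0) (x : ℝ) :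
    shiftLong g op om κ (x - Complex.I*op/2) =
      oddLong g op om κ x * ssinh (Real.pi/om*x + Real.pi/om*(Complex.I*κ)) := by
  rw [shiftLong, cosh_sub_quarter (ne_zero_of_re_pos hop), oddLong, gPair]
  have := h.shift_pair hop hom hκ x
  rw [show -((x:ℂ) - Complex.I*op/2) - Complex.I*(om/2+κ) = -x - Complex.I*((op+om)/2+κ-op) by ring,
    this, show (x:ℂ) - Complex.I*op/2 - Complex.I*(om/2+κ) = x - Complex.I*((op+om)/2+κ) by ring]
  linear_combination (-2 * Complex.sinh (Real.pi*x/op) *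
    ssinh (Real.pi/om*x + Real.pi/om*(Complex.I*κ)) * g (x - Complex.I*((op+om)/2+κ)) *
    g (-x - Complex.I*((op+om)/2+κ))) * Complex.I_sq

theorem shiftShort_sub {op om : ℂ} {g : ℂ → ℂ} (h : IsHypGamma op om g) (hop : 0 < op.re)
    (hom : 0 < om.re) {a b : ℂ} (ha : a.re < 0) (hb : b.re < 0) (c d : ℂ) (x : ℝ) :
    shiftShort g op om a b c d (x - Complex.I*op/4) = Complex.I * (oddShort g op om a b c d x *
      (ssinh (Real.pi/om*x + Real.pi/om*(Complex.I*a)) *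
        ssinh (Real.pi/om*x + Real.pi/om*(Complex.I*b)))) := by
  rw [shiftShort, show 2*(Real.pi:ℂ)*(x - Complex.I*op/4)/op =
    Real.pi*(2*x - Complex.I*op/2)/op by ring, cosh_sub_quarter (ne_zero_of_re_pos hop), oddShort]
  have e1 : ∀ γ, -((x:ℂ) - Complex.I*op/4) - Complex.I*((op+om)/2+γ-3*op/4) =
    -x - Complex.I*((op+om)/2+γ-op) := fun γ => by ring
  have e2 : ∀ γ, (x:ℂ) - Complex.I*op/4 - Complex.I*((op+om)/2+γ-op/4) =
    x - Complex.I*((op+om)/2+γ) := fun γ => by ring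
  have e3 : ∀ γ, -((x:ℂ) - Complex.I*op/4) - Complex.I*((op+om)/2+γ+op/4) =
    -x - Complex.I*((op+om)/2+γ) := fun γ => by ring
  rw [e1, e1, e2, e2, e2, e2, e3, e3, h.shift_pair hop hom ha, h.shift_pair hop hom hb,
    show (Real.pi:ℂ)*(2*x)/op = 2*Real.pi*x/op by ring]
  simp only [gPair]
  generalize ssinh (Real.pi/om*x + Real.pi/om*(Complex.I*a)) = A
  generalize ssinh (Real.pi/om*x + Real.pi/om*(Complex.I*b)) = B
  linear_combination (-2 * Complex.I * Complex.sinh (2*Real.pi*x/op) * A * B *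
    (g (x - Complex.I*((op+om)/2+a)) * g (-x - Complex.I*((op+om)/2+a))) *
    (g (x - Complex.I*((op+om)/2+b)) * g (-x - Complex.I*((op+om)/2+b))) *
    (g (x - Complex.I*((op+om)/2+c)) * g (-x - Complex.I*((op+om)/2+c))) *
    (g (x - Complex.I*((op+om)/2+d)) * g (-x - Complex.I*((op+om)/2+d)))) * Complex.I_sq

theorem oddLong_neg (g : ℂ → ℂ) (op om κ : ℂ) (x : ℝ) :
    oddLong g op om κ (-x) = -oddLong g op om κ x := by
  simp only [oddLong, gPair_neg, sinh_mul_neg]; ring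

theorem oddShort_neg (g : ℂ → ℂ) (op om a b c d : ℂ) (x : ℝ) :
    oddShort g op om a b c d (-x) = -oddShort g op om a b c d x := by
  simp only [oddShort, gPair_neg, sinh_mul_neg]; ring

/-- The auxiliary integral with all variables shifted by `ζ`. -/
def shiftInt (n : ℕ) (g : ℂ → ℂ) (op om a b c d κ ζ : ℂ) : ℂ :=
  ∫ v : Fin n → ℝ, rootProd (fun x => shiftShort g op om a b c d (x+ζ))
    (fun x => shiftLong g op om κ (x+2*ζ)) (wLong g op om κ) v

theorem eq_of_real_translation {h : ℂ → ℂ} {r : ℝ}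
    (hd : ∀ ζ : ℂ, |ζ.im| ≤ r → DifferentiableAt ℂ h ζ) (ht : ∀ (ζ : ℂ) (s : ℝ), h (ζ + s) = h ζ)
    {ζ w : ℂ} (hζ : |ζ.im| ≤ r) (hw : |w.im| ≤ r) : h w = h ζ := by
  have h0 : ∀ ζ : ℂ, |ζ.im| ≤ r → deriv h ζ = 0 := fun ζ hζ => by
    have h1 : HasDerivAt (fun w : ℂ => h (ζ + w)) (deriv h ζ) ((0:ℝ):ℂ) :=
      HasDerivAt.comp_const_add ζ _ (by simpa using (hd ζ hζ).hasDerivAt)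
    have h1 := h1.comp_ofReal
    simp only [ht] at h1
    simpa using (h1.unique (hasDerivAt_const _ _))
  have hconv : Convex ℝ {ζ : ℂ | |ζ.im| ≤ r} := by
    have : {ζ : ℂ | |ζ.im| ≤ r} = Complex.imLm ⁻¹' (Set.Icc (-r) r) := by
      ext z; simp [abs_le]
    rw [this]
    exact (convex_Icc _ _).linear_preimage _
  have := hconv.norm_image_sub_le_of_norm_deriv_le (C := 0) (fun z hz => hd z hz)
    (fun z hz => by rw [h0 z hz]; simp) hζ hw
  rw [zero_mul] at this
  exact sub_eq_zero.mp (norm_le_zero_iff.mp this)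

section
variable {G : ℂ → ℂ → ℂ → ℂ} {op om a b c d κ : ℂ}

theorem decayFam_shiftPair (hG : ∀ a b : ℂ, 0 < a.re → 0 < b.re → IsHypGamma a b (G a b))
    (hop : 0 < op.re) (hom : 0 < om.re) (A B m ζ : ℂ)
    (hA : A.re - (m*ζ).im < (op.re+om.re)/2) (hB : B.re + (m*ζ).im < (op.re+om.re)/2) :
    DecayFam ζ (ell op om (A+B)) (fun ζ x => G op om ((x+m*ζ) - Complex.I*A) *
      G op om (-(x+m*ζ) - Complex.I*B)) := by
  have h := (decayFam_pair hG (om := om) (op := fun _ => op) (a := fun ζ => A + Complex.I*(m*ζ))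
    (b := fun ζ => B - Complex.I*(m*ζ)) continuous_const (by fun_prop) (by fun_prop) (t₀ := ζ)
    hop hom (by simp at hA ⊢; linarith)
    (by simp at hB ⊢; linarith)).congr_rate (s := ell op om (A+B))
    (by ring_nf)
  have e1 : ∀ (ζ : ℂ) (x : ℝ), (x:ℂ) - Complex.I*(A + Complex.I*(m*ζ)) = (x+m*ζ) - Complex.I*A :=
    fun ζ x => by linear_combination (-(m*ζ)) * Complex.I_sq
  have e2 : ∀ (ζ : ℂ) (x : ℝ), -(x:ℂ) - Complex.I*(B - Complex.I*(m*ζ)) =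
      -(x+m*ζ) - Complex.I*B := fun ζ x => by linear_combination (m*ζ) * Complex.I_sq
  simpa only [e1, e2] using h

theorem eventually_differentiableAt_shiftPair {g : ℂ → ℂ} (h : IsHypGamma op om g)
    (hop : 0 < op.re) (hom : 0 < om.re) (A B m ζ : ℂ)
    (hA : A.re - (m*ζ).im < (op.re+om.re)/2) (hB : B.re + (m*ζ).im < (op.re+om.re)/2) :
    ∀ᶠ ζ in 𝓝 ζ, ∀ x : ℝ, DifferentiableAt ℂ (fun ζ => g ((x+m*ζ) - Complex.I*A) *
      g (-(x+m*ζ) - Complex.I*B)) ζ := by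
  have h := eventually_differentiableAt_pair h (a := fun ζ => A + Complex.I*(m*ζ))
    (b := fun ζ => B - Complex.I*(m*ζ)) hop hom (by fun_prop) (by fun_prop) (t₀ := ζ)
    (by simp at hA ⊢; linarith)
    (by simp at hB ⊢; linarith)
  have e1 : ∀ (ζ : ℂ) (x : ℝ), (x:ℂ) - Complex.I*(A + Complex.I*(m*ζ)) = (x+m*ζ) - Complex.I*A :=
    fun ζ x => by linear_combination (-(m*ζ)) * Complex.I_sq
  have e2 : ∀ (ζ : ℂ) (x : ℝ), -(x:ℂ) - Complex.I*(B - Complex.I*(m*ζ)) =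
      -(x+m*ζ) - Complex.I*B := fun ζ x => by linear_combination (m*ζ) * Complex.I_sq
  simpa only [e1, e2] using h

theorem decayFam_shiftLong (hG : ∀ a b : ℂ, 0 < a.re → 0 < b.re → IsHypGamma a b (G a b))
    (hop : 0 < op.re) (hom : 0 < om.re) (hκ : κ.re < 0) {ζ : ℂ} (hζ : |ζ.im| ≤ op.re/4) :
    DecayFam ζ (2 * ell op om κ) (fun ζ x => shiftLong (G op om) op om κ (x+2*ζ)) := by
  obtain ⟨h1, h2⟩ := abs_le.mp hζ
  have hc := decayFam_cosh (A := fun _ => op⁻¹) (B := fun ζ => op⁻¹*(2*ζ)) (by fun_prop)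
    (by fun_prop) ζ
  rw [abs_of_pos (inv_re_pos hop)] at hc
  have hp := decayFam_shiftPair hG hop hom (om/2+κ) (om/2+κ) 2 ζ (by simp; linarith)
    (by simp; linarith)
  have h := (hc.mul hp).congr_rate (s := 2 * ell op om κ) (by
    rw [show om/2+κ+(om/2+κ) = om + (κ+κ) by ring, ell_add, ell_om hom, ell_add]; ring)
  have e : ∀ (ζ : ℂ) (x : ℝ), Real.pi*(op⁻¹*x + op⁻¹*(2*ζ)) = Real.pi*(x+2*ζ)/op := fun ζ x => by ring
  simp only [e] at h
  exact h

theorem decayFam_shiftShort (hG : ∀ a b : ℂ, 0 < a.re → 0 < b.re → IsHypGamma a b (G a b))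
    (hop : 0 < op.re) (hom : 0 < om.re) (ha : a.re < 0) (hb : b.re < 0) (hc : c.re + op.re/2 < 0)
    (hd : d.re + op.re/2 < 0) {ζ : ℂ} (hζ : |ζ.im| ≤ op.re/4) :
    DecayFam ζ (2 * ell op om (op + om + (a+b+c+d)))
      (fun ζ x => shiftShort (G op om) op om a b c d (x+ζ)) := by
  obtain ⟨h1, h2⟩ := abs_le.mp hζ
  have hch := decayFam_cosh (A := fun _ => (2:ℝ)*op⁻¹) (B := fun ζ => op⁻¹*(2*ζ)) (by fun_prop)
    (by fun_prop) ζ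
  rw [Complex.re_ofReal_mul, abs_of_pos (mul_pos two_pos (inv_re_pos hop))] at hch
  have hp := fun (γ : ℂ) (hγ : γ.re < 0) => decayFam_shiftPair hG hop hom ((op+om)/2+γ-op/4)
    ((op+om)/2+γ-3*op/4) 1 ζ (by simp; linarith) (by simp; linarith)
  have hq := fun (γ : ℂ) (hγ : γ.re + op.re/2 < 0) => decayFam_shiftPair hG hop hom ((op+om)/2+γ-op/4)
    ((op+om)/2+γ+op/4) 1 ζ (by simp; linarith) (by simp; linarith)
  have h := (hch.mul (((hp a ha).mul (hp b hb)).mul ((hq c hc).mul (hq d hd)))).congr_rate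
    (s := 2 * ell op om (op + om + (a+b+c+d))) (by
    have e1 : ∀ γ, ell op om ((op+om)/2+γ-op/4+((op+om)/2+γ-3*op/4)) = (op⁻¹).re + 2*ell op om γ :=
      fun γ => by
        rw [show (op+om)/2+γ-op/4+((op+om)/2+γ-3*op/4) = om + (γ+γ) by ring, ell_add, ell_om hom,
          ell_add]; ring
    have e2 : ∀ γ, ell op om ((op+om)/2+γ-op/4+((op+om)/2+γ+op/4)) =
        (op⁻¹).re + (om⁻¹).re + 2*ell op om γ :=
      fun γ => by
        rw [show (op+om)/2+γ-op/4+((op+om)/2+γ+op/4) = (op+om) + (γ+γ) by ring, ell_add,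
          ell_op_add_om hop hom, ell_add]; ring
    rw [e1, e1, e2, e2, ell_add, ell_op_add_om hop hom, ell_add, ell_add, ell_add]; ring)
  have e : ∀ (ζ : ℂ) (x : ℝ), Real.pi*((2:ℝ)*op⁻¹*x + op⁻¹*(2*ζ)) = 2*Real.pi*(x+ζ)/op :=
    fun ζ x => by push_cast; ring
  simp only [e, one_mul] at h
  exact h

theorem decayFam_wLong_const (hG : ∀ a b : ℂ, 0 < a.re → 0 < b.re → IsHypGamma a b (G a b))
    (hop : 0 < op.re) (hom : 0 < om.re) (hκ : κ.re < 0) (t : ℂ) :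
    DecayFam t (2 * ell op om κ) (fun _ => wLong (G op om) op om κ) :=
  decayFam_wLong hG (op := fun _ => op) continuous_const (fun _ => ne_zero_of_re_pos hop) hop hom hκ

theorem differentiableAt_shiftInt (hG : ∀ a b : ℂ, 0 < a.re → 0 < b.re → IsHypGamma a b (G a b))
    (n : ℕ) (hop : 0 < op.re) (hom : 0 < om.re) (ha : a.re < 0) (hb : b.re < 0)
    (hc : c.re + op.re/2 < 0) (hd : d.re + op.re/2 < 0) (hθ : 0 < ell op om (op + om + (a+b+c+d)))
    (hκ : κ.re < 0) (hκ' : 0 < ell op om κ) {ζ : ℂ} (hζ : |ζ.im| ≤ op.re/4) :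
    DifferentiableAt ℂ (shiftInt n (G op om) op om a b c d κ) ζ := by
  obtain ⟨h1, h2⟩ := abs_le.mp hζ
  have hg := hG op om hop hom
  refine differentiableAt_integral_rootProd (decayFam_shiftShort hG hop hom ha hb hc hd hζ)
    (decayFam_shiftLong hG hop hom hκ hζ) (decayFam_wLong_const hG hop hom hκ ζ)
    (by linarith) (by linarith) (by linarith) ?_ ?_
    (Eventually.of_forall fun t x => differentiableAt_const _)
  · have hp := fun (γ : ℂ) (hγ : γ.re < 0) => eventually_differentiableAt_shiftPair hg hop hom
      ((op+om)/2+γ-op/4) ((op+om)/2+γ-3*op/4) 1 ζ (by simp; linarith) (by simp; linarith)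
    have hq := fun (γ : ℂ) (hγ : γ.re + op.re/2 < 0) => eventually_differentiableAt_shiftPair hg hop
      hom ((op+om)/2+γ-op/4) ((op+om)/2+γ+op/4) 1 ζ (by simp; linarith) (by simp; linarith)
    simp only [one_mul] at hp hq
    filter_upwards [hp a ha, hp b hb, hq c hc, hq d hd] with ζ h1 h2 h3 h4 x
    have : DifferentiableAt ℂ (fun ζ : ℂ => 2 * Complex.cosh (2*Real.pi*(x+ζ)/op)) ζ := by fun_prop
    exact this.mul (((h1 x).mul (h2 x)).mul ((h3 x).mul (h4 x)))
  · filter_upwards [eventually_differentiableAt_shiftPair hg hop hom (om/2+κ) (om/2+κ) 2 ζ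
      (by simp; linarith) (by simp; linarith)] with ζ h1 x
    have : DifferentiableAt ℂ (fun ζ : ℂ => 2 * Complex.cosh (Real.pi*(x+2*ζ)/op)) ζ := by fun_prop
    exact this.mul (h1 x)

theorem shiftInt_add_real (n : ℕ) (g : ℂ → ℂ) (ζ : ℂ) (s : ℝ) :
    shiftInt n g op om a b c d κ (ζ + s) = shiftInt n g op om a b c d κ ζ := by
  rw [shiftInt, shiftInt]
  conv_rhs => rw [← integral_add_right_eq_self _ (fun _ : Fin n => s)]
  refine integral_congr_ae (ae_of_all _ fun v => ?_)
  simp only [rootProd, pairProd, Pi.add_apply]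
  push_cast
  congr 1
  · exact Finset.prod_congr rfl fun i _ => by ring_nf
  · refine Finset.prod_congr rfl fun i _ => Finset.prod_congr rfl fun j _ => ?_
    ring_nf

theorem shiftInt_neg (n : ℕ) (g : ℂ → ℂ) (ζ : ℂ) :
    shiftInt n g op om a b c d κ (-ζ) =
      shiftInt n g op om (c+op/2) (d+op/2) (a-op/2) (b-op/2) κ ζ := by
  rw [shiftInt, shiftInt, ← integral_neg_eq_self]
  refine integral_congr_ae (ae_of_all _ fun v => ?_)
  simp only [rootProd, pairProd, Pi.neg_apply]
  congr 1
  · refine Finset.prod_congr rfl fun i _ => ?_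
    rw [← shiftShort_neg]; push_cast; ring_nf
  · refine Finset.prod_congr rfl fun i _ => Finset.prod_congr rfl fun j _ => ?_
    rw [← shiftLong_neg, ← wLong_neg]; push_cast; ring_nf

theorem pi_div_re_ne_zero (hom : 0 < om.re) : ((Real.pi:ℂ)/om).re ≠ 0 := by
  rw [div_eq_mul_inv, Complex.re_ofReal_mul]
  exact (mul_pos Real.pi_pos (inv_re_pos hom)).ne'

theorem shiftInt_eq (hG : ∀ a b : ℂ, 0 < a.re → 0 < b.re → IsHypGamma a b (G a b))
    (n : ℕ) (hop : 0 < op.re) (hom : 0 < om.re) (ha : a.re < 0) (hb : b.re < 0)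
    (hc : c.re + op.re/2 < 0) (hd : d.re + op.re/2 < 0) (hθ : 0 < ell op om (op + om + (a+b+c+d)))
    (hκ : κ.re < 0) (hκ' : 0 < ell op om κ) :
    2^n * shiftInt n (G op om) op om a b c d κ (-(Complex.I*op/4)) = Complex.I^n *
      ((∏ j ∈ Finset.range n, ssinh (Real.pi/om*(Complex.I*a) + Real.pi/om*(Complex.I*b) +
        j*(Real.pi/om*(Complex.I*κ)))) * koorInt n (G op om) op om a b c d κ) := by
  have hg := hG op om hop hom
  have hζ : |(-(Complex.I*op/4)).im| ≤ op.re/4 := by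
    have : (-(Complex.I*op/4)).im = -(op.re/4) := by simp
    rw [this, abs_neg, abs_of_pos (by positivity)]
  have hint := integrable_rootProd (n := n) (decayFam_shiftShort hG hop hom ha hb hc hd hζ)
    (decayFam_shiftLong hG hop hom hκ hζ) (decayFam_wLong_const hG hop hom hκ _)
    (by linarith) (by linarith) (by linarith)
  have e1 : ∀ x : ℝ, shiftShort (G op om) op om a b c d (x+-(Complex.I*op/4)) =
      Complex.I * (oddShort (G op om) op om a b c d x *
      (ssinh (Real.pi/om*x + Real.pi/om*(Complex.I*a)) *
        ssinh (Real.pi/om*x + Real.pi/om*(Complex.I*b)))) := fun x => by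
    rw [← sub_eq_add_neg]; exact shiftShort_sub hg hop hom ha hb c d x
  have e2 : ∀ x : ℝ, shiftLong (G op om) op om κ (x+2*-(Complex.I*op/4)) =
      oddLong (G op om) op om κ x * ssinh (Real.pi/om*x + Real.pi/om*(Complex.I*κ)) := fun x => by
    rw [show (x:ℂ)+2*-(Complex.I*op/4) = x - Complex.I*op/2 by ring]
    exact shiftLong_sub hg hop hom hκ x
  have e3 : ∀ x : ℝ, wLong (G op om) op om κ x = oddLong (G op om) op om κ x *
      ssinh (Real.pi/om * x) := fun x => by
    rw [wLong, oddLong, ssinh_eq]; ring_nf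
  have e : ∀ v : Fin n → ℝ, rootProd (fun x => shiftShort (G op om) op om a b c d
      (x+-(Complex.I*op/4))) (fun x => shiftLong (G op om) op om κ (x+2*-(Complex.I*op/4)))
      (wLong (G op om) op om κ) v = Complex.I^n * (rootProd (oddShort (G op om) op om a b c d)
      (oddLong (G op om) op om κ) (oddLong (G op om) op om κ) v *
      symTerm (Real.pi/om*(Complex.I*a)) (Real.pi/om*(Complex.I*b)) (Real.pi/om*(Complex.I*κ))
        (fun i => (Real.pi/om) * v i)) := fun v => by
    simp only [rootProd, symTerm, e1, Finset.prod_mul_distrib, Finset.prod_const, Finset.card_univ,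
      Fintype.card_fin, pairProd, e3]
    have e2' : ∀ i j, shiftLong (G op om) op om κ (((v i + v j : ℝ) : ℂ)+2*-(Complex.I*op/4)) =
      oddLong (G op om) op om κ (v i + v j) *
        ssinh (Real.pi/om*(v i + v j) + Real.pi/om*(Complex.I*κ)) := fun i j => by
      rw [e2]; push_cast; rfl
    simp only [e2']
    push_cast
    have e4 : ∀ i j, (Real.pi/om * v i + Real.pi/om * v j + Real.pi/om*(Complex.I*κ) : ℂ) =
      Real.pi/om * (v i + v j) + Real.pi/om*(Complex.I*κ) := fun i j => by ring
    have e5 : ∀ i j, (Real.pi/om * v i - Real.pi/om * v j : ℂ) =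
      Real.pi/om * (v i - v j) := fun i j => by ring
    simp only [e4, e5, Finset.prod_mul_distrib]
    ring
  have key := integral_rootProd_mul_symTerm (n := n) (oddShort_neg (G op om) op om a b c d)
    (oddLong_neg (G op om) op om κ) (pi_div_re_ne_zero hom) (Real.pi/om*(Complex.I*a))
    (Real.pi/om*(Complex.I*b)) (Real.pi/om*(Complex.I*κ)) (by
      have := (hint.congr (ae_of_all _ e)).const_mul (Complex.I^n)⁻¹
      refine this.congr (ae_of_all _ fun v => ?_)
      simp only
      rw [inv_mul_cancel_left₀ (pow_ne_zero _ Complex.I_ne_zero)])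
  rw [shiftInt, integral_congr_ae (ae_of_all _ e), integral_const_mul, mul_left_comm, key]
  simp only [← koorFun_eq]
  rfl

/-- Relation between the integrals at `(a,b,c,d)` and `(a-ω₊/2, b-ω₊/2, c+ω₊/2, d+ω₊/2)`. -/
theorem koorInt_half_shift (hG : ∀ a b : ℂ, 0 < a.re → 0 < b.re → IsHypGamma a b (G a b))
    (n : ℕ) (hop : 0 < op.re) (hom : 0 < om.re) (ha : a.re < 0) (hb : b.re < 0)
    (hc : c.re + op.re/2 < 0) (hd : d.re + op.re/2 < 0) (hθ : 0 < ell op om (op + om + (a+b+c+d)))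
    (hκ : κ.re < 0) (hκ' : 0 < ell op om κ) :
    (∏ j ∈ Finset.range n, ssinh (Real.pi/om*(Complex.I*a) + Real.pi/om*(Complex.I*b) +
        j*(Real.pi/om*(Complex.I*κ)))) * koorInt n (G op om) op om a b c d κ =
    (∏ j ∈ Finset.range n, ssinh (Real.pi/om*(Complex.I*(c+op/2)) + Real.pi/om*(Complex.I*(d+op/2)) +
        j*(Real.pi/om*(Complex.I*κ)))) *
      koorInt n (G op om) op om (a-op/2) (b-op/2) (c+op/2) (d+op/2) κ := by
  have h1 := shiftInt_eq hG n hop hom ha hb hc hd hθ hκ hκ'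
  have h2 := shiftInt_eq hG n (a := c+op/2) (b := d+op/2) (c := a-op/2) (d := b-op/2) hop hom
    (by simpa using hc) (by simpa using hd) (by simpa using ha) (by simpa using hb)
    (by convert hθ using 2; ring) hκ hκ'
  have hζ : |(Complex.I*op/4).im| ≤ op.re/4 := by
    have : (Complex.I*op/4).im = op.re/4 := by simp
    rw [this, abs_of_pos (by positivity)]
  have h3 := eq_of_real_translation
    (fun ζ hζ => differentiableAt_shiftInt hG n hop hom ha hb hc hd hθ hκ hκ' hζ)
    (fun ζ s => shiftInt_add_real n (G op om) ζ s) hζ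
    (w := -(Complex.I*op/4)) (by rwa [Complex.neg_im, abs_neg])
  have h4 := shiftInt_neg n (G op om) (op := op) (om := om) (a := a) (b := b) (c := c) (d := d)
    (κ := κ) (-(Complex.I*op/4))
  rw [neg_neg] at h4
  rw [h3, h4, h2] at h1
  have h5 := mul_left_cancel₀ (pow_ne_zero n Complex.I_ne_zero) h1
  rw [← h5]
  congr 1
  have h6 : koorInt n (G op om) op om (c+op/2) (d+op/2) (a-op/2) (b-op/2) κ =
      koorInt n (G op om) op om (a-op/2) (b-op/2) (c+op/2) (d+op/2) κ := by
    have : wShort (G op om) op om (c+op/2) (d+op/2) (a-op/2) (b-op/2) =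
        wShort (G op om) op om (a-op/2) (b-op/2) (c+op/2) (d+op/2) := by
      funext x; simp only [wShort]; ring
    simp only [koorInt, koorFun, this]
  exact h6
end

/-- The product of `n` values of `g` along the progression `A, A+κ, …`. -/
def gProd (n : ℕ) (g : ℂ → ℂ) (op om κ A : ℂ) : ℂ :=
  ∏ j ∈ Finset.range n, g (-Complex.I*((op+om)/2+(A+j*κ)))

/-- The part of the evaluation that depends on the individual parameters. -/
def askeyProd (n : ℕ) (g : ℂ → ℂ) (op om a b c d κ : ℂ) : ℂ :=
  gProd n g op om κ (a+b) * gProd n g op om κ (c+d) *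
    (gProd n g op om κ (a+c) * gProd n g op om κ (b+d)) *
    (gProd n g op om κ (a+d) * gProd n g op om κ (b+c))

theorem gProd_ne_zero (n : ℕ) {op om κ A : ℂ} {g : ℂ → ℂ} (h : IsHypGamma op om g)
    (hop : 0 < op.re) (hom : 0 < om.re) (hκ : κ.re < 0) (hκ' : 0 < ell op om κ)
    (hA : A.re < 0) (hA' : 0 < ell op om (op+om+A)) : gProd n g op om κ A ≠ 0 := by
  refine Finset.prod_ne_zero_iff.mpr fun j _ => h.ne_zero_of_ell hop hom ?_ ?_
  · have : 0 ≤ (j:ℝ) * -κ.re := mul_nonneg j.cast_nonneg (by linarith)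
    simp; linarith
  · rw [← add_assoc, ell_add, ell_nat_mul]; positivity

theorem gProd_shift (n : ℕ) {op om κ A : ℂ} {g : ℂ → ℂ} (h : IsHypGamma op om g)
    (hop : 0 < op.re) (hom : 0 < om.re) (hκ : κ.re < 0) (hA : A.re < 0) :
    gProd n g op om κ (A-op) = Complex.I^n * (∏ j ∈ Finset.range n,
      ssinh (Real.pi/om*(Complex.I*A) + j*(Real.pi/om*(Complex.I*κ)))) * gProd n g op om κ A := by
  have hI : Complex.I^n = ∏ _j ∈ Finset.range n, Complex.I := by simp
  rw [gProd, gProd, hI, ← Finset.prod_mul_distrib, ← Finset.prod_mul_distrib]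
  refine Finset.prod_congr rfl fun j _ => ?_
  have hj : (A+j*κ).re < 0 := by
    have : 0 ≤ (j:ℝ) * -κ.re := mul_nonneg j.cast_nonneg (by linarith)
    simp; linarith
  rw [show A - op + j*κ = A+j*κ-op by ring, h.shift_sinh hop hom hj, ssinh_eq]
  rw [show Real.pi * (Complex.I*(A+j*κ))/om =
    Real.pi/om*(Complex.I*A) + j*(Real.pi/om*(Complex.I*κ)) by ring]
  ring

theorem differentiableAt_gProd (n : ℕ) {op om κ : ℂ} {g A : ℂ → ℂ} {t : ℂ} (h : IsHypGamma op om g)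
    (hop : 0 < op.re) (hom : 0 < om.re) (hκ : κ.re < 0) (hA : (A t).re < 0)
    (hAd : Differentiable ℂ A) : DifferentiableAt ℂ (fun t => gProd n g op om κ (A t)) t := by
  unfold gProd
  refine DifferentiableAt.fun_finsetProd fun j _ => ?_
  have : 0 ≤ (j:ℝ) * -κ.re := mul_nonneg j.cast_nonneg (by linarith)
  refine DifferentiableAt.comp (g := g) (f := fun t => -Complex.I*((op+om)/2+(A t+j*κ))) t
    (h.differentiableAt hop hom ?_) (by fun_prop)
  simp; linarith

theorem differentiableAt_askeyProd (n : ℕ) {op om κ : ℂ} {g a b c d : ℂ → ℂ} {t : ℂ}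
    (h : IsHypGamma op om g)
    (hop : 0 < op.re) (hom : 0 < om.re) (hκ : κ.re < 0) (ha : Differentiable ℂ a)
    (hb : Differentiable ℂ b) (hc : Differentiable ℂ c) (hd : Differentiable ℂ d)
    (ha0 : (a t).re < 0) (hb0 : (b t).re < 0) (hc0 : (c t).re < 0) (hd0 : (d t).re < 0) :
    DifferentiableAt ℂ (fun t => askeyProd n g op om (a t) (b t) (c t) (d t) κ) t := by
  have key := fun {A B : ℂ → ℂ} (hA : Differentiable ℂ A) (hB : Differentiable ℂ B)
    (hA0 : (A t).re < 0) (hB0 : (B t).re < 0) =>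
    differentiableAt_gProd n (A := fun t => A t + B t) h hop hom hκ
      (by simp; linarith) (hA.add hB)
  exact (((key ha hb ha0 hb0).mul (key hc hd hc0 hd0)).mul
    ((key ha hc ha0 hc0).mul (key hb hd hb0 hd0))).mul
    ((key ha hd ha0 hd0).mul (key hb hc hb0 hc0))

theorem askeyProd_swap (n : ℕ) (g : ℂ → ℂ) (op om a b c d κ : ℂ) :
    askeyProd n g om op a b c d κ = askeyProd n g op om a b c d κ := by
  simp only [askeyProd, gProd, add_comm om op]

theorem askeyProd_comm₂₃ (n : ℕ) (g : ℂ → ℂ) (op om a b c d κ : ℂ) :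
    askeyProd n g op om a c b d κ = askeyProd n g op om a b c d κ := by
  simp only [askeyProd, add_comm c b]; ring

theorem askeyProd_comm₂₄ (n : ℕ) (g : ℂ → ℂ) (op om a b c d κ : ℂ) :
    askeyProd n g op om a d c b κ = askeyProd n g op om a b c d κ := by
  simp only [askeyProd, add_comm d b, add_comm d c, add_comm c b]; ring

/-- The integral divided by the parameter-dependent part of its evaluation. -/
def koorRatio (n : ℕ) (g : ℂ → ℂ) (op om a b c d κ : ℂ) : ℂ :=
  koorInt n g op om a b c d κ / askeyProd n g op om a b c d κ

theorem koorRatio_half_shift {G : ℂ → ℂ → ℂ → ℂ}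
    (hG : ∀ a b : ℂ, 0 < a.re → 0 < b.re → IsHypGamma a b (G a b)) (n : ℕ) {op om a b c d κ : ℂ}
    (hop : 0 < op.re) (hom : 0 < om.re) (ha : a.re < 0) (hb : b.re < 0)
    (hc : c.re + op.re/2 < 0) (hd : d.re + op.re/2 < 0) (hθ : 0 < ell op om (op + om + (a+b+c+d)))
    (hκ : κ.re < 0) (hκ' : 0 < ell op om κ)
    (h0 : askeyProd n (G op om) op om a b c d κ ≠ 0)
    (h1 : askeyProd n (G op om) op om (a-op/2) (b-op/2) (c+op/2) (d+op/2) κ ≠ 0) :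
    koorRatio n (G op om) op om (a-op/2) (b-op/2) (c+op/2) (d+op/2) κ =
      koorRatio n (G op om) op om a b c d κ := by
  have h := hG op om hop hom
  have hI := koorInt_half_shift hG n hop hom ha hb hc hd hθ hκ hκ'
  have e1 := gProd_shift n (A := a+b) h hop hom hκ (by simp; linarith)
  have e2 := gProd_shift n (A := c+op/2+(d+op/2)) h hop hom hκ (by simp; linarith)
  simp only [← mul_add] at hI
  rw [show c + op/2 + (d+op/2) - op = c+d by ring] at e2
  generalize (∏ j ∈ Finset.range n, ssinh (Real.pi/om*(Complex.I*(a+b)) +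
    j*(Real.pi/om*(Complex.I*κ)))) = p at hI e1
  generalize (∏ j ∈ Finset.range n, ssinh (Real.pi/om*(Complex.I*(c+op/2+(d+op/2))) +
    j*(Real.pi/om*(Complex.I*κ)))) = q at hI e2
  have hE : p * askeyProd n (G op om) op om a b c d κ =
      q * askeyProd n (G op om) op om (a-op/2) (b-op/2) (c+op/2) (d+op/2) κ := by
    refine mul_left_cancel₀ (pow_ne_zero n Complex.I_ne_zero) ?_
    simp only [askeyProd]
    rw [show a - op/2 + (b-op/2) = a+b-op by ring, show a - op/2+(c+op/2) = a+c by ring,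
      show b - op/2+(d+op/2) = b+d by ring, show a - op/2+(d+op/2) = a+d by ring,
      show b - op/2+(c+op/2) = b+c by ring, e1, e2]
    ring
  have hp : p ≠ 0 := by
    rintro rfl
    rw [zero_mul, eq_comm] at hE
    rcases mul_eq_zero.mp hE with hq | hE
    · rw [hq, mul_zero, zero_mul] at e2
      exact h0 (by rw [askeyProd, e2]; ring)
    · exact h1 hE
  have hq : q ≠ 0 := by
    rintro rfl
    rw [zero_mul] at hE
    exact (mul_ne_zero hp h0) hE
  rw [koorRatio, koorRatio, div_eq_div_iff h1 h0]
  refine mul_left_cancel₀ (mul_ne_zero hp hq) ?_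
  linear_combination (-p * askeyProd n (G op om) op om a b c d κ) * hI +
    (p * koorInt n (G op om) op om a b c d κ) * hE

theorem koorRatio_swap (n : ℕ) (g : ℂ → ℂ) (op om a b c d κ : ℂ) :
    koorRatio n g om op a b c d κ = koorRatio n g op om a b c d κ := by
  rw [koorRatio, koorRatio, koorInt_swap, askeyProd_swap]

theorem koorRatio_comm₂₃ (n : ℕ) (g : ℂ → ℂ) (op om a b c d κ : ℂ) :
    koorRatio n g op om a c b d κ = koorRatio n g op om a b c d κ := by
  rw [koorRatio, koorRatio, koorInt_comm₂₃, askeyProd_comm₂₃]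

theorem koorRatio_comm₂₄ (n : ℕ) (g : ℂ → ℂ) (op om a b c d κ : ℂ) :
    koorRatio n g op om a d c b κ = koorRatio n g op om a b c d κ := by
  rw [koorRatio, koorRatio, koorInt_comm₂₄, askeyProd_comm₂₄]

/-- Parameters close enough to the symmetric point for the double periodicity to apply. -/
def NearSym (op om a b c d : ℂ) : Prop :=
  (a.re < -(op.re+om.re)/4 ∧ b.re < -(op.re+om.re)/4 ∧ c.re < -(op.re+om.re)/4 ∧
    d.re < -(op.re+om.re)/4) ∧
  (0 < ell op om ((op+om)/2+(a+b)) ∧ 0 < ell op om ((op+om)/2+(c+d)) ∧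
    0 < ell op om ((op+om)/2+(a+c)) ∧ 0 < ell op om ((op+om)/2+(b+d)) ∧
    0 < ell op om ((op+om)/2+(a+d)) ∧ 0 < ell op om ((op+om)/2+(b+c)))

theorem NearSym.comm₂₃ {op om a b c d : ℂ} (h : NearSym op om a b c d) :
    NearSym op om a c b d := by
  obtain ⟨⟨h1, h2, h3, h4⟩, h5, h6, h7, h8, h9, h10⟩ := h
  exact ⟨⟨h1, h3, h2, h4⟩, h7, h8, h5, h6, h9, by rwa [add_comm c b]⟩

theorem NearSym.comm₂₄ {op om a b c d : ℂ} (h : NearSym op om a b c d) :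
    NearSym op om a d c b := by
  obtain ⟨⟨h1, h2, h3, h4⟩, h5, h6, h7, h8, h9, h10⟩ := h
  exact ⟨⟨h1, h4, h3, h2⟩, h9, by rwa [add_comm c b], h7, by rwa [add_comm d b], h5,
    by rwa [add_comm d c]⟩

theorem askeyProd_ne_zero (n : ℕ) {op om a b c d κ : ℂ} {g : ℂ → ℂ}
    (h : IsHypGamma op om g) (hop : 0 < op.re) (hom : 0 < om.re) (hκ : κ.re < 0)
    (hκ' : 0 < ell op om κ) (ha : a.re < 0) (hb : b.re < 0) (hc : c.re < 0) (hd : d.re < 0)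
    (h₁ : 0 < ell op om (op+om+(a+b))) (h₂ : 0 < ell op om (op+om+(c+d)))
    (h₃ : 0 < ell op om (op+om+(a+c))) (h₄ : 0 < ell op om (op+om+(b+d)))
    (h₅ : 0 < ell op om (op+om+(a+d))) (h₆ : 0 < ell op om (op+om+(b+c))) :
    askeyProd n g op om a b c d κ ≠ 0 := by
  have key := fun {A B : ℂ} (hA : A.re < 0) (hB : B.re < 0) (hAB : 0 < ell op om (op+om+(A+B))) =>
    gProd_ne_zero n h hop hom hκ hκ' (A := A+B) (by simp; linarith) hAB
  exact mul_ne_zero (mul_ne_zero (mul_ne_zero (key ha hb h₁) (key hc hd h₂))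
    (mul_ne_zero (key ha hc h₃) (key hb hd h₄))) (mul_ne_zero (key ha hd h₅) (key hb hc h₆))

theorem ell_comm (op om z : ℂ) : ell om op z = ell op om z := by
  rw [ell, ell, mul_comm]

theorem continuous_ell (op om : ℂ) : Continuous (ell op om) := by unfold ell; fun_prop

theorem abs_mul_le_half {s x : ℝ} (hs : |s| ≤ 1/2) (hx : 0 < x) : -(x/2) ≤ s*x ∧ s*x ≤ x/2 := by
  rw [← abs_le, abs_mul, abs_of_pos hx]
  nlinarith

theorem convex_pos_of_affine {f : ℂ → ℝ}
    (hf : ∀ (x y : ℂ) (s : ℝ), f ((1-s:ℝ)*x+s*y) = (1-s)*f x+s*f y) : Convex ℝ {z | 0 < f z} := by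
  intro x hx y hy s t hs ht hst
  obtain rfl : s = 1-t := by linarith
  rw [mem_ofPred_eq, Complex.real_smul, Complex.real_smul, hf]
  rw [mem_ofPred_eq] at hx hy
  rcases hs.eq_or_lt with h | h
  · rw [← h, show t = 1 by linarith]; linarith
  · have := mul_nonneg ht hy.le
    have := mul_pos h hx
    linarith

theorem convex_neg_of_affine {f : ℂ → ℝ}
    (hf : ∀ (x y : ℂ) (s : ℝ), f ((1-s:ℝ)*x+s*y) = (1-s)*f x+s*f y) : Convex ℝ {z | f z < 0} := by
  have := convex_pos_of_affine (f := fun z => -f z) (fun x y s => by simp only [hf]; ring)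
  simpa using this

theorem koorRatio_const_direction {G : ℂ → ℂ → ℂ → ℂ}
    (hG : ∀ a b : ℂ, 0 < a.re → 0 < b.re → IsHypGamma a b (G a b)) (n : ℕ) {op om a b c d κ z : ℂ}
    (hop : 0 < op.re) (hom : 0 < om.re) (him : (op * starRingEnd ℂ om).im ≠ 0)
    (hθ : 0 < ell op om (op + om + (a+b+c+d)))
    (hκ : κ.re < 0) (hκ' : 0 < ell op om κ)
    (h0 : NearSym op om a b c d) (hz : NearSym op om (a+z) (b+z) (c-z) (d-z)) :
    koorRatio n (G op om) op om (a+z) (b+z) (c-z) (d-z) κ =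
      koorRatio n (G op om) op om a b c d κ := by
  have h := hG op om hop hom
  have hl1 := inv_re_pos hop
  have hl2 := inv_re_pos hom
  set V : Set ℂ := ({z | (a+z).re < 0} ∩ {z | (b+z).re < 0} ∩ ({z | (c-z).re < 0} ∩
    {z | (d-z).re < 0})) ∩ ({z | 0 < ell op om (op+om+(a+z+(b+z)))} ∩
      {z | 0 < ell op om (op+om+(c-z+(d-z)))}) with hVdef
  have hVo : IsOpen V := by
    refine IsOpen.inter (IsOpen.inter (IsOpen.inter ?_ ?_) (IsOpen.inter ?_ ?_))
      (IsOpen.inter ?_ ?_)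
    iterate 4 exact isOpen_lt (by fun_prop) continuous_const
    iterate 2 exact isOpen_lt continuous_const ((continuous_ell op om).comp (by fun_prop))
  have hVc : Convex ℝ V := by
    refine Convex.inter (Convex.inter (Convex.inter ?_ ?_) (Convex.inter ?_ ?_))
      (Convex.inter ?_ ?_)
    iterate 4 exact convex_neg_of_affine fun x y s => by simp; ring
    iterate 2
      refine convex_pos_of_affine fun x y s => ?_
      simp only [ell_add, ell_sub, ell_real_mul]
      ring
  have hω : 0 < ell op om (op+om) := by rw [ell_op_add_om hop hom]; positivity
  obtain ⟨⟨k1, k2, k3, k4⟩, k5, k6, k7, k8, k9, k10⟩ := h0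
  obtain ⟨⟨l1, l2, l3, l4⟩, l5, l6, l7, l8, l9, l10⟩ := hz
  simp only [ell_add, ell_sub, ell_half, Complex.add_re, Complex.sub_re] at *
  have hN : ∀ w ∈ V, askeyProd n (G op om) op om (a+w) (b+w) (c-w) (d-w) κ ≠ 0 := by
    rintro w ⟨⟨⟨m1, m2⟩, ⟨m3, m4⟩⟩, m5, m6⟩
    refine askeyProd_ne_zero n h hop hom hκ hκ' m1 m2 m3 m4 m5 m6 ?_ ?_ ?_ ?_ <;>
    · simp only [ell_add, ell_sub]
      linarith
  have hper : ∀ w ∈ V, w - op/2 ∈ V → koorRatio n (G op om) op om (a+w-op/2) (b+w-op/2) (c-w+op/2)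
      (d-w+op/2) κ = koorRatio n (G op om) op om (a+w) (b+w) (c-w) (d-w) κ := by
    rintro w hw hw'
    have e1 := hN w hw
    have e2 := hN _ hw'
    obtain ⟨⟨⟨m1, m2⟩, ⟨m3, m4⟩⟩, m5, m6⟩ := hw
    obtain ⟨⟨⟨n1, n2⟩, ⟨n3, n4⟩⟩, n5, n6⟩ := hw'
    rw [mem_ofPred_eq] at m1 m2 n3 n4
    simp only [← sub_add, ← add_sub_assoc] at e2
    refine koorRatio_half_shift hG n hop hom m1 m2 ?_ ?_ ?_ hκ hκ' e1 e2
    · simp at n3 ⊢; linarith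
    · simp at n4 ⊢; linarith
    · simp only [ell_add, ell_sub]; linarith
  have hper' : ∀ w ∈ V, w - om/2 ∈ V → koorRatio n (G op om) op om (a+w-om/2) (b+w-om/2) (c-w+om/2)
      (d-w+om/2) κ = koorRatio n (G op om) op om (a+w) (b+w) (c-w) (d-w) κ := by
    rintro w hw hw'
    have e1 := hN w hw
    have e2 := hN _ hw'
    obtain ⟨⟨⟨m1, m2⟩, ⟨m3, m4⟩⟩, m5, m6⟩ := hw
    obtain ⟨⟨⟨n1, n2⟩, ⟨n3, n4⟩⟩, n5, n6⟩ := hw'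
    rw [mem_ofPred_eq] at m1 m2 n3 n4
    simp only [← sub_add, ← add_sub_assoc] at e2
    rw [← koorRatio_swap, ← koorRatio_swap _ _ op om]
    rw [← askeyProd_swap] at e1 e2
    refine koorRatio_half_shift (G := fun a b => G b a) (fun a b ha hb => (hG b a hb ha).swap)
      n hom hop m1 m2 ?_ ?_ ?_ hκ (by rwa [ell_comm]) e1 e2
    · simp at n3 ⊢; linarith
    · simp at n4 ⊢; linarith
    · rw [ell_comm]; simp only [ell_add, ell_sub]; linarith
  have hd : DifferentiableOn ℂ
      (fun w => koorRatio n (G op om) op om (a+w) (b+w) (c-w) (d-w) κ) V := by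
    intro w hw
    refine (DifferentiableAt.fun_div (d := fun w => askeyProd n (G op om) op om (a+w) (b+w) (c-w)
      (d-w) κ) ?_ ?_ (hN w hw)).differentiableWithinAt
    · obtain ⟨⟨⟨m1, m2⟩, ⟨m3, m4⟩⟩, m5, m6⟩ := hw
      refine differentiableAt_koorInt hG n (by fun_prop) (by fun_prop) (by fun_prop) (by fun_prop)
        hop hom m1 m2 m3 m4 ?_ hκ hκ'
      simp only [ell_add, ell_sub]; linarith
    · obtain ⟨⟨⟨m1, m2⟩, ⟨m3, m4⟩⟩, m5, m6⟩ := hw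
      exact differentiableAt_askeyProd n h hop hom hκ (by fun_prop) (by fun_prop) (by fun_prop)
        (by fun_prop) m1 m2 m3 m4
  have main := eqOn_const_of_two_periods hVo hVc hd (w₁ := op/2) (w₂ := om/2) ?_ ?_ ?_ ?_ z ?_
  · simpa using main
  · rw [show op/2 = ((1/2:ℝ):ℂ)*op by push_cast; ring, show om/2 = ((1/2:ℝ):ℂ)*om by push_cast; ring,
      map_mul, Complex.conj_ofReal, show ((1/2:ℝ):ℂ)*op*(((1/2:ℝ):ℂ)*starRingEnd ℂ om) =
        ((1/4:ℝ):ℂ)*(op*starRingEnd ℂ om) by push_cast; ring, Complex.im_ofReal_mul]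
    exact mul_ne_zero (by norm_num) him
  · intro s t hs ht
    have b1 := abs_mul_le_half hs hop
    have b2 := abs_mul_le_half ht hom
    have b3 := abs_mul_le_half hs hl2
    have b4 := abs_mul_le_half ht hl1
    rw [ell_op hop, ell_om hom] at *
    refine ⟨⟨⟨?_, ?_⟩, ⟨?_, ?_⟩⟩, ?_, ?_⟩ <;> rw [mem_ofPred_eq] <;>
      simp only [ell_add, ell_sub, ell_real_mul, ell_half, ell_op hop, ell_om hom,
        Complex.add_re, Complex.sub_re, Complex.re_ofReal_mul, Complex.div_ofNat_re] <;>
      linarith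
  · intro w hw hw'
    have := hper (w+op/2) hw' (by simpa using hw)
    ring_nf at this ⊢
    exact this.symm
  · intro w hw hw'
    have := hper' (w+om/2) hw' (by simpa using hw)
    ring_nf at this ⊢
    exact this.symm
  · refine ⟨⟨⟨?_, ?_⟩, ⟨?_, ?_⟩⟩, ?_, ?_⟩ <;> rw [mem_ofPred_eq] <;>
      simp only [ell_add, ell_sub, Complex.add_re, Complex.sub_re] <;> linarith

theorem NearSym.eventually {op om : ℂ} {a b c d : ℂ → ℂ} (ha : Continuous a) (hb : Continuous b)
    (hc : Continuous c) (hd : Continuous d) {t₀ : ℂ}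
    (h : NearSym op om (a t₀) (b t₀) (c t₀) (d t₀)) :
    ∀ᶠ t in 𝓝 t₀, NearSym op om (a t) (b t) (c t) (d t) := by
  obtain ⟨⟨h1, h2, h3, h4⟩, h5, h6, h7, h8, h9, h10⟩ := h
  have hr := fun {γ : ℂ → ℂ} (hγ : Continuous γ) (h : (γ t₀).re < -(op.re+om.re)/4) =>
    ((Complex.continuous_re.comp hγ).tendsto t₀).eventually_lt_const h
  have hl := fun {γ δ : ℂ → ℂ} (hγ : Continuous γ) (hδ : Continuous δ)
      (h : 0 < ell op om ((op+om)/2+(γ t₀+δ t₀))) =>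
    (((continuous_ell op om).comp (continuous_const.add (hγ.add hδ))).tendsto
      t₀).eventually_const_lt h
  filter_upwards [hr ha h1, hr hb h2, hr hc h3, hr hd h4, hl ha hb h5, hl hc hd h6, hl ha hc h7,
    hl hb hd h8, hl ha hd h9, hl hb hc h10] with t k1 k2 k3 k4 k5 k6 k7 k8 k9 k10
  exact ⟨⟨k1, k2, k3, k4⟩, k5, k6, k7, k8, k9, k10⟩

theorem nearSym_of_eq {op om p : ℂ} (h1 : (op+om+4*p).re < 0) (h2 : 0 < ell op om (op+om+4*p)) :
    NearSym op om p p p p := by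
  have e : ell op om ((op+om)/2+(p+p)) = ell op om (op+om+4*p)/2 := by
    rw [← ell_half]; congr 1; ring
  have e' : p.re < -(op.re+om.re)/4 := by
    simp at h1; linarith
  have e'' : 0 < ell op om ((op+om)/2+(p+p)) := by rw [e]; positivity
  exact ⟨⟨e', e', e', e'⟩, e'', e'', e'', e'', e'', e''⟩

section
variable {G : ℂ → ℂ → ℂ → ℂ} {op om κ : ℂ}

theorem NearSym.askeyProd_ne_zero {a b c d : ℂ} (h : NearSym op om a b c d) (n : ℕ) {g : ℂ → ℂ}
    (hg : IsHypGamma op om g) (hop : 0 < op.re) (hom : 0 < om.re) (hκ : κ.re < 0)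
    (hκ' : 0 < ell op om κ) : askeyProd n g op om a b c d κ ≠ 0 := by
  obtain ⟨⟨h1, h2, h3, h4⟩, h5, h6, h7, h8, h9, h10⟩ := h
  have hω : 0 < ell op om (op+om) := by
    rw [ell_op_add_om hop hom]; exact add_pos (inv_re_pos hop) (inv_re_pos hom)
  have hl : ∀ A, 0 < ell op om ((op+om)/2+A) → 0 < ell op om (op+om+A) := fun A hA => by
    rw [ell_add, ell_half] at hA
    rw [ell_add]; linarith
  exact _root_.askeyProd_ne_zero n hg hop hom hκ hκ' (by linarith) (by linarith) (by linarith)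
    (by linarith) (hl _ h5) (hl _ h6) (hl _ h7) (hl _ h8) (hl _ h9) (hl _ h10)

theorem koorRatio_eventually_const
    (hG : ∀ a b : ℂ, 0 < a.re → 0 < b.re → IsHypGamma a b (G a b)) (n : ℕ)
    (hop : 0 < op.re) (hom : 0 < om.re) (him : (op * starRingEnd ℂ om).im ≠ 0)
    (hκ : κ.re < 0) (hκ' : 0 < ell op om κ) {p : ℂ} (h1 : (op+om+4*p).re < 0)
    (h2 : 0 < ell op om (op+om+4*p)) (x y w : ℂ) :
    ∀ᶠ t in 𝓝 (0:ℂ), NearSym op om (p+t*x+t*y+t*w) (p+t*x-t*y-t*w) (p-t*x+t*y-t*w) (p-t*x-t*y+t*w) ∧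
      koorRatio n (G op om) op om (p+t*x+t*y+t*w) (p+t*x-t*y-t*w) (p-t*x+t*y-t*w) (p-t*x-t*y+t*w) κ =
      koorRatio n (G op om) op om p p p p κ := by
  have h0 := nearSym_of_eq h1 h2
  have e1 := NearSym.eventually (a := fun t => p+t*x) (b := fun t => p+t*x) (c := fun t => p-t*x)
    (d := fun t => p-t*x) (op := op) (om := om) (t₀ := 0) (by fun_prop) (by fun_prop) (by fun_prop)
    (by fun_prop) (by simpa using h0)
  have e2 := NearSym.eventually (a := fun t => p+t*x+t*y) (b := fun t => p+t*x-t*y)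
    (c := fun t => p-t*x+t*y)
    (d := fun t => p-t*x-t*y) (op := op) (om := om) (t₀ := 0) (by fun_prop) (by fun_prop) (by fun_prop)
    (by fun_prop) (by simpa using h0)
  have e3 := NearSym.eventually (a := fun t => p+t*x+t*y+t*w) (b := fun t => p+t*x-t*y-t*w)
    (c := fun t => p-t*x+t*y-t*w)
    (d := fun t => p-t*x-t*y+t*w) (op := op) (om := om) (t₀ := 0) (by fun_prop) (by fun_prop) (by fun_prop)
    (by fun_prop) (by simpa using h0)
  filter_upwards [e1, e2, e3] with t m1 m2 m3
  refine ⟨m3, ?_⟩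
  have hθ : ∀ A, A = 4*p → 0 < ell op om (op+om+A) := by rintro A rfl; exact h2
  rw [← koorRatio_const_direction hG n hop hom him (hθ _ (by ring)) hκ hκ' h0 m1,
    ← koorRatio_comm₂₃ n (G op om) op om (p+t*x),
    ← koorRatio_const_direction hG n hop hom him (hθ _ (by ring)) hκ hκ' m1.comm₂₃ m2.comm₂₃,
    koorRatio_comm₂₃ n (G op om) op om (p+t*x+t*y) (p+t*x-t*y), ← koorRatio_comm₂₄ n (G op om) op om (p+t*x+t*y),
    ← koorRatio_const_direction hG n hop hom him (hθ _ (by ring)) hκ hκ' m2.comm₂₄ m3.comm₂₄,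
    koorRatio_comm₂₄]

theorem koorInt_eq_ratio_mul
    (hG : ∀ a b : ℂ, 0 < a.re → 0 < b.re → IsHypGamma a b (G a b)) (n : ℕ)
    (hop : 0 < op.re) (hom : 0 < om.re) (him : (op * starRingEnd ℂ om).im ≠ 0)
    (hκ : κ.re < 0) (hκ' : 0 < ell op om κ) {p a b c d : ℂ} (h1 : (op+om+4*p).re < 0)
    (h2 : 0 < ell op om (op+om+4*p)) (hs : a+b+c+d = 4*p)
    (ha : a.re < 0) (hb : b.re < 0) (hc : c.re < 0) (hd : d.re < 0) :
    koorInt n (G op om) op om a b c d κ =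
      koorRatio n (G op om) op om p p p p κ * askeyProd n (G op om) op om a b c d κ := by
  have h := hG op om hop hom
  have hp : p.re < 0 := by simp at h1; linarith
  set q : ℂ → ℂ → ℂ := fun e t => p+t*(e-p) with hq
  have hqd : ∀ e, Differentiable ℂ (q e) := fun e => by fun_prop
  set D : Set ℂ := ({t | (q a t).re < 0} ∩ {t | (q b t).re < 0}) ∩
    ({t | (q c t).re < 0} ∩ {t | (q d t).re < 0}) with hD
  have hDo : IsOpen D := by
    refine IsOpen.inter (IsOpen.inter ?_ ?_) (IsOpen.inter ?_ ?_) <;>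
      exact isOpen_lt (by fun_prop) continuous_const
  have hDc : Convex ℝ D := by
    refine Convex.inter (Convex.inter ?_ ?_) (Convex.inter ?_ ?_) <;>
      exact convex_neg_of_affine fun x y s => by simp [hq]; ring
  have hI : DifferentiableOn ℂ
      (fun t => koorInt n (G op om) op om (q a t) (q b t) (q c t) (q d t) κ) D := by
    rintro t ⟨⟨m1, m2⟩, m3, m4⟩
    refine (differentiableAt_koorInt hG n (hqd a) (hqd b) (hqd c) (hqd d)
        hop hom m1 m2 m3 m4 ?_ hκ hκ').differentiableWithinAt
    rwa [show q a t + q b t + q c t + q d t = 4*p by simp only [hq]; linear_combination t*hs]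
  have hE : DifferentiableOn ℂ (fun t => koorRatio n (G op om) op om p p p p κ *
      askeyProd n (G op om) op om (q a t) (q b t) (q c t) (q d t) κ) D := by
    rintro t ⟨⟨m1, m2⟩, m3, m4⟩
    exact ((differentiableAt_askeyProd n h hop hom hκ (hqd a) (hqd b) (hqd c) (hqd d)
        m1 m2 m3 m4).const_mul _).differentiableWithinAt
  have hev := koorRatio_eventually_const hG n hop hom him hκ hκ' h1 h2 ((a+b)/2-p) ((a+c)/2-p)
    ((a+d)/2-p)
  have key := (hI.analyticOnNhd hDo).eqOn_of_preconnected_of_eventuallyEq (hE.analyticOnNhd hDo)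
    hDc.isPreconnected (z₀ := 0) (by simp [hD, hq, hp]) ?_
  · have := key (x := 1) (by simp [hD, hq, ha, hb, hc, hd])
    simpa [hq] using this
  · filter_upwards [hev] with t ht
    obtain ⟨ht1, ht2⟩ := ht
    have e1 : p+t*((a+b)/2-p)+t*((a+c)/2-p)+t*((a+d)/2-p) = q a t := by
      simp only [hq]; linear_combination t/2*hs
    have e2 : p+t*((a+b)/2-p)-t*((a+c)/2-p)-t*((a+d)/2-p) = q b t := by
      simp only [hq]; linear_combination -t/2*hs
    have e3 : p-t*((a+b)/2-p)+t*((a+c)/2-p)-t*((a+d)/2-p) = q c t := by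
      simp only [hq]; linear_combination -t/2*hs
    have e4 : p-t*((a+b)/2-p)-t*((a+c)/2-p)+t*((a+d)/2-p) = q d t := by
      simp only [hq]; linear_combination -t/2*hs
    rw [e1, e2, e3, e4] at ht1 ht2
    have hne := ht1.askeyProd_ne_zero n h hop hom hκ hκ'
    rw [← ht2, koorRatio, div_mul_cancel₀ _ hne]

end

/-- The entire function `sinh z / z`. -/
def sinhQuot : ℂ → ℂ := dslope Complex.sinh 0

theorem mul_sinhQuot (z : ℂ) : z * sinhQuot z = Complex.sinh z := by
  simpa [sinhQuot] using sub_smul_dslope Complex.sinh 0 z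

theorem sinhQuot_zero : sinhQuot 0 = 1 := by
  simp [sinhQuot, dslope_same]

theorem continuous_sinhQuot : Continuous sinhQuot := by
  refine continuous_iff_continuousAt.mpr fun z => ?_
  by_cases hz : z = 0
  · rw [hz]; exact continuousAt_dslope_same.mpr Complex.differentiable_sinh.differentiableAt
  · exact (continuousAt_dslope_of_ne hz).mpr Complex.continuous_sinh.continuousAt

theorem sinhQuot_ne_zero {om z : ℂ} (hom : 0 < om.re) (hz : |z.im| < om.re) :
    sinhQuot (Real.pi*z/om) ≠ 0 := by
  intro h
  have h0 := ne_zero_of_re_pos hom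
  have hs : Complex.sinh (Real.pi*z/om) = 0 := by rw [← mul_sinhQuot, h, mul_zero]
  have hc : Complex.cosh (Real.pi*(z+Complex.I*om/2)/om) = 0 := by
    rw [show Real.pi*(z+Complex.I*om/2)/om = Real.pi*z/om + Real.pi*Complex.I/2 by field_simp,
      cosh_add_pi_I_div_two, hs, mul_zero]
  obtain ⟨k, hk⟩ := cosh_eq_zero_iff_exists h0 hc
  have hz' : z = Complex.I*om*k := by linear_combination hk
  by_cases hk0 : k = 0
  · rw [hz', hk0] at h
    simp [sinhQuot_zero] at h
  · have h1 : (1:ℝ) ≤ |(k:ℝ)| := by exact_mod_cast Int.one_le_abs hk0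
    have : z.im = om.re*k := by rw [hz']; simp
    rw [this, abs_mul, abs_of_pos hom] at hz
    nlinarith

/-- The function `z / (2 sinh (π z/ω))`, extended continuously to the origin. -/
def sinhRecip (om z : ℂ) : ℂ := om/(2*Real.pi)/sinhQuot (Real.pi*z/om)

theorem sinhRecip_mul {om z : ℂ} (hom : 0 < om.re) (hz : |z.im| < om.re) :
    sinhRecip om z * (2 * Complex.sinh (Real.pi*z/om)) = z := by
  have h0 := ne_zero_of_re_pos hom
  have h1 := sinhQuot_ne_zero hom hz
  have h2 : (Real.pi:ℂ) ≠ 0 := Complex.ofReal_ne_zero.mpr Real.pi_ne_zero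
  rw [sinhRecip, ← mul_sinhQuot]
  field_simp

theorem sinhRecip_zero (om : ℂ) : sinhRecip om 0 = om/(2*Real.pi) := by
  simp [sinhRecip, sinhQuot_zero]

theorem DecayFam.of_large {t₀ : ℂ} {r : ℝ} {f : ℂ → ℝ → ℂ}
    (hc : ∀ᶠ t in 𝓝 t₀, ∀ x : ℝ, ContinuousAt (fun p : ℂ × ℝ => f p.1 p.2) (t, x))
    (hd : ∀ ρ < r, ∃ C : ℝ, 0 ≤ C ∧ ∀ᶠ t in 𝓝 t₀, ∀ x : ℝ, 1 ≤ |x| →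
      ‖f t x‖ ≤ C * Real.exp (-(Real.pi*ρ*|x|))) : DecayFam t₀ r f where
  cont := hc
  decay ρ hρ := by
    obtain ⟨C, hC, hd⟩ := hd ρ hρ
    obtain ⟨δ, hδ, hb⟩ := Metric.eventually_nhds_iff_ball.mp hc
    have hK : IsCompact (Metric.closedBall t₀ (δ/2) ×ˢ Icc (-1:ℝ) 1) :=
      (isCompact_closedBall _ _).prod isCompact_Icc
    obtain ⟨M, hM⟩ := hK.exists_bound_of_continuousOn (f := fun p : ℂ × ℝ => f p.1 p.2)
      fun p hp => (hb p.1 (Metric.closedBall_subset_ball (by linarith) hp.1) p.2).continuousWithinAt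
    refine ⟨max C (M * Real.exp (Real.pi*|ρ|)), hC.trans (le_max_left _ _), ?_⟩
    filter_upwards [hd, Metric.closedBall_mem_nhds t₀ (half_pos hδ)] with t h1 h2 x
    rcases le_total 1 |x| with hx | hx
    · exact (h1 x hx).trans (mul_le_mul_of_nonneg_right (le_max_left _ _) (Real.exp_pos _).le)
    · have h3 := hM (t, x) ⟨h2, abs_le.mp hx⟩
      have hM0 : 0 ≤ M := (norm_nonneg _).trans h3
      refine h3.trans ((?_ : M ≤ M * Real.exp (Real.pi*|ρ|) * Real.exp (-(Real.pi*ρ*|x|))).trans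
        (mul_le_mul_of_nonneg_right (le_max_right _ _) (Real.exp_pos _).le))
      rw [mul_assoc, ← Real.exp_add]
      refine le_mul_of_one_le_right hM0 (Real.one_le_exp ?_)
      have : ρ * |x| ≤ |ρ| := (le_abs_self _).trans (by
        rw [abs_mul, abs_abs]; exact mul_le_of_le_one_right (abs_nonneg _) hx)
      have := mul_le_mul_of_nonneg_left this Real.pi_pos.le
      linarith

theorem decayFam_sinhRecip {om : ℂ} (hom : 0 < om.re) (e : ℂ) :
    DecayFam 0 (om⁻¹).re (fun t x => sinhRecip om (x+e*t)) := by
  have hr := inv_re_pos hom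
  have hcont : Continuous fun t : ℂ => (e*t).im := by fun_prop
  refine DecayFam.of_large ?_ ?_
  · have h1 : ∀ᶠ t : ℂ in 𝓝 0, |(e*t).im| < om.re :=
      (hcont.abs.tendsto 0).eventually_lt_const (by simpa using hom)
    filter_upwards [h1] with t ht x
    refine ContinuousAt.div continuousAt_const ?_ (sinhQuot_ne_zero hom (by simpa using ht))
    exact (continuous_sinhQuot.comp (by fun_prop :
      Continuous fun p : ℂ × ℝ => Real.pi*(p.2+e*p.1)/om)).continuousAt
  · intro ρ hρ
    set r := (om⁻¹).re with hrdef
    have h1 : ∀ᶠ t : ℂ in 𝓝 0, |(e*t/om).re| < r/2 := by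
      have : Continuous fun t : ℂ => |(e*t/om).re| := by fun_prop
      exact (this.tendsto 0).eventually_lt_const (by simpa using half_pos hr)
    have h2 : ∀ᶠ t : ℂ in 𝓝 0, ‖e*t‖ < 1 := by
      have : Continuous fun t : ℂ => ‖e*t‖ := by fun_prop
      exact (this.tendsto 0).eventually_lt_const (by simp)
    have h3 : ∀ᶠ t : ℂ in 𝓝 0, |(e*t).im| < om.re :=
      (hcont.abs.tendsto 0).eventually_lt_const (by simpa using hom)
    have hq : 0 < 1 - Real.exp (-(Real.pi*r)) := by
      have := Real.exp_lt_one_iff (x := -(Real.pi*r)) |>.mpr (by have := mul_pos Real.pi_pos hr; linarith)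
      linarith
    set q := 1 - Real.exp (-(Real.pi*r)) with hqdef
    have hd : 0 < Real.pi*(r-ρ) := mul_pos Real.pi_pos (by linarith)
    refine ⟨2/(Real.pi*(r-ρ))*Real.exp (Real.pi*(r/2))/q, by positivity, ?_⟩
    filter_upwards [h1, h2, h3] with t h1 h2 h3 x hx
    set w : ℂ := Real.pi*(x+e*t)/om with hw
    have hwre : w.re = Real.pi*(x*r+(e*t/om).re) := by
      rw [hw, show Real.pi*(x+e*t)/om = (Real.pi:ℂ)*((x:ℂ)*om⁻¹+e*t/om) by ring,
        Complex.re_ofReal_mul, Complex.add_re, Complex.re_ofReal_mul]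
    have hwabs : Real.pi*(|x| * r-r/2) ≤ |w.re| := by
      rw [hwre, abs_mul, abs_of_pos Real.pi_pos]
      refine mul_le_mul_of_nonneg_left ?_ Real.pi_pos.le
      have := abs_sub_abs_le_abs_sub (x*r) (-(e*t/om).re)
      rw [abs_neg, sub_neg_eq_add, abs_mul, abs_of_pos hr] at this
      linarith
    have hsinh : Real.sinh |w.re| ≤ ‖Complex.sinh w‖ := by
      rcases abs_cases w.re with ⟨h, _⟩ | ⟨h, _⟩
      · rw [h]; exact sinh_re_le_norm_sinh w
      · rw [h]; simpa using sinh_re_le_norm_sinh (-w)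
    have hsinh2 : q/2*Real.exp |w.re| ≤ Real.sinh |w.re| := by
      have : Real.exp (-|w.re|) ≤ Real.exp (-(Real.pi*r)) * Real.exp |w.re| := by
        rw [← Real.exp_add]
        refine Real.exp_le_exp.mpr ?_
        have : Real.pi*(r/2) ≤ Real.pi*(|x| * r-r/2) :=
          mul_le_mul_of_nonneg_left (by nlinarith) Real.pi_pos.le
        linarith
      rw [Real.sinh_eq]; linarith
    have hlow : q/2*Real.exp (Real.pi*(|x| * r-r/2)) ≤ ‖Complex.sinh w‖ :=
      (mul_le_mul_of_nonneg_left (Real.exp_le_exp.mpr hwabs) (by positivity)).trans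
        (hsinh2.trans hsinh)
    have hz : ‖(x:ℂ)+e*t‖ ≤ 2*|x| := by
      have := norm_add_le (x:ℂ) (e*t)
      rw [Complex.norm_real, Real.norm_eq_abs] at this
      linarith
    have hz2 : |x| ≤ Real.exp (Real.pi*(r-ρ)*|x|)/(Real.pi*(r-ρ)) := by
      rw [le_div_iff₀ hd]
      have := Real.add_one_le_exp (Real.pi*(r-ρ)*|x|)
      linarith
    have hmul := congrArg norm (sinhRecip_mul (om := om) (z := x+e*t) hom (by simpa using h3))
    rw [norm_mul, norm_mul, Complex.norm_ofNat] at hmul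
    have hpos : 0 < q/2*Real.exp (Real.pi*(|x| * r-r/2)) := by positivity
    have hfin : ‖sinhRecip om (x+e*t)‖ * (q*Real.exp (Real.pi*(|x| * r-r/2))) ≤
        2*(Real.exp (Real.pi*(r-ρ)*|x|)/(Real.pi*(r-ρ))) := by
      have := mul_le_mul_of_nonneg_left hlow (norm_nonneg (sinhRecip om (x+e*t)))
      linarith
    rw [← le_div_iff₀ (by positivity)] at hfin
    refine hfin.trans (le_of_eq ?_)
    rw [show Real.pi*(|x| * r-r/2) = Real.pi*|x| * r + -(Real.pi*(r/2)) by ring,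
      show Real.pi*(r-ρ)*|x| = Real.pi*|x| * r + -(Real.pi*ρ*|x|) by ring, Real.exp_add, Real.exp_add,
      Real.exp_neg (Real.pi*(r/2))]
    have := hq.ne'
    have := hd.ne'
    field_simp

theorem decayFam_sinhQuot {op : ℂ} (hop : 0 < op.re) {m : ℝ} (hm : 0 < m) :
    DecayFam 0 (-(m*(op⁻¹).re))
      (fun _ x => 2*m*Real.pi/op * sinhQuot (m*Real.pi*x/op)) := by
  have h := decayFam_sinh_div (op := fun _ => op) (t₀ := 0) continuous_const
    (fun _ => ne_zero_of_re_pos hop) hop hm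
  refine DecayFam.of_large (Eventually.of_forall fun t x => ?_) fun ρ hρ => ?_
  · exact (continuous_const.mul (continuous_sinhQuot.comp (by fun_prop :
      Continuous fun p : ℂ × ℝ => m*Real.pi*p.2/op))).continuousAt
  · obtain ⟨C, hC, hb⟩ := h.decay ρ hρ
    refine ⟨C, hC, ?_⟩
    filter_upwards [hb] with t hb x hx
    refine le_trans ?_ (hb x)
    rw [← mul_sinhQuot, show 2*(m*Real.pi*x/op*sinhQuot (m*Real.pi*x/op)) =
      x*(2*m*Real.pi/op*sinhQuot (m*Real.pi*x/op)) by ring, norm_mul (x:ℂ), Complex.norm_real]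
    exact le_mul_of_one_le_left (norm_nonneg _) hx

theorem two_sinh_eq_mul_sinhQuot (m : ℝ) (op : ℂ) (x : ℝ) :
    2*Complex.sinh (m*Real.pi*x/op) = x*(2*m*Real.pi/op * sinhQuot (m*Real.pi*x/op)) := by
  rw [← mul_sinhQuot]; ring

theorem pairProd_comp_perm_of_symm {R : Type*} {n : ℕ} (f : R → R → ℂ) (hf : ∀ x y, f x y = f y x)
    (u : Fin n → R) (τ : Equiv.Perm (Fin n)) : pairProd f (u ∘ τ) = pairProd f u := by
  let w : Fin n → R × ℂ := fun i => (u i, ((i:ℕ):ℂ))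
  have h1 := pairProd_comp_perm (fun p q : R × ℂ => f p.1 q.1 * (p.2 - q.2))
    (fun x y => by rw [hf]; ring) w τ
  have h2 := pairProd_comp_perm (fun p q : R × ℂ => p.2 - q.2) (fun x y => by ring) w τ
  rw [pairProd_mul, pairProd_mul, h2] at h1
  have h3 : pairProd (fun p q : R × ℂ => p.2 - q.2) w ≠ 0 := by
    refine Finset.prod_ne_zero_iff.mpr fun i _ => Finset.prod_ne_zero_iff.mpr fun j hj => ?_
    simp only [w, sub_ne_zero, ne_eq, Nat.cast_inj]
    have := Finset.mem_Ioi.mp hj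
    omega
  have h4 : (Equiv.Perm.sign τ : ℂ) ≠ 0 := by
    rcases Int.units_eq_one_or (Equiv.Perm.sign τ) with h | h <;> simp [h]
  have h5 : pairProd (fun p q : R × ℂ => f p.1 q.1) (w ∘ τ) = pairProd f (u ∘ τ) :=
    pairProd_congr fun _ _ => rfl
  have h6 : pairProd (fun p q : R × ℂ => f p.1 q.1) w = pairProd f u :=
    pairProd_congr fun _ _ => rfl
  rw [h5, h6] at h1
  refine mul_right_cancel₀ (mul_ne_zero h4 h3) ?_
  linear_combination h1

theorem rootProd_comp_perm {n : ℕ} (f : ℝ → ℂ) {p q : ℝ → ℂ} (hq : ∀ x, q (-x) = q x)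
    (v : Fin n → ℝ) (τ : Equiv.Perm (Fin n)) : rootProd f p q (v ∘ τ) = rootProd f p q v := by
  rw [rootProd, rootProd, pairProd_comp_perm_of_symm _ fun x y => by
    rw [add_comm, ← hq (x-y), neg_sub]]
  congr 1
  exact Equiv.prod_comp τ fun i => f (v i)

theorem integral_comp_perm {n : ℕ} (F : (Fin n → ℝ) → ℂ) (τ : Equiv.Perm (Fin n)) :
    ∫ v, F (v ∘ τ) = ∫ v, F v := by
  have := (volume_measurePreserving_piCongrLeft (fun _ : Fin n => ℝ) τ.symm).integral_comp' F
  rw [← this]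
  refine integral_congr_ae (Eventually.of_forall fun v => ?_)
  dsimp only
  congr 1
  funext i
  have := Equiv.piCongrLeft_apply_apply (fun _ : Fin n => ℝ) τ.symm v (τ i)
  rw [MeasurableEquiv.coe_piCongrLeft]
  simpa using this.symm

/-- Vectors whose coordinate of index `i` has the strictly smallest absolute value. -/
def minCoord {n : ℕ} (i : Fin n) : Set (Fin n → ℝ) := {v | ∀ j, j ≠ i → |v i| < |v j|}

theorem measurableSet_minCoord {n : ℕ} (i : Fin n) : MeasurableSet (minCoord i) := by
  have : minCoord i = ⋂ j, {v : Fin n → ℝ | j ≠ i → |v i| < |v j|} := by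
    ext v; simp [minCoord]
  rw [this]
  refine MeasurableSet.iInter fun j => ?_
  by_cases h : j = i
  · simp [h]
  · simp only [ne_eq, h, not_false_eq_true, true_imp_iff]
    exact measurableSet_lt (by fun_prop) (by fun_prop)

theorem minCoord_comp_perm {n : ℕ} (τ : Equiv.Perm (Fin n)) (i : Fin n) (v : Fin n → ℝ) :
    v ∘ τ ∈ minCoord i ↔ v ∈ minCoord (τ i) := by
  simp only [minCoord, mem_ofPred_eq, Function.comp]
  refine ⟨fun h j hj => ?_, fun h j hj => h _ (by simpa using hj)⟩
  simpa using h (τ.symm j) (by rwa [ne_eq, Equiv.symm_apply_eq])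

theorem ae_linear_ne_zero {n : ℕ} (L : (Fin n → ℝ) →ₗ[ℝ] ℝ) (hL : L ≠ 0) :
    ∀ᵐ v : Fin n → ℝ, L v ≠ 0 := by
  have := Measure.addHaar_submodule (volume : Measure (Fin n → ℝ)) (LinearMap.ker L)
    (by rwa [ne_eq, LinearMap.ker_eq_top])
  rw [ae_iff]
  simp only [not_not]
  exact this

theorem ae_coord_ne_zero {n : ℕ} : ∀ᵐ v : Fin n → ℝ, ∀ i, v i ≠ 0 := by
  refine ae_all_iff.mpr fun i => ae_linear_ne_zero (LinearMap.proj i) fun h => ?_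
  have := LinearMap.congr_fun h (Pi.single i 1)
  simp at this

theorem ae_abs_ne {n : ℕ} : ∀ᵐ v : Fin n → ℝ, ∀ i j, i ≠ j → |v i| ≠ |v j| := by
  refine ae_all_iff.mpr fun i => ae_all_iff.mpr fun j => ?_
  by_cases hij : i = j
  · simp [hij]
  let p : Fin n → (Fin n → ℝ) →ₗ[ℝ] ℝ := fun i => LinearMap.proj i
  have h1 : ∀ᵐ v : Fin n → ℝ, (p i - p j) v ≠ 0 := by
    refine ae_linear_ne_zero _ fun h => ?_
    have := LinearMap.congr_fun h (Pi.single i 1)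
    simp [p, Ne.symm hij] at this
  have h2 : ∀ᵐ v : Fin n → ℝ, (p i + p j) v ≠ 0 := by
    refine ae_linear_ne_zero _ fun h => ?_
    have := LinearMap.congr_fun h (Pi.single i 1)
    simp [p, Ne.symm hij] at this
  filter_upwards [h1, h2] with v h1 h2
  intro _ h
  rcases abs_eq_abs.mp h with h | h
  · exact h1 (by simp [p, h])
  · exact h2 (by simp [p, h])

theorem sum_indicator_minCoord {n : ℕ} (F : (Fin (n+1) → ℝ) → ℂ) :
    ∀ᵐ v : Fin (n+1) → ℝ, F v = ∑ i, (minCoord i).indicator F v := by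
  filter_upwards [ae_abs_ne] with v hv
  obtain ⟨i, _, hi⟩ := Finset.exists_min_image Finset.univ (fun i => |v i|) Finset.univ_nonempty
  rw [Finset.sum_eq_single i]
  · rw [indicator_of_mem]
    exact fun j hj => lt_of_le_of_ne (hi j (Finset.mem_univ _)) (hv i j hj.symm)
  · intro j _ hj
    refine indicator_of_notMem (fun h => ?_) _
    exact absurd ((show ∀ k, k ≠ j → |v j| < |v k| from h) i hj.symm) (not_lt.mpr (hi j (Finset.mem_univ _)))
  · simp

theorem integral_eq_mul_integral_minCoord {n : ℕ} {F : (Fin (n+1) → ℝ) → ℂ} (hF : Integrable F)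
    (hs : ∀ v (τ : Equiv.Perm (Fin (n+1))), F (v ∘ τ) = F v) :
    ∫ v, F v = (n+1) * ∫ v, (minCoord 0).indicator F v := by
  rw [integral_congr_ae (sum_indicator_minCoord F),
    integral_finsetSum _ fun i _ => hF.indicator (measurableSet_minCoord i)]
  have : ∀ i : Fin (n+1), ∫ v, (minCoord i).indicator F v = ∫ v, (minCoord 0).indicator F v := by
    intro i
    rw [← integral_comp_perm _ (Equiv.swap 0 i)]
    congr 1
    funext v
    have := minCoord_comp_perm (Equiv.swap 0 i) i v
    rw [Equiv.swap_apply_right] at this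
    by_cases h : v ∈ minCoord 0
    · rw [indicator_of_mem h, indicator_of_mem (this.mpr h), hs]
    · rw [indicator_of_notMem h, indicator_of_notMem (fun h' => h (this.mp h'))]
  simp [this]

theorem integral_scale_zero {n : ℕ} {F : (Fin (n+1) → ℝ) → ℂ} {ε : ℝ} (hε : 0 < ε)
    (hF : AEStronglyMeasurable F) :
    ∫ v, F v = ε * ∫ v : Fin (n+1) → ℝ, F (Fin.cons (ε * v 0) (Fin.tail v)) := by
  set D : Fin (n+1) → ℝ := Fin.cons ε (fun _ => 1) with hD
  have hdet : Matrix.det (Matrix.diagonal D) = ε := by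
    simp [Matrix.det_diagonal, Fin.prod_univ_succ, hD]
  have h := Real.smul_map_diagonal_volume_pi (D := D) (by rw [hdet]; exact hε.ne')
  rw [hdet, abs_of_pos hε] at h
  have hfun : ∀ v : Fin (n+1) → ℝ, Matrix.toLin' (Matrix.diagonal D) v =
      Fin.cons (ε * v 0) (Fin.tail v) := fun v => by
    funext i
    rw [Matrix.toLin'_apply, Matrix.mulVec_diagonal]
    refine Fin.cases ?_ (fun j => ?_) i <;> simp [hD, Fin.tail]
  have hm : Measurable (Matrix.toLin' (Matrix.diagonal D)) :=
    (LinearMap.continuous_on_pi _).measurable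
  have hF' : AEStronglyMeasurable F (Measure.map (Matrix.toLin' (Matrix.diagonal D)) volume) := by
    refine hF.mono_ac ?_
    conv_rhs => rw [← h]
    exact Measure.absolutelyContinuous_smul (by simpa using hε)
  conv_lhs => rw [← h]
  rw [integral_smul_measure, integral_map hm.aemeasurable hF']
  simp only [hfun, ENNReal.toReal_ofReal hε.le, Complex.real_smul]

theorem integral_mul_tail {n : ℕ} (φ : ℝ → ℂ) (Ψ : (Fin n → ℝ) → ℂ) :
    ∫ v : Fin (n+1) → ℝ, φ (v 0) * Ψ (Fin.tail v) = (∫ x, φ x) * ∫ v, Ψ v := by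
  rw [← integral_prod_mul, ← Measure.volume_eq_prod,
    ← (volume_preserving_piFinSuccAbove (fun _ : Fin (n+1) => ℝ) 0).integral_comp']
  rfl

theorem integrable_sq_div_one_add_sq_sq : Integrable fun x : ℝ => x^2/(1+x^2)^2 := by
  refine integrable_inv_one_add_sq.mono' (Measurable.aestronglyMeasurable (by fun_prop)) (Eventually.of_forall fun x => ?_)
  rw [Real.norm_of_nonneg (by positivity), div_le_iff₀ (by positivity), sq (1+x^2), ← mul_assoc,
    inv_mul_cancel₀ (by positivity)]
  linarith

theorem integral_sq_div_one_add_sq_sq : ∫ x : ℝ, x^2/(1+x^2)^2 = Real.pi/2 := by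
  have hd : ∀ x : ℝ, HasDerivAt (fun x => (Real.arctan x - x/(1+x^2))/2) (x^2/(1+x^2)^2) x := by
    intro x
    have h0 : (1+x^2) ≠ 0 := by positivity
    have h1 : HasDerivAt (fun x : ℝ => 1+x^2) (2*x) x := by
      simpa using (hasDerivAt_pow 2 x).const_add 1
    have h := ((Real.hasDerivAt_arctan x).sub ((hasDerivAt_id x).div h1 h0)).div_const 2
    have e : x^2/(1+x^2)^2 = (1/(1+x^2) - (1*(1+x^2) - id x*(2*x))/(1+x^2)^2)/2 := by
      simp only [id]
      field_simp
      ring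
    rw [e]
    exact h
  have hlim : ∀ l : Filter ℝ, Tendsto (fun x : ℝ => |x|) l atTop →
      Tendsto (fun x : ℝ => x/(1+x^2)) l (𝓝 0) := by
    intro l hl
    refine squeeze_zero_norm' ?_ (tendsto_inv_atTop_zero.comp hl)
    filter_upwards [hl.eventually_gt_atTop 0] with x hx
    rw [Real.norm_eq_abs, abs_div, abs_of_pos (by positivity : 0 < 1+x^2), Function.comp,
      div_le_iff₀ (by positivity), inv_mul_eq_div, le_div_iff₀ hx, ← sq, sq_abs]
    linarith
  have hb := (tendsto_nhds_of_tendsto_nhdsWithin Real.tendsto_arctan_atBot).sub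
    (hlim _ tendsto_abs_atBot_atTop)
  have ht := (tendsto_nhds_of_tendsto_nhdsWithin Real.tendsto_arctan_atTop).sub
    (hlim _ tendsto_abs_atTop_atTop)
  rw [integral_of_hasDerivAt_of_tendsto hd integrable_sq_div_one_add_sq_sq
    (hb.div_const 2) (ht.div_const 2)]
  ring

theorem indicator_minCoord_cons {n : ℕ} (f p q : ℝ → ℂ) (z : ℝ) (u : Fin n → ℝ) :
    (minCoord 0).indicator (rootProd f p q) (Fin.cons z u : Fin (n+1) → ℝ) =
      f z * rootProd (fun x => if |z| < |x| then p (z+x) * q (z-x) * f x else 0) p q u := by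
  have hmem : (Fin.cons z u : Fin (n+1) → ℝ) ∈ minCoord 0 ↔ ∀ j, |z| < |u j| := by
    refine ⟨fun h j => ?_, fun h j => ?_⟩
    · simpa using (show ∀ k : Fin (n+1), k ≠ 0 → |(Fin.cons z u : Fin (n+1) → ℝ) 0| <
        |(Fin.cons z u : Fin (n+1) → ℝ) k| from h) j.succ (Fin.succ_ne_zero j)
    · refine Fin.cases (fun h => absurd rfl h) (fun i _ => ?_) j
      simpa using h i
  by_cases h : ∀ j, |z| < |u j|
  · rw [indicator_of_mem (hmem.mpr h), rootProd, rootProd, pairProd_cons, Fin.prod_univ_succ]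
    simp only [h, if_true, Fin.cons_zero, Fin.cons_succ, Finset.prod_mul_distrib]
    ring
  · rw [indicator_of_notMem (mt hmem.mp h)]
    push Not at h
    obtain ⟨j, hj⟩ := h
    rw [rootProd, Finset.prod_eq_zero (Finset.mem_univ j) (by simp [hj])]
    simp

/-- The weight `x² / (x² + ε²)²`, which concentrates at the origin as `ε` tends to zero. -/
def pinchWeight (ε x : ℝ) : ℝ := x^2/(x^2+ε^2)^2

theorem pinchWeight_nonneg (ε x : ℝ) : 0 ≤ pinchWeight ε x := by
  unfold pinchWeight; positivity

theorem continuous_pinchWeight {ε : ℝ} (hε : 0 < ε) : Continuous (pinchWeight ε) := by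
  unfold pinchWeight
  exact Continuous.div (by fun_prop) (by fun_prop) fun x => by positivity

theorem sq_mul_pinchWeight_le (ε x : ℝ) : x^2 * pinchWeight ε x ≤ 1 := by
  unfold pinchWeight
  rw [← mul_div_assoc]
  refine div_le_one_of_le₀ ?_ (by positivity)
  nlinarith [sq_nonneg x, sq_nonneg ε, mul_nonneg (sq_nonneg x) (sq_nonneg ε)]

theorem sq_mul_pinchWeight_scale {ε : ℝ} (hε : 0 < ε) (x : ℝ) :
    ε^2 * pinchWeight ε (ε*x) = x^2/(1+x^2)^2 := by
  unfold pinchWeight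
  have : (1+x^2) ≠ 0 := by positivity
  have : ((ε*x)^2+ε^2) = ε^2*(1+x^2) := by ring
  rw [this]
  field_simp

theorem tendsto_pinch {n : ℕ} {H : ℝ → ℝ → ℂ} {W : ℝ → ℂ} {C K c : ℝ} (hc : 0 < c)
    (hWc : Continuous W) (hWe : ∀ x, W (-x) = W x) (hW1 : ∀ x, ‖W x‖ ≤ K)
    (hW2 : ∀ x, ‖W x‖ ≤ K * x^2) (hHc : ∀ᶠ ε in 𝓝[>] 0, Continuous (H ε))
    (hHb : ∀ᶠ ε in 𝓝[>] 0, ∀ x, ‖H ε x‖ ≤ C * Real.exp (-(c * |x|)))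
    (hH0 : ∀ x, ContinuousAt (fun p : ℝ × ℝ => H p.1 p.2) (0, x))
    (hint : ∀ᶠ ε in 𝓝[>] 0, Integrable
      (rootProd (n := n+1) (fun x => pinchWeight ε x * H ε x) W W)) :
    Tendsto (fun ε : ℝ => ε * ∫ v : Fin (n+1) → ℝ,
        rootProd (fun x => pinchWeight ε x * H ε x) W W v) (𝓝[>] 0)
      (𝓝 ((n+1) * (Real.pi/2 * H 0 0 *
        ∫ v : Fin n → ℝ, rootProd (fun x => W x^2 * (H 0 x/(x:ℂ)^2)) W W v))) := by
  have hpos : ∀ᶠ ε : ℝ in 𝓝[>] 0, 0 < ε := self_mem_nhdsWithin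
  have hK : 0 ≤ K := (norm_nonneg _).trans (hW1 0)
  have hC : 0 ≤ C := by
    obtain ⟨ε, h⟩ := hHb.exists
    simpa using (norm_nonneg _).trans (h 0)
  set F : ℝ → ℝ → ℝ → ℂ := fun ε z x => if |z| < |x| then
    W (z+x) * W (z-x) * (pinchWeight ε x * H ε x) else 0 with hF
  set Φ : ℝ → (Fin (n+1) → ℝ) → ℂ := fun ε v =>
    ((v 0^2/(1+v 0^2)^2 : ℝ) * H ε (ε * v 0)) * rootProd (F ε (ε * v 0)) W W (Fin.tail v) with hΦ
  have hcons : ∀ ε : ℝ, 0 < ε → ∀ v : Fin (n+1) → ℝ, (ε:ℂ)^2 * (minCoord 0).indicator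
      (rootProd (fun x => pinchWeight ε x * H ε x) W W) (Fin.cons (ε * v 0) (Fin.tail v)) = Φ ε v := by
    intro ε hε v
    rw [indicator_minCoord_cons]
    simp only [hΦ, hF]
    rw [← sq_mul_pinchWeight_scale hε]
    push_cast
    ring
  have hmeas : ∀ᶠ ε in 𝓝[>] 0, AEStronglyMeasurable ((minCoord (0 : Fin (n+1))).indicator
      (rootProd (fun x => pinchWeight ε x * H ε x) W W)) := by
    filter_upwards [hint] with ε h using h.1.indicator (measurableSet_minCoord 0)
  have hstep : ∀ᶠ ε : ℝ in 𝓝[>] 0, (n+1) * ∫ v, Φ ε v = ε * ∫ v : Fin (n+1) → ℝ,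
        rootProd (fun x => pinchWeight ε x * H ε x) W W v := by
    filter_upwards [hpos, hint, hmeas] with ε hε hi hm
    rw [integral_eq_mul_integral_minCoord hi fun v τ => rootProd_comp_perm _ hWe v τ,
      integral_scale_zero hε hm]
    simp only [← hcons ε hε, integral_const_mul]
    ring
  refine Tendsto.congr' hstep (Tendsto.const_mul _ ?_)
  have hlim : ∫ v : Fin (n+1) → ℝ, (((v 0^2/(1+v 0^2)^2 : ℝ):ℂ) * H 0 0) *
      rootProd (fun x => W x^2 * (H 0 x/(x:ℂ)^2)) W W (Fin.tail v) = Real.pi/2 * H 0 0 *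
        ∫ v : Fin n → ℝ, rootProd (fun x => W x^2 * (H 0 x/(x:ℂ)^2)) W W v := by
    rw [integral_mul_tail (fun x => ((x^2/(1+x^2)^2 : ℝ):ℂ) * H 0 0)
      (rootProd (fun x => W x^2 * (H 0 x/(x:ℂ)^2)) W W), integral_mul_const,
      integral_complex_ofReal, integral_sq_div_one_add_sq_sq]
    push_cast
    rfl
  rw [← hlim]
  set B : ℝ → ℝ := fun x => 4*K^2*C*Real.exp (-(c * |x|)) with hB
  have hBi : Integrable B := (integrable_exp_neg_mul_abs' hc).const_mul _
  set M : ℝ := pairProd (fun _ _ : ℝ => K*K) (fun _ : Fin n => (0:ℝ)) with hM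
  refine tendsto_integral_filter_of_dominated_convergence
    (fun v => (v 0^2/(1+v 0^2)^2*C) * ((∏ i, B (Fin.tail v i)) * M)) ?_ ?_ ?_ ?_
  · filter_upwards [hpos, hHc] with ε hε hHc
    have hφ : Continuous fun v : Fin (n+1) → ℝ =>
        (((v 0^2/(1+v 0^2)^2 : ℝ):ℂ) * H ε (ε * v 0)) := by
      refine Continuous.mul (Complex.continuous_ofReal.comp ?_) (hHc.comp (by fun_prop))
      exact Continuous.div (by fun_prop) (by fun_prop) fun x => by positivity
    refine hφ.measurable.aestronglyMeasurable.mul (Measurable.aestronglyMeasurable ?_)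
    have hFm : Measurable fun p : ℝ × ℝ => F ε p.1 p.2 := by
      refine Measurable.ite (measurableSet_lt (by fun_prop) (by fun_prop)) ?_ measurable_const
      have := continuous_pinchWeight hε
      exact Continuous.measurable (by fun_prop)
    unfold rootProd pairProd
    refine Measurable.mul ?_ ?_
    · refine Finset.measurable_prod _ fun i _ => ?_
      exact hFm.comp (by unfold Fin.tail; fun_prop :
        Measurable fun v : Fin (n+1) → ℝ => (ε * v 0, Fin.tail v i))
    · unfold Fin.tail
      exact Continuous.measurable (by fun_prop)
  · filter_upwards [hpos, hHb] with ε hε hHb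
    refine Eventually.of_forall fun v => ?_
    rw [hΦ, norm_mul, norm_mul, Complex.norm_real, Real.norm_of_nonneg (by positivity)]
    refine mul_le_mul ?_ ?_ (norm_nonneg _) (by positivity)
    · refine mul_le_mul_of_nonneg_left ((hHb _).trans ?_) (by positivity)
      exact mul_le_of_le_one_right hC (Real.exp_le_one_iff.mpr (by
        have := mul_nonneg hc.le (abs_nonneg (ε * v 0)); linarith))
    · refine (rootProd_norm_le (B := B) (fun x => ?_) hW1 hW1 _).trans_eq rfl
      simp only [hF]
      split_ifs with h
      · rw [norm_mul, norm_mul, norm_mul, Complex.norm_real,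
          Real.norm_of_nonneg (pinchWeight_nonneg _ _)]
        have hx2 : (ε * v 0 - x)^2 ≤ 4*x^2 := by
          have h1 := abs_sub (ε * v 0) x
          have h2 : |ε * v 0 - x| ≤ 2*|x| := by linarith
          have := pow_le_pow_left₀ (abs_nonneg _) h2 2
          rw [sq_abs, mul_pow, sq_abs] at this
          linarith
        have h3 : ‖W (ε * v 0 - x)‖ ≤ K*(4*x^2) :=
          (hW2 _).trans (mul_le_mul_of_nonneg_left hx2 hK)
        calc ‖W (ε * v 0 + x)‖ * ‖W (ε * v 0 - x)‖ * (pinchWeight ε x * ‖H ε x‖)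
            ≤ K * (K*(4*x^2)) * (pinchWeight ε x * (C * Real.exp (-(c * |x|)))) := by
              gcongr
              · exact mul_nonneg (pinchWeight_nonneg _ _) (norm_nonneg _)
              · exact hW1 _
              · exact pinchWeight_nonneg _ _
              · exact hHb x
          _ = 4*K^2*C*Real.exp (-(c * |x|)) * (x^2 * pinchWeight ε x) := by ring
          _ ≤ B x := mul_le_of_le_one_right (by positivity) (sq_mul_pinchWeight_le _ _)
      · rw [norm_zero]; positivity
  · have := Integrable.fintype_prod (𝕜 := ℝ) (μ := fun _ : Fin (n+1) => (volume : Measure ℝ))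
      (f := Fin.cons (fun x : ℝ => x^2/(1+x^2)^2*C) (fun _ => B)) (fun i => by
        refine Fin.cases ?_ (fun j => ?_) i
        · exact integrable_sq_div_one_add_sq_sq.mul_const C
        · exact hBi)
    refine (this.mul_const M).congr (Eventually.of_forall fun v => ?_)
    simp only [Fin.prod_univ_succ, Fin.cons_zero, Fin.cons_succ, Fin.tail]
    ring
  · filter_upwards [ae_coord_ne_zero] with v hv
    have hid : Tendsto (fun ε : ℝ => ε) (𝓝[>] 0) (𝓝 0) := tendsto_nhdsWithin_of_tendsto_nhds tendsto_id
    have hz : Tendsto (fun ε : ℝ => ε * v 0) (𝓝[>] 0) (𝓝 0) := by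
      simpa using hid.mul_const (v 0)
    refine Tendsto.mul (Tendsto.const_mul _ ?_) ?_
    · exact ((hH0 0).tendsto.comp (hid.prodMk_nhds hz))
    · refine Tendsto.mul (tendsto_finsetProd _ fun i _ => ?_) tendsto_const_nhds
      set x := Fin.tail v i with hx
      have hx0 : x ≠ 0 := hv i.succ
      have hev : ∀ᶠ ε : ℝ in 𝓝[>] 0, F ε (ε * v 0) x =
          W (ε * v 0+x) * W (ε * v 0-x) * (pinchWeight ε x * H ε x) := by
        have : Tendsto (fun ε : ℝ => |ε * v 0|) (𝓝[>] 0) (𝓝 0) := by simpa using hz.abs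
        filter_upwards [this.eventually_lt_const (abs_pos.mpr hx0)] with ε h
        simp only [hF, h, if_true]
      refine Tendsto.congr' (hev.mono fun _ h => h.symm) ?_
      have e : W x^2 * (H 0 x/(x:ℂ)^2) = W (0+x) * W (0-x) * (pinchWeight 0 x * H 0 x) := by
        rw [zero_add, zero_sub, hWe, pinchWeight]
        have : (x:ℂ) ≠ 0 := by exact_mod_cast hx0
        push_cast
        field_simp
        ring
      change Tendsto _ _ (𝓝 (W x^2 * (H 0 x/(x:ℂ)^2)))
      rw [e]
      refine Tendsto.mul (((hWc.tendsto _).comp (hz.add_const x)).mul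
        ((hWc.tendsto _).comp (hz.sub_const x))) (Tendsto.mul ?_ ?_)
      · refine (Complex.continuous_ofReal.tendsto _).comp ?_
        unfold pinchWeight
        refine Tendsto.div tendsto_const_nhds ((hid.pow 2).const_add _ |>.pow 2) (by positivity)
      · exact (hH0 x).tendsto.comp (hid.prodMk_nhds tendsto_const_nhds)

theorem sinhQuot_neg (z : ℂ) : sinhQuot (-z) = sinhQuot z := by
  by_cases hz : z = 0
  · simp [hz]
  · refine mul_left_cancel₀ (neg_ne_zero.mpr hz) ?_
    rw [mul_sinhQuot, Complex.sinh_neg, neg_mul, mul_sinhQuot]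

theorem sinhRecip_neg (om z : ℂ) : sinhRecip om (-z) = sinhRecip om z := by
  rw [sinhRecip, sinhRecip, ← sinhQuot_neg (Real.pi*z/om)]
  congr 2
  ring

/-- Behaviour of the hyperbolic gamma function near its first pole. -/
theorem IsHypGamma.mul_pole {op om z : ℂ} {g : ℂ → ℂ} (h : IsHypGamma op om g)
    (hop : 0 < op.re) (hom : 0 < om.re) (hz : 0 < z.im) (hz' : z.im < om.re) :
    z * g (z - Complex.I*((op+om)/2)) =
      Complex.I * sinhRecip om z * g (z + Complex.I*(op-om)/2) := by
  have h0 := ne_zero_of_re_pos hom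
  have h1 := sinhRecip_mul (om := om) (z := z) hom (by rw [abs_of_pos hz]; exact hz')
  rw [h.unshift (z := z + Complex.I*(op-om)/2) hop hom (by simp; linarith),
    show (Real.pi:ℂ)*(z + Complex.I*(op-om)/2 - Complex.I*op/2)/om =
      -(-(Real.pi*z/om) + Real.pi*Complex.I/2) by field_simp; ring, Complex.cosh_neg,
    cosh_add_pi_I_div_two, Complex.sinh_neg,
    show z + Complex.I*(op-om)/2 - Complex.I*op = z - Complex.I*((op+om)/2) by ring]
  linear_combination (-g (z - Complex.I*((op+om)/2))) * h1 + (2*sinhRecip om z *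
    Complex.sinh (Real.pi*z/om) * g (z - Complex.I*((op+om)/2))) * Complex.I_sq

/-- The regular part of `g(x-i(ω-t)) g(-x-i(ω-t))` near the pole at `x = t = 0`. -/
def pinchPair (g : ℂ → ℂ) (op om t : ℂ) (x : ℝ) : ℂ :=
  sinhRecip om (x + Complex.I*t) * sinhRecip om (x + (-Complex.I)*t) *
    gPair g ((om-op)/2-t) ((om-op)/2-t) x

theorem pinchPair_eq {op om : ℂ} {g : ℂ → ℂ} (h : IsHypGamma op om g) (hop : 0 < op.re)
    (hom : 0 < om.re) {ε : ℝ} (hε : 0 < ε) (hε' : ε < om.re) (x : ℝ) :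
    ((x:ℂ)^2+(ε:ℂ)^2) * gPair g ((op+om)/2+-ε) ((op+om)/2+-ε) x = pinchPair g op om ε x := by
  have h1 := h.mul_pole (z := x + Complex.I*ε) hop hom (by simpa) (by simpa)
  have h2 := h.mul_pole (z := -x + Complex.I*ε) hop hom (by simpa) (by simpa)
  rw [show -(x:ℂ) + Complex.I*ε = -(x + (-Complex.I)*ε) by ring, sinhRecip_neg] at h2
  rw [gPair, pinchPair, gPair]
  rw [show (x:ℂ) - Complex.I*((op+om)/2+-ε) = x + Complex.I*ε - Complex.I*((op+om)/2) by ring,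
    show -(x:ℂ) - Complex.I*((op+om)/2+-ε) = -(x+(-Complex.I)*ε) - Complex.I*((op+om)/2) by ring,
    show (x:ℂ) - Complex.I*((om-op)/2-ε) = x + Complex.I*ε + Complex.I*(op-om)/2 by ring,
    show -(x:ℂ) - Complex.I*((om-op)/2-ε) = -(x+(-Complex.I)*ε) + Complex.I*(op-om)/2 by ring]
  set A := g (x + Complex.I*ε - Complex.I*((op+om)/2))
  set B := g (-(x+(-Complex.I)*ε) - Complex.I*((op+om)/2))
  set A' := g (x + Complex.I*ε + Complex.I*(op-om)/2)
  set B' := g (-(x+(-Complex.I)*ε) + Complex.I*(op-om)/2)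
  have h3 : ((x + Complex.I*ε) * A) * (-(x+(-Complex.I)*ε) * B) = (Complex.I * sinhRecip om (x + Complex.I*ε) * A') *
    (Complex.I * sinhRecip om (x + (-Complex.I)*ε) * B') := by rw [h1, h2]
  linear_combination (-1:ℂ) * h3 + ((ε:ℂ)^2*A*B - sinhRecip om (x + Complex.I*ε) *
    sinhRecip om (x + (-Complex.I)*ε) * (A' * B')) * Complex.I_sq

theorem pinchPair_zero_mul {op om : ℂ} {g : ℂ → ℂ} (h : IsHypGamma op om g) (hop : 0 < op.re)
    (hom : 0 < om.re) {x : ℝ} (hx : x ≠ 0) :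
    pinchPair g op om 0 x * ((2*Complex.sinh (Real.pi*x/op)) * (2*Complex.sinh (Real.pi*x/om))) =
      (x:ℂ)^2 := by
  have hs := sinhRecip_mul (om := om) (z := x) hom (by simpa)
  have hs' := sinhRecip_mul (om := op) (z := x) hop (by simpa)
  have hne : Complex.sinh (Real.pi*x/op) ≠ 0 := by
    intro h0
    rw [h0] at hs'
    simp only [mul_zero] at hs'
    exact hx (by exact_mod_cast hs'.symm)
  have h1 := h.mul_top hop hom (x := x) (by simp)
  have h2 := h.swap.shift_top (z := x) hom hop (by simpa)
  have h3 := h.swap.shift_top (z := -x) hom hop (by simpa)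
  rw [add_comm om op] at h2 h3
  rw [h2, h3, show (Real.pi:ℂ)*-x/op = -(Real.pi*x/op) by ring, Complex.sinh_neg] at h1
  rw [pinchPair, gPair, mul_zero, mul_zero, add_zero,
    show (x:ℂ) - Complex.I*((om-op)/2-0) = x + Complex.I*(op-om)/2 by ring,
    show -(x:ℂ) - Complex.I*((om-op)/2-0) = -x + Complex.I*(op-om)/2 by ring]
  set A := g (x + Complex.I*(op-om)/2)
  set B := g (-x + Complex.I*(op-om)/2)
  set s := Complex.sinh (Real.pi*x/op)
  set s' := Complex.sinh (Real.pi*x/om)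
  have h4 : s * (A * B) = s' := by
    refine mul_left_cancel₀ (mul_ne_zero (show (4:ℂ) ≠ 0 by norm_num) hne) ?_
    linear_combination h1 + 4*s^2*A*B*Complex.I_sq
  linear_combination (sinhRecip om x*(2*s') + x) * hs + 4*(sinhRecip om x)^2*s'*h4

theorem pinchPair_zero_zero {G : ℂ → ℂ → ℂ → ℂ}
    (hG : ∀ a b : ℂ, 0 < a.re → 0 < b.re → IsHypGamma a b (G a b)) {op om : ℂ}
    (hop : 0 < op.re) (hom : 0 < om.re) :
    pinchPair (G op om) op om 0 0 = op*om/(4*(Real.pi:ℂ)^2) := by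
  have h := hypGamma_value hG hop hom
  have hsq : (((op*om)^((1:ℂ)/2))^2 : ℂ) = op*om := by
    have := Complex.cpow_nat_inv_pow (op*om) (n := 2) two_ne_zero
    simpa using this
  rw [← hsq, ← h, pinchPair, gPair]
  simp only [Complex.ofReal_zero, mul_zero, add_zero, neg_zero, sinhRecip_zero, sub_zero]
  rw [show 0 - Complex.I*((om-op)/2) = Complex.I*(op-om)/2 by ring]
  ring

/-- The regular part of the weight of a single coordinate when two parameters tend to zero. -/
def pinchReg (g : ℂ → ℂ) (op om τ t : ℂ) (x : ℝ) : ℂ :=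
  ((2*(2:ℝ)*Real.pi/op * sinhQuot ((2:ℝ)*Real.pi*x/op)) *
    (2*(2:ℝ)*Real.pi/om * sinhQuot ((2:ℝ)*Real.pi*x/om))) *
  ((pinchPair g op om t x * pinchPair g op om t x) *
    (gPair g ((op+om)/2+(τ+t)) ((op+om)/2+(τ+t)) x * gPair g ((op+om)/2+(τ+t)) ((op+om)/2+(τ+t)) x))

theorem wShort_eq_pinch {op om τ : ℂ} {g : ℂ → ℂ} (h : IsHypGamma op om g) (hop : 0 < op.re)
    (hom : 0 < om.re) {ε : ℝ} (hε : 0 < ε) (hε' : ε < om.re) (x : ℝ) :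
    wShort g op om (-ε) (-ε) (τ+ε) (τ+ε) x = pinchWeight ε x * pinchReg g op om τ ε x := by
  have h1 := two_sinh_eq_mul_sinhQuot 2 op x
  have h2 := two_sinh_eq_mul_sinhQuot 2 om x
  simp only [Complex.ofReal_ofNat] at h1 h2
  have h3 := pinchPair_eq h hop hom hε hε' x
  have h4 : (x:ℂ)^2+(ε:ℂ)^2 ≠ 0 := by
    exact_mod_cast (by positivity : x^2+ε^2 ≠ 0)
  rw [wShort, h1, h2, pinchReg, ← h3, pinchWeight]
  push_cast
  field_simp

theorem wLong_sq_mul_pinchReg {op om κ τ : ℂ} {g : ℂ → ℂ} (h : IsHypGamma op om g)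
    (hop : 0 < op.re) (hom : 0 < om.re) {x : ℝ} (hx : x ≠ 0) :
    wLong g op om κ x^2 * (pinchReg g op om τ 0 x/(x:ℂ)^2) = wShort g op om κ κ τ τ x := by
  have h1 := two_sinh_eq_mul_sinhQuot 2 op x
  have h2 := two_sinh_eq_mul_sinhQuot 2 om x
  simp only [Complex.ofReal_ofNat] at h1 h2
  have h3 := pinchPair_zero_mul h hop hom hx
  have h4 : (x:ℂ) ≠ 0 := by exact_mod_cast hx
  rw [wLong, pinchReg, wShort, h1, h2, add_zero]
  push_cast
  rw [mul_div_assoc', div_eq_iff (pow_ne_zero 2 h4)]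
  set P := pinchPair g op om 0 x
  set s := 2*Complex.sinh (Real.pi*x/op)
  set s' := 2*Complex.sinh (Real.pi*x/om)
  set a := 2*2*Real.pi/op*sinhQuot (2*Real.pi*x/op)
  set b := 2*2*Real.pi/om*sinhQuot (2*Real.pi*x/om)
  set E := gPair g ((op+om)/2+κ) ((op+om)/2+κ) x
  set F := gPair g ((op+om)/2+τ) ((op+om)/2+τ) x
  linear_combination (a*b*E^2*F^2*(P*(s*s')+(x:ℂ)^2)) * h3

theorem decayFam_pinchPair {G : ℂ → ℂ → ℂ → ℂ}
    (hG : ∀ a b : ℂ, 0 < a.re → 0 < b.re → IsHypGamma a b (G a b)) {op om : ℂ}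
    (hop : 0 < op.re) (hom : 0 < om.re) :
    DecayFam 0 (ell op om (op+om)) (fun t => pinchPair (G op om) op om t) := by
  have h1 := decayFam_sinhRecip hom Complex.I
  have h2 := decayFam_sinhRecip hom (-Complex.I)
  have h3 := decayFam_pair hG (om := om) (op := fun _ => op) (a := fun t => (om-op)/2-t)
    (b := fun t => (om-op)/2-t) continuous_const (by fun_prop) (by fun_prop) (t₀ := 0) hop hom
    (by simp; linarith) (by simp; linarith)
  exact ((h1.mul h2).mul h3).congr_rate (by
    rw [show (om-op)/2-0+((om-op)/2-0) = om-op by ring, ell_sub, ell_add, ell_op hop, ell_om hom]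
    ring)

theorem decayFam_pinchReg {G : ℂ → ℂ → ℂ → ℂ}
    (hG : ∀ a b : ℂ, 0 < a.re → 0 < b.re → IsHypGamma a b (G a b)) {op om τ : ℂ}
    (hop : 0 < op.re) (hom : 0 < om.re) (hτ : τ.re < 0) :
    DecayFam 0 (2*ell op om (op+om+2*τ)) (fun t => pinchReg (G op om) op om τ t) := by
  have h1 := decayFam_sinhQuot hop two_pos
  have h2 := decayFam_sinhQuot hom two_pos
  have h3 := decayFam_pinchPair hG hop hom
  have h4 := decayFam_pair hG (om := om) (op := fun _ => op) (a := fun t => (op+om)/2+(τ+t))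
    (b := fun t => (op+om)/2+(τ+t)) continuous_const (by fun_prop) (by fun_prop) (t₀ := 0) hop hom
    (by simp; linarith) (by simp; linarith)
  exact ((h1.mul h2).mul ((h3.mul h3).mul (h4.mul h4))).congr_rate (by
    rw [show (op+om)/2+(τ+0)+((op+om)/2+(τ+0)) = op+om+2*τ by ring, ell_add (z := op+om) (w := 2*τ),
      ell_op_add_om hop hom]
    ring)

theorem wLong_bounds {G : ℂ → ℂ → ℂ → ℂ}
    (hG : ∀ a b : ℂ, 0 < a.re → 0 < b.re → IsHypGamma a b (G a b)) {op om κ : ℂ}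
    (hop : 0 < op.re) (hom : 0 < om.re) (hκ : κ.re < 0) (hκ' : 0 < ell op om κ) :
    Continuous (wLong (G op om) op om κ) ∧ ∃ K, (∀ x, ‖wLong (G op om) op om κ x‖ ≤ K) ∧
      ∀ x, ‖wLong (G op om) op om κ x‖ ≤ K * x^2 := by
  have hL := decayFam_wLong hG (op := fun _ => op) (t₀ := 0) continuous_const
    (fun _ => ne_zero_of_re_pos hop) hop hom hκ
  have h1 := decayFam_sinhQuot hop one_pos
  have h2 := decayFam_sinhQuot hom one_pos
  have h3 := decayFam_pair hG (om := om) (op := fun _ => op) (a := fun t => (op+om)/2+κ)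
    (b := fun t => (op+om)/2+κ) continuous_const (by fun_prop) (by fun_prop) (t₀ := 0) hop hom
    (by simp; linarith) (by simp; linarith)
  have hQ := ((h1.mul h2).mul h3).congr_rate (s := 2*ell op om κ) (by
    rw [show (op+om)/2+κ+((op+om)/2+κ) = op+om+(κ+κ) by ring, ell_add (z := op+om) (w := κ+κ),
      ell_op_add_om hop hom, ell_add]
    ring)
  obtain ⟨C, hC, hCb⟩ := hL.decay 0 (by linarith)
  obtain ⟨D, hD, hDb⟩ := hQ.decay 0 (by linarith)
  have hCb := hCb.self_of_nhds
  have hDb := hDb.self_of_nhds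
  simp only [mul_zero, zero_mul, neg_zero, Real.exp_zero, mul_one] at hCb hDb
  refine ⟨hL.continuous.self_of_nhds, max C D, fun x => (hCb x).trans (le_max_left _ _), fun x => ?_⟩
  refine le_trans ?_ (mul_le_mul_of_nonneg_right ((hDb x).trans (le_max_right _ _)) (sq_nonneg x))
  have e1 := two_sinh_eq_mul_sinhQuot 1 op x
  have e2 := two_sinh_eq_mul_sinhQuot 1 om x
  simp only [Complex.ofReal_one, one_mul] at e1 e2
  rw [wLong, e1, e2, gPair, ← sq_abs, ← Real.norm_eq_abs, ← Complex.norm_real, ← norm_pow, ← norm_mul]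
  refine le_of_eq (congrArg norm ?_)
  push_cast
  simp only [one_mul]
  ring

theorem ae_coord_ne_zero_rootProd {n : ℕ} {f f' p q : ℝ → ℂ} (h : ∀ x, x ≠ 0 → f x = f' x) :
    (rootProd (n := n) f p q) =ᵐ[volume] rootProd f' p q := by
  filter_upwards [ae_coord_ne_zero] with v hv
  rw [rootProd, rootProd, Finset.prod_congr rfl fun i _ => h (v i) (hv i)]

theorem pinchReg_zero_zero {G : ℂ → ℂ → ℂ → ℂ}
    (hG : ∀ a b : ℂ, 0 < a.re → 0 < b.re → IsHypGamma a b (G a b)) {op om : ℂ} (τ : ℂ)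
    (hop : 0 < op.re) (hom : 0 < om.re) :
    pinchReg (G op om) op om τ 0 0 =
      op*om/(Real.pi:ℂ)^2 * G op om (-Complex.I*((op+om)/2+τ))^4 := by
  have h1 := ne_zero_of_re_pos hop
  have h2 := ne_zero_of_re_pos hom
  have h3 : (Real.pi:ℂ) ≠ 0 := by exact_mod_cast Real.pi_ne_zero
  rw [pinchReg, pinchPair_zero_zero hG hop hom, gPair]
  simp only [Complex.ofReal_zero, mul_zero, zero_div, sinhQuot_zero, neg_zero, add_zero, zero_sub,
    mul_one, neg_mul]
  push_cast
  field_simp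
  ring

/-- The residue of the integral when two of its parameters tend to zero. -/
theorem tendsto_mul_koorInt {G : ℂ → ℂ → ℂ → ℂ}
    (hG : ∀ a b : ℂ, 0 < a.re → 0 < b.re → IsHypGamma a b (G a b)) (n : ℕ) {op om κ τ : ℂ}
    (hop : 0 < op.re) (hom : 0 < om.re) (hκ : κ.re < 0) (hκ' : 0 < ell op om κ) (hτ : τ.re < 0)
    (hτ' : 0 < ell op om (op+om+2*τ)) :
    Tendsto (fun ε : ℝ => (ε:ℂ) * koorInt (n+1) (G op om) op om (-ε) (-ε) (τ+ε) (τ+ε) κ) (𝓝[>] 0)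
      (𝓝 ((n+1) * (op*om/(2*Real.pi) * G op om (-Complex.I*((op+om)/2+τ))^4 *
        koorInt n (G op om) op om κ κ τ τ κ))) := by
  have hg := hG op om hop hom
  obtain ⟨hWc, K, hW1, hW2⟩ := wLong_bounds hG hop hom hκ hκ'
  have hD := decayFam_pinchReg hG hop hom hτ
  obtain ⟨C, hC, hCb⟩ := hD.decay (ell op om (op+om+2*τ)) (by linarith)
  have hlim : Tendsto (fun ε : ℝ => (ε:ℂ)) (𝓝[>] 0) (𝓝 0) := by
    have : Tendsto (fun ε : ℝ => (ε:ℂ)) (𝓝 0) (𝓝 ((0:ℝ):ℂ)) := Complex.continuous_ofReal.tendsto 0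
    rw [Complex.ofReal_zero] at this
    exact this.mono_left nhdsWithin_le_nhds
  have hpos : ∀ᶠ ε : ℝ in 𝓝[>] 0, 0 < ε := self_mem_nhdsWithin
  have hlt : ∀ {r : ℝ}, 0 < r → ∀ᶠ ε : ℝ in 𝓝[>] 0, ε < r := fun hr =>
    nhdsWithin_le_nhds (eventually_lt_nhds hr)
  have heq : ∀ᶠ ε : ℝ in 𝓝[>] 0, rootProd (n := n+1)
      (fun x => pinchWeight ε x * pinchReg (G op om) op om τ ε x) (wLong (G op om) op om κ)
      (wLong (G op om) op om κ) = koorFun (n+1) (G op om) op om (-ε) (-ε) (τ+ε) (τ+ε) κ := by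
    filter_upwards [hpos, hlt hom] with ε h1 h2
    funext v
    rw [koorFun, rootProd, rootProd]
    congr 1
    exact Finset.prod_congr rfl fun i _ => (wShort_eq_pinch hg hop hom h1 h2 (v i)).symm
  have key := tendsto_pinch (n := n) (H := fun ε x => pinchReg (G op om) op om τ ε x)
    (W := wLong (G op om) op om κ) (C := C) (K := K) (c := Real.pi * ell op om (op+om+2*τ))
    (by positivity) hWc (wLong_neg _ _ _ _) hW1 hW2 (hlim.eventually hD.continuous)
    (hlim.eventually hCb) (fun x => by
      have := hD.cont.self_of_nhds x
      have h2 : ContinuousAt (fun p : ℝ × ℝ => ((p.1:ℂ), p.2)) (0, x) := by fun_prop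
      exact ContinuousAt.comp (f := fun p : ℝ × ℝ => ((p.1:ℂ), p.2))
        (g := fun p : ℂ × ℝ => pinchReg (G op om) op om τ p.1 p.2) (by simpa using this) h2)
    (by
      filter_upwards [heq, hpos, hlt (neg_pos.mpr hτ)] with ε h1 h2 h3
      rw [h1]
      refine integrable_koorFun hG (n+1) hop hom (by simpa) (by simpa) (by simp; linarith)
        (by simp; linarith) ?_ hκ hκ'
      rwa [show op + om + (-(ε:ℂ) + -ε + (τ+ε) + (τ+ε)) = op+om+2*τ by ring])
  have hint : ∫ v : Fin n → ℝ, rootProd (fun x => wLong (G op om) op om κ x^2 *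
      (pinchReg (G op om) op om τ ((0:ℝ):ℂ) x/(x:ℂ)^2)) (wLong (G op om) op om κ) (wLong (G op om) op om κ) v =
      koorInt n (G op om) op om κ κ τ τ κ := by
    rw [koorInt]
    refine integral_congr_ae (ae_coord_ne_zero_rootProd fun x hx => ?_)
    rw [Complex.ofReal_zero, wLong_sq_mul_pinchReg hg hop hom hx]
  rw [hint, Complex.ofReal_zero, pinchReg_zero_zero hG τ hop hom] at key
  have h3 : (Real.pi:ℂ) ≠ 0 := by exact_mod_cast Real.pi_ne_zero
  refine (key.congr' ?_).trans_eq ?_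
  · filter_upwards [heq] with ε h1
    rw [h1, koorInt]
  · congr 1
    field_simp

theorem gProd_succ (n : ℕ) (g : ℂ → ℂ) (op om κ A : ℂ) :
    gProd (n+1) g op om κ A = gProd n g op om κ A * g (-Complex.I*((op+om)/2+(A+n*κ))) :=
  Finset.prod_range_succ _ _

theorem gProd_succ' (n : ℕ) (g : ℂ → ℂ) (op om κ A : ℂ) :
    gProd (n+1) g op om κ A = gProd n g op om κ (A+κ) * g (-Complex.I*((op+om)/2+A)) := by
  rw [gProd, Finset.prod_range_succ', gProd]
  simp only [Nat.cast_zero, zero_mul, add_zero, Nat.cast_add, Nat.cast_one]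
  congr 1
  refine Finset.prod_congr rfl fun j _ => ?_
  congr 3
  ring

theorem IsHypGamma.continuousAt_gProd (n : ℕ) {op om κ A : ℂ} {g : ℂ → ℂ}
    (h : IsHypGamma op om g) (hop : 0 < op.re) (hom : 0 < om.re) (hκ : κ.re < 0) (hA : A.re < 0) :
    ContinuousAt (gProd n g op om κ) A := by
  have h1 : ContinuousAt (fun B => ∏ j ∈ Finset.range n, g (-Complex.I*((op+om)/2+(B+j*κ)))) A := by
    refine tendsto_finsetProd _ fun j _ => ?_
    have h2 : (0:ℝ) ≤ (j:ℝ) * -κ.re := mul_nonneg j.cast_nonneg (by linarith)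
    have h3 := h.continuousAt (z := -Complex.I*((op+om)/2+(A+j*κ))) hop hom (by simp; linarith)
    exact ContinuousAt.comp (f := fun B : ℂ => -Complex.I*((op+om)/2+(B+j*κ))) h3 (by fun_prop)
  exact h1

/-- The part of the evaluation that depends on the parameters only through their sum `σ`. -/
def koorConst (n : ℕ) (g : ℂ → ℂ) (op om κ σ : ℂ) : ℂ :=
  2^n * (Nat.factorial n : ℂ) * ((op*om)^((1:ℂ)/2))^n * gProd n g op om κ κ /
    (g (-Complex.I*((op+om)/2+κ))^n * gProd n g op om κ ((n-1)*κ+σ))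

theorem sqrt_period_sq (op om : ℂ) : ((op*om)^((1:ℂ)/2))^2 = op*om := by
  have := Complex.cpow_nat_inv_pow (op*om) (n := 2) two_ne_zero
  simpa using this

theorem sqrt_period_ne_zero {op om : ℂ} (hop : 0 < op.re) (hom : 0 < om.re) :
    (op*om)^((1:ℂ)/2) ≠ 0 := by
  intro h
  have := sqrt_period_sq op om
  rw [h] at this
  exact mul_ne_zero (ne_zero_of_re_pos hop) (ne_zero_of_re_pos hom) (by simpa using this.symm)

theorem tendsto_ofReal_zero : Tendsto (fun ε : ℝ => (ε:ℂ)) (𝓝[>] 0) (𝓝 0) := by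
  have : Tendsto (fun ε : ℝ => (ε:ℂ)) (𝓝 0) (𝓝 ((0:ℝ):ℂ)) := Complex.continuous_ofReal.tendsto 0
  rw [Complex.ofReal_zero] at this
  exact this.mono_left nhdsWithin_le_nhds

theorem tendsto_mul_pole {G : ℂ → ℂ → ℂ → ℂ}
    (hG : ∀ a b : ℂ, 0 < a.re → 0 < b.re → IsHypGamma a b (G a b)) {op om : ℂ}
    (hop : 0 < op.re) (hom : 0 < om.re) :
    Tendsto (fun ε : ℝ => (ε:ℂ) * G op om (-Complex.I*((op+om)/2+(-ε+-ε)))) (𝓝[>] 0)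
      (𝓝 ((op*om)^((1:ℂ)/2)/(4*Real.pi))) := by
  have hg := hG op om hop hom
  have hpi : (Real.pi:ℂ) ≠ 0 := by exact_mod_cast Real.pi_ne_zero
  have h1 : ContinuousAt (fun t : ℂ => sinhRecip om (2*Complex.I*t) *
      G op om (2*Complex.I*t + Complex.I*(op-om)/2) / 2) 0 := by
    refine ContinuousAt.div_const (ContinuousAt.mul ?_ ?_) 2
    · have h2 : ContinuousAt (sinhRecip om) (2*Complex.I*0) := by
        unfold sinhRecip
        refine ContinuousAt.div continuousAt_const ?_ (by simp [sinhQuot_zero])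
        have := continuous_sinhQuot
        fun_prop
      exact ContinuousAt.comp (f := fun t : ℂ => 2*Complex.I*t) h2 (by fun_prop)
    · have h3 := hg.continuousAt (z := 2*Complex.I*0 + Complex.I*(op-om)/2) hop hom
        (by simp; linarith)
      exact ContinuousAt.comp (f := fun t : ℂ => 2*Complex.I*t + Complex.I*(op-om)/2) h3
        (by fun_prop)
  have h2 := h1.tendsto.comp tendsto_ofReal_zero
  have h3 : sinhRecip om (2*Complex.I*0) * G op om (2*Complex.I*0 + Complex.I*(op-om)/2) / 2 =
      (op*om)^((1:ℂ)/2)/(4*Real.pi) := by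
    rw [mul_zero, zero_add, sinhRecip_zero, ← hypGamma_value hG hop hom]
    field_simp
    ring
  rw [h3] at h2
  refine h2.congr' ?_
  have hs : ∀ᶠ ε : ℝ in 𝓝[>] 0, ε < om.re/2 := nhdsWithin_le_nhds (eventually_lt_nhds (by linarith))
  filter_upwards [self_mem_nhdsWithin, hs] with ε hε hε'
  have hε : 0 < ε := hε
  have h4 := hg.mul_pole (z := 2*Complex.I*ε) hop hom (by simpa) (by simp; linarith)
  rw [show 2*Complex.I*(ε:ℂ) - Complex.I*((op+om)/2) = -Complex.I*((op+om)/2+(-ε+-ε)) by ring] at h4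
  refine mul_left_cancel₀ (mul_ne_zero two_ne_zero Complex.I_ne_zero) ?_
  simp only [Function.comp]
  linear_combination -h4

/-- Asymptotics of the product side when two of the parameters tend to zero. -/
theorem tendsto_mul_askeyProd {G : ℂ → ℂ → ℂ → ℂ}
    (hG : ∀ a b : ℂ, 0 < a.re → 0 < b.re → IsHypGamma a b (G a b)) (n : ℕ) {op om κ τ : ℂ}
    (hop : 0 < op.re) (hom : 0 < om.re) (hκ : κ.re < 0) (hτ : τ.re < 0) :
    Tendsto (fun ε : ℝ => (ε:ℂ) * askeyProd (n+1) (G op om) op om (-ε) (-ε) (τ+ε) (τ+ε) κ) (𝓝[>] 0)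
      (𝓝 ((op*om)^((1:ℂ)/2)/(4*Real.pi) * gProd n (G op om) op om κ κ *
        gProd (n+1) (G op om) op om κ (2*τ) * gProd (n+1) (G op om) op om κ τ^4)) := by
  have hg := hG op om hop hom
  have h1 := tendsto_mul_pole hG hop hom
  have h2 : Tendsto (fun ε : ℝ => gProd n (G op om) op om κ (-ε+-ε+κ)) (𝓝[>] 0)
      (𝓝 (gProd n (G op om) op om κ κ)) := by
    have h3 : ContinuousAt (fun t : ℂ => gProd n (G op om) op om κ (-t+-t+κ)) 0 :=
      ContinuousAt.comp (f := fun t : ℂ => -t+-t+κ)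
        (hg.continuousAt_gProd n hop hom hκ (by simpa)) (by fun_prop)
    have h4 := h3.tendsto.comp tendsto_ofReal_zero
    rwa [neg_zero, add_zero, zero_add] at h4
  have h3 : Tendsto (fun ε : ℝ => gProd (n+1) (G op om) op om κ (τ+ε+(τ+ε))) (𝓝[>] 0)
      (𝓝 (gProd (n+1) (G op om) op om κ (2*τ))) := by
    have h3 : ContinuousAt (fun t : ℂ => gProd (n+1) (G op om) op om κ (τ+t+(τ+t))) 0 :=
      ContinuousAt.comp (f := fun t : ℂ => τ+t+(τ+t))
        (hg.continuousAt_gProd (n+1) hop hom hκ (by simp; linarith)) (by fun_prop)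
    have h4 := h3.tendsto.comp tendsto_ofReal_zero
    rwa [add_zero, ← two_mul] at h4
  refine (((h1.mul h2).mul h3).mul_const _).congr fun ε => ?_
  simp only [askeyProd]
  rw [gProd_succ' n (A := -ε+-ε), show -(ε:ℂ)+(τ+ε) = τ by ring]
  ring

theorem ell_theta {op om κ θ : ℂ} (k : ℕ) (hκ' : 0 < ell op om κ) (h : 0 < ell op om (op+om+θ)) :
    0 < ell op om (op+om+(k*κ+θ)) := by
  rw [show op+om+(k*κ+θ) = k*κ + (op+om+θ) by ring, ell_add, ell_nat_mul]
  positivity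

theorem koorInt_eq_of_not_real {G : ℂ → ℂ → ℂ → ℂ}
    (hG : ∀ a b : ℂ, 0 < a.re → 0 < b.re → IsHypGamma a b (G a b)) {op om κ : ℂ}
    (hop : 0 < op.re) (hom : 0 < om.re) (him : (op * (starRingEnd ℂ) om).im ≠ 0)
    (hκ : κ.re < 0) (hκ' : 0 < ell op om κ) (n : ℕ) {a b c d : ℂ}
    (h1 : (op+om+(a+b+c+d)).re < 0) (h2 : 0 < ell op om (op+om+(a+b+c+d)))
    (ha : a.re < 0) (hb : b.re < 0) (hc : c.re < 0) (hd : d.re < 0) :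
    koorInt n (G op om) op om a b c d κ =
      koorConst n (G op om) op om κ (a+b+c+d) * askeyProd n (G op om) op om a b c d κ := by
  have hg := hG op om hop hom
  induction n generalizing a b c d with
  | zero =>
    simp [koorConst, askeyProd, gProd, koorInt, koorFun, rootProd, pairProd, integral_unique, Measure.real,
      volume_pi]
  | succ n ih =>
    set τ := (a+b+c+d)/2 with hτdef
    have hσ : a+b+c+d = 2*τ := by rw [hτdef]; ring
    rw [hσ] at h1 h2 ⊢
    have hτ : τ.re < 0 := by
      simp at h1
      linarith
    have hp : 4*(τ/2) = 2*τ := by ring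
    rw [koorInt_eq_ratio_mul hG (n+1) hop hom him hκ hκ' (p := τ/2) (by rwa [hp]) (by rwa [hp])
      (by rw [hp, hσ]) ha hb hc hd]
    congr 1
    set R := koorRatio (n+1) (G op om) op om (τ/2) (τ/2) (τ/2) (τ/2) κ
    have hpos : ∀ᶠ ε : ℝ in 𝓝[>] 0, 0 < ε := self_mem_nhdsWithin
    have hlt : ∀ᶠ ε : ℝ in 𝓝[>] 0, ε < -τ.re := nhdsWithin_le_nhds (eventually_lt_nhds (by linarith))
    have t1 := (tendsto_mul_askeyProd hG n hop hom hκ hτ).const_mul R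
    have t2 := tendsto_mul_koorInt hG n hop hom hκ hκ' hτ h2
    have heq := tendsto_nhds_unique t2 (t1.congr' (by
      filter_upwards [hpos, hlt] with ε e1 e2
      rw [koorInt_eq_ratio_mul hG (n+1) hop hom him hκ hκ' (p := τ/2) (by rwa [hp]) (by rwa [hp])
        (by ring) (by simpa) (by simpa) (by simp; linarith) (by simp; linarith)]
      ring))
    have hsum : κ+κ+τ+τ = 2*κ+2*τ := by ring
    have h1' : (op+om+(κ+κ+τ+τ)).re < 0 := by
      rw [hsum]; simp at h1 ⊢; linarith
    rw [ih h1' (by rw [hsum]; exact_mod_cast ell_theta 2 hκ' h2) hκ hκ hτ hτ] at heq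
    have hell : 0 < ell op om (op+om) := by
      rw [ell_op_add_om hop hom]; exact add_pos (inv_re_pos hop) (inv_re_pos hom)
    have n1 := gProd_ne_zero n hg hop hom hκ hκ' hκ (by rw [ell_add]; linarith)
    have n2 := gProd_ne_zero (n+1) hg hop hom hκ hκ' (A := 2*τ) (by simp; linarith) h2
    have n3 := gProd_ne_zero (n+1) hg hop hom hκ hκ' hτ (by
      have := h2
      rw [ell_add (z := op+om), show 2*τ = τ+τ by ring, ell_add (z := τ)] at this
      rw [ell_add]; linarith)
    have hre : (n*κ+2*τ).re < 0 := by
      have : (0:ℝ) ≤ (n:ℝ) * -κ.re := mul_nonneg n.cast_nonneg (by linarith)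
      simp; linarith
    have n4 := gProd_ne_zero (n+1) hg hop hom hκ hκ' hre (ell_theta n hκ' h2)
    have n5 := hg.ne_zero_of_ell hop hom hκ (by rw [ell_add]; linarith)
    have hpi : (Real.pi:ℂ) ≠ 0 := by exact_mod_cast Real.pi_ne_zero
    have hs := sqrt_period_ne_zero hop hom
    refine mul_right_cancel₀ (mul_ne_zero (mul_ne_zero (mul_ne_zero (div_ne_zero hs
      (mul_ne_zero (by norm_num : (4:ℂ) ≠ 0) hpi)) n1) n2) (pow_ne_zero 4 n3)) (heq.symm.trans ?_)
    have hsq := sqrt_period_sq op om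
    rw [koorConst, koorConst, askeyProd]
    generalize (op*om)^((1:ℂ)/2) = s at hs hsq ⊢
    rw [← hsq]
    have e1 : ((n+1:ℕ):ℂ)-1 = n := by push_cast; ring
    rw [e1, show ((n:ℂ)-1)*κ+(κ+κ+τ+τ) = n*κ+2*τ+κ by ring, ← two_mul, ← two_mul]
    rw [gProd_succ' n (A := n*κ+2*τ)] at n4 ⊢
    rw [gProd_succ' n (A := κ), gProd_succ' n (A := τ), gProd_succ n (A := 2*τ), ← two_mul,
      add_comm (2*τ) (n*κ), add_comm τ κ, Nat.factorial_succ]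
    have n6 := left_ne_zero_of_mul n4
    have n7 := right_ne_zero_of_mul n4
    push_cast
    generalize G op om (-Complex.I*((op+om)/2+(n*κ+2*τ))) = X at n7 ⊢
    generalize G op om (-Complex.I*((op+om)/2+κ)) = Y at n5 ⊢
    field_simp
    ring

theorem continuousAt_gProd_period {G : ℂ → ℂ → ℂ → ℂ}
    (hG : ∀ a b : ℂ, 0 < a.re → 0 < b.re → IsHypGamma a b (G a b)) (n : ℕ) {op om κ A : ℂ}
    (hop : 0 < op.re) (hom : 0 < om.re) (hκ : κ.re < 0) (hA : A.re < 0) :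
    ContinuousAt (fun p => gProd n (G p om) p om κ A) op := by
  refine tendsto_finsetProd _ fun j _ => ?_
  have h2 : (0:ℝ) ≤ (j:ℝ) * -κ.re := mul_nonneg j.cast_nonneg (by linarith)
  have h3 := continuousAt_hypGamma hG (z := -Complex.I*((op+om)/2+(A+j*κ))) hop hom
    (by simp; linarith)
  exact ContinuousAt.comp (f := fun p : ℂ => (p, -Complex.I*((p+om)/2+(A+j*κ)))) h3 (by fun_prop)

theorem continuousAt_askeyProd_period {G : ℂ → ℂ → ℂ → ℂ}
    (hG : ∀ a b : ℂ, 0 < a.re → 0 < b.re → IsHypGamma a b (G a b)) (n : ℕ) {op om κ a b c d : ℂ}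
    (hop : 0 < op.re) (hom : 0 < om.re) (hκ : κ.re < 0)
    (ha : a.re < 0) (hb : b.re < 0) (hc : c.re < 0) (hd : d.re < 0) :
    ContinuousAt (fun p => askeyProd n (G p om) p om a b c d κ) op := by
  have H : ∀ {x y : ℂ}, x.re < 0 → y.re < 0 →
      ContinuousAt (fun p => gProd n (G p om) p om κ (x+y)) op := fun hx hy =>
    continuousAt_gProd_period hG n hop hom hκ (by simp; linarith)
  exact (((H ha hb).mul (H hc hd)).mul ((H ha hc).mul (H hb hd))).mul ((H ha hd).mul (H hb hc))

theorem nat_mul_add_re_neg {κ σ : ℂ} (n : ℕ) (hκ : κ.re < 0) (hσ : σ.re < 0) :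
    (n*κ+σ).re < 0 := by
  have : (0:ℝ) ≤ (n:ℝ) * -κ.re := mul_nonneg n.cast_nonneg (by linarith)
  simp; linarith

theorem ell_add_pos {op om κ : ℂ} (hop : 0 < op.re) (hom : 0 < om.re) (hκ' : 0 < ell op om κ) :
    0 < ell op om (op+om+κ) := by
  rw [ell_add, ell_op_add_om hop hom]
  linarith [inv_re_pos hop, inv_re_pos hom]

theorem continuousAt_koorConst_period {G : ℂ → ℂ → ℂ → ℂ}
    (hG : ∀ a b : ℂ, 0 < a.re → 0 < b.re → IsHypGamma a b (G a b)) (n : ℕ) {op om κ σ : ℂ}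
    (hop : 0 < op.re) (hom : 0 < om.re) (him : op*om ∈ Complex.slitPlane) (hκ : κ.re < 0)
    (hκ' : 0 < ell op om κ) (h1 : (op+om+σ).re < 0) (h2 : 0 < ell op om (op+om+σ)) :
    ContinuousAt (fun p => koorConst (n+1) (G p om) p om κ σ) op := by
  have hg := hG op om hop hom
  have hσ : σ.re < 0 := by simp at h1; linarith
  have e1 : ((n+1:ℕ):ℂ)-1 = n := by push_cast; ring
  have hA := nat_mul_add_re_neg n hκ hσ
  refine ContinuousAt.div (ContinuousAt.mul (continuousAt_const.mul (ContinuousAt.pow ?_ _))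
    (continuousAt_gProd_period hG _ hop hom hκ hκ)) (ContinuousAt.mul (ContinuousAt.pow ?_ _) ?_) ?_
  · exact ContinuousAt.cpow (f := fun p => p*om) (by fun_prop) continuousAt_const him
  · have h3 := continuousAt_hypGamma hG (z := -Complex.I*((op+om)/2+κ)) hop hom
      (by simp; linarith)
    exact ContinuousAt.comp (f := fun p : ℂ => (p, -Complex.I*((p+om)/2+κ))) h3 (by fun_prop)
  · rw [e1]
    exact continuousAt_gProd_period hG _ hop hom hκ hA
  · rw [e1]
    have hne := hg.ne_zero_of_ell hop hom hκ (ell_add_pos hop hom hκ')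
    have hne_prod := gProd_ne_zero (n+1) hg hop hom hκ hκ' hA (ell_theta n hκ' h2)
    exact mul_ne_zero (pow_ne_zero _ hne) hne_prod

/-- The evaluation of the Koornwinder-type integral. -/
theorem koorInt_eq {G : ℂ → ℂ → ℂ → ℂ}
    (hG : ∀ a b : ℂ, 0 < a.re → 0 < b.re → IsHypGamma a b (G a b)) (n : ℕ) {op om κ a b c d : ℂ}
    (hop : 0 < op.re) (hom : 0 < om.re) (him : op*om ∈ Complex.slitPlane)
    (hκ : κ.re < 0) (hκ' : 0 < ell op om κ)
    (h1 : (op+om+(a+b+c+d)).re < 0) (h2 : 0 < ell op om (op+om+(a+b+c+d)))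
    (ha : a.re < 0) (hb : b.re < 0) (hc : c.re < 0) (hd : d.re < 0) :
    koorInt (n+1) (G op om) op om a b c d κ =
      koorConst (n+1) (G op om) op om κ (a+b+c+d) * askeyProd (n+1) (G op om) op om a b c d κ := by
  by_cases hr : (op * (starRingEnd ℂ) om).im = 0
  swap
  · exact koorInt_eq_of_not_real hG hop hom hr hκ hκ' (n+1) h1 h2 ha hb hc hd
  have hop0 := ne_zero_of_re_pos hop
  have hom0 := ne_zero_of_re_pos hom
  set P : ℂ → ℂ := fun t => op * Complex.exp (Complex.I*t) with hP
  have hP0 : P 0 = op := by simp [hP]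
  have hPc : Continuous P := by fun_prop
  have hPne : ∀ t, P t ≠ 0 := fun t => mul_ne_zero hop0 (Complex.exp_ne_zero _)
  have c1 := continuousAt_koorInt hG (n+1) (t₀ := 0) (om := om) (κ := κ) hPc hPne
    (a := fun _ => a) (b := fun _ => b) (c := fun _ => c) (d := fun _ => d) continuous_const
    continuous_const continuous_const continuous_const (by rwa [hP0]) hom ha hb hc hd
    (by rwa [hP0]) hκ (by rwa [hP0])
  have c2 : ContinuousAt (fun t => koorConst (n+1) (G (P t) om) (P t) om κ (a+b+c+d) *
      askeyProd (n+1) (G (P t) om) (P t) om a b c d κ) 0 := by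
    have := (continuousAt_koorConst_period hG n hop hom him hκ hκ' h1 h2).mul
      (continuousAt_askeyProd_period hG (n+1) hop hom hκ ha hb hc hd)
    rw [← hP0] at this
    exact ContinuousAt.comp (f := P) this hPc.continuousAt
  have l1 := c1.tendsto.comp tendsto_ofReal_zero
  have l2 := c2.tendsto.comp tendsto_ofReal_zero
  rw [hP0] at l1 l2
  refine tendsto_nhds_unique l1 (l2.congr' ?_)
  have hl : ∀ z : ℂ → ℂ, Continuous z → Continuous fun t => ell (P t) om (z t) := fun z hz => by
    unfold ell
    exact Complex.continuous_re.comp (hz.div (hPc.mul continuous_const)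
      fun t => mul_ne_zero (hPne t) hom0)
  have ev : ∀ {f : ℂ → ℝ}, Continuous f → 0 < f 0 → ∀ᶠ ε : ℝ in 𝓝[>] 0, 0 < f ε := fun hf h =>
    tendsto_ofReal_zero.eventually ((hf.tendsto 0).eventually_const_lt h)
  have hpi : ∀ᶠ ε : ℝ in 𝓝[>] 0, ε < Real.pi := nhdsWithin_le_nhds (eventually_lt_nhds Real.pi_pos)
  filter_upwards [self_mem_nhdsWithin, hpi,
    ev (Complex.continuous_re.comp hPc) (by simpa [hP0] using hop),
    ev (hl (fun _ => κ) continuous_const) (by rwa [hP0]),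
    ev (hl (fun t => P t+om+(a+b+c+d)) (by fun_prop)) (by rwa [hP0]),
    ev (f := fun t => -(P t+om+(a+b+c+d)).re)
      (Complex.continuous_re.comp (by fun_prop : Continuous fun t => P t+om+(a+b+c+d))).neg
      (by rw [hP0]; linarith)] with ε e1 e2 e3 e4 e5 e6
  refine (koorInt_eq_of_not_real hG e3 hom ?_ hκ e4 (n+1) (by linarith) e5 ha hb hc hd).symm
  have hz : op * (starRingEnd ℂ) om = ((op * (starRingEnd ℂ) om).re : ℂ) := by
    apply Complex.ext <;> simp [hr]
  have hz0 : (op * (starRingEnd ℂ) om).re ≠ 0 := by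
    intro h
    rw [h, Complex.ofReal_zero] at hz
    exact mul_ne_zero hop0 (by simpa using hom0) hz
  rw [hP, show op * Complex.exp (Complex.I*ε) * (starRingEnd ℂ) om =
    (op * (starRingEnd ℂ) om) * Complex.exp (Complex.I*ε) by ring, hz, Complex.im_ofReal_mul,
    mul_comm Complex.I, Complex.exp_ofReal_mul_I_im]
  exact mul_ne_zero hz0 (Real.sin_pos_of_pos_of_lt_pi e1 e2).ne'

theorem NBC_eq {G : ℂ → ℂ → ℂ → ℂ}
    (hG : ∀ a b : ℂ, 0 < a.re → 0 < b.re → IsHypGamma a b (G a b)) (n : ℕ) {op om κ a b c d : ℂ}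
    (hop : 0 < op.re) (hom : 0 < om.re) (hκ : κ.re < 0) (hκ' : 0 < ell op om κ)
    (h2 : 0 < ell op om (op+om+(a+b+c+d)))
    (ha : a.re < 0) (hb : b.re < 0) (hc : c.re < 0) (hd : d.re < 0)
    (hab : 0 < ell op om (op+om+(a+b))) (hcd : 0 < ell op om (op+om+(c+d)))
    (hac : 0 < ell op om (op+om+(a+c))) (hbd : 0 < ell op om (op+om+(b+d)))
    (had : 0 < ell op om (op+om+(a+d))) (hbc : 0 < ell op om (op+om+(b+c))) :
    NBC G (n+1) op om ![a, b, c, d] κ =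
      koorConst (n+1) (G op om) op om κ (a+b+c+d) * askeyProd (n+1) (G op om) op om a b c d κ := by
  have hg := hG op om hop hom
  have hσ : (a+b+c+d).re < 0 := by simp; linarith
  set g := G op om with hgdef
  have inv : ∀ {z : ℂ}, z.re < 0 → 0 < ell op om (op+om+z) →
      g (Complex.I*((op+om)/2+z)) = (g (-Complex.I*((op+om)/2+z)))⁻¹ := fun h h' =>
    eq_inv_of_mul_eq_one_right (hg.mul_neg_of_ell hop hom h h')
  have invj : ∀ (j : ℕ) {z : ℂ}, z.re < 0 → 0 < ell op om (op+om+z) →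
      g (Complex.I*((op+om)/2+(j*κ+z))) = (g (-Complex.I*((op+om)/2+(z+j*κ))))⁻¹ := fun j z h h' => by
    rw [inv (nat_mul_add_re_neg j hκ h) (ell_theta j hκ' h'), add_comm z]
  have pair : ∀ {x y : ℂ} (j : ℕ), x.re < 0 → y.re < 0 → 0 < ell op om (op+om+(x+y)) →
      g (Complex.I*((op+om)/2+j*κ+x+y)) = (g (-Complex.I*((op+om)/2+((x+y)+j*κ))))⁻¹ :=
    fun {x y} j hx hy h => by
      rw [← invj j (by simp; linarith) h]
      congr 2
      ring
  have hrefl : ∏ j ∈ Finset.range (n+1),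
      g (Complex.I*((op+om)/2 + (2*((n+1:ℕ):ℂ) - (j:ℂ) - 2)*κ + (a+b+c+d))) =
      (gProd (n+1) g op om κ ((((n+1:ℕ):ℂ)-1)*κ+(a+b+c+d)))⁻¹ := by
    rw [← Finset.prod_range_reflect, gProd, ← Finset.prod_inv_distrib]
    refine Finset.prod_congr rfl fun j hj => ?_
    have hj' : j ≤ n := Nat.lt_succ_iff.mp (Finset.mem_range.mp hj)
    rw [show (((n+1:ℕ):ℂ)-1)*κ+(a+b+c+d)+j*κ = (a+b+c+d)+((n+j:ℕ):ℂ)*κ by push_cast; ring,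
      ← invj (n+j) hσ h2, Nat.add_sub_cancel, Nat.cast_sub hj']
    congr 2
    push_cast
    ring
  have hκj : ∏ j ∈ Finset.range (n+1), g (Complex.I*((op+om)/2 + ((j:ℂ)+1)*κ)) =
      (gProd (n+1) g op om κ κ)⁻¹ := by
    rw [gProd, ← Finset.prod_inv_distrib]
    refine Finset.prod_congr rfl fun j _ => ?_
    rw [← invj j hκ (ell_add_pos hop hom hκ')]
    congr 2
    ring
  have hpairs : ∀ f : Fin 4 × Fin 4 → ℂ,
      ∏ p ∈ Finset.univ.filter (fun p : Fin 4 × Fin 4 => p.1 < p.2), f p =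
        f (0,1) * f (2,3) * (f (0,2) * f (1,3)) * (f (0,3) * f (1,2)) := by
    intro f
    rw [Finset.prod_filter, Fintype.prod_prod_type]
    simp [Fin.prod_univ_four]
    ring
  have hprod : ∀ {x y : ℂ}, x.re < 0 → y.re < 0 → 0 < ell op om (op+om+(x+y)) →
      ∏ j ∈ Finset.range (n+1), g (Complex.I*((op+om)/2+j*κ+x+y)) =
        (gProd (n+1) g op om κ (x+y))⁻¹ := fun hx hy h => by
    rw [gProd, ← Finset.prod_inv_distrib]
    exact Finset.prod_congr rfl fun j _ => pair j hx hy h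
  rw [NBC, Finset.prod_div_distrib, Finset.prod_mul_distrib, Finset.prod_mul_distrib]
  simp only [hpairs, Matrix.cons_val_zero, Matrix.cons_val_one, Matrix.cons_val]
  rw [← hgdef, hrefl, hκj]
  simp only [Finset.prod_mul_distrib]
  rw [hprod ha hb hab, hprod hc hd hcd, hprod ha hc hac, hprod hb hd hbd, hprod ha hd had,
    hprod hb hc hbc, Finset.prod_const, Finset.card_range, inv hκ (ell_add_pos hop hom hκ'),
    koorConst, askeyProd]
  simp only [div_eq_mul_inv, mul_inv, inv_inv, inv_pow]
  ring

theorem ae_linear_notMem {n : ℕ} (L : (Fin n → ℝ) →ₗ[ℝ] ℝ) (hL : L ≠ 0) {S : Set ℝ}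
    (hS : S.Countable) : ∀ᵐ v : Fin n → ℝ, L v ∉ S := by
  have hsurj : Function.Surjective L := LinearMap.surjective hL
  obtain ⟨c, -, h⟩ := L.exists_map_addHaar_eq_smul_addHaar
    (volume : Measure (Fin n → ℝ)) (volume : Measure ℝ) hsurj
  have h1 : ∀ᵐ x ∂((volume : Measure (Fin n → ℝ)).map L), x ∉ S := by
    rw [h]
    exact Measure.ae_smul_measure (hS.ae_notMem volume) _
  exact ae_of_ae_map L.continuous_of_finiteDimensional.aemeasurable h1

theorem IsHypGamma.exists_countable_mul_neg {op om A : ℂ} {g : ℂ → ℂ} (h : IsHypGamma op om g)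
    (hop : 0 < op.re) (hom : 0 < om.re) (hA : A.re < 0) :
    ∃ S : Set ℝ, S.Countable ∧ ∀ x : ℝ, x ∉ S →
      (g (x + Complex.I*((op+om)/2+A)) * g (-x + Complex.I*((op+om)/2+A)))⁻¹ =
        gPair g ((op+om)/2+A) ((op+om)/2+A) x := by
  set F : ℕ × ℕ → ℂ := fun p => Complex.I*((op+om)/2 + p.1*op + p.2*om) + Complex.I*((op+om)/2+A)
  set T : Set ℝ := (fun x : ℝ => (x:ℂ)) ⁻¹' Set.range F
  have hT : T.Countable := (countable_range F).preimage Complex.ofReal_injective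
  have key : ∀ x : ℝ, x ∉ T →
      g (x - Complex.I*((op+om)/2+A)) * g (-x + Complex.I*((op+om)/2+A)) = 1 := fun x hx => by
    have := h.mul_neg (z := x - Complex.I*((op+om)/2+A)) hop hom (by simp; linarith)
      (fun m n hmn => hx ⟨(m, n), by simp only [F]; rw [← hmn]; ring⟩)
    rwa [neg_sub, sub_eq_add_neg (Complex.I*_), add_comm (Complex.I*_)] at this
  refine ⟨T ∪ (fun x : ℝ => -x) ⁻¹' T, hT.union (hT.preimage neg_injective), fun x hx => ?_⟩
  rw [mem_union, not_or] at hx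
  have k1 := key x hx.1
  have k2 := key (-x) hx.2
  push_cast at k2
  rw [neg_neg] at k2
  rw [gPair]
  refine inv_eq_of_mul_eq_one_left ?_
  linear_combination (g (x - Complex.I*((op+om)/2+A)) * g (-x + Complex.I*((op+om)/2+A))) * k2 + k1

theorem exists_countable_long {op om κ : ℂ} {g : ℂ → ℂ} (h : IsHypGamma op om g)
    (hop : 0 < op.re) (hom : 0 < om.re) (hκ : κ.re < 0) :
    ∃ S : Set ℝ, S.Countable ∧ ∀ x : ℝ, x ∉ S →
      (g ((x:ℂ) + Complex.I*(op+om)/2) / g ((x:ℂ) + Complex.I*(κ+(op+om)/2))) *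
        (g (((-x:ℝ):ℂ) + Complex.I*(op+om)/2) / g (((-x:ℝ):ℂ) + Complex.I*(κ+(op+om)/2))) =
        wLong g op om κ x := by
  obtain ⟨S, hS, hx⟩ := h.exists_countable_mul_neg hop hom hκ
  refine ⟨S, hS, fun x hxS => ?_⟩
  have h1 := h.mul_top hop hom (x := x) (by simp)
  rw [wLong, ← hx x hxS, div_mul_div_comm, div_eq_mul_inv, add_comm κ, mul_div_assoc]
  push_cast
  rw [h1]
  ring

theorem exists_countable_short {op om κ : ℂ} {g H : ℂ → ℂ} (h : IsHypGamma op om g)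
    (h' : IsHypGamma op (om/2) H) (hop : 0 < op.re) (hom : 0 < om.re) (hκ : κ.re < 0) :
    ∃ S : Set ℝ, S.Countable ∧ ∀ x : ℝ, x ∉ S →
      (H ((x:ℂ) + Complex.I*(op/2+om/4)) / H ((x:ℂ) + Complex.I*(κ+op/2+om/4))) *
        (H (((-x:ℝ):ℂ) + Complex.I*(op/2+om/4)) / H (((-x:ℝ):ℂ) + Complex.I*(κ+op/2+om/4))) =
        wShort g op om κ (κ-om/2) (-op/2) (-(op+om)/2) x := by
  have hom2 : 0 < (om/2).re := by simpa using hom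
  obtain ⟨S, hS, hx⟩ := h'.exists_countable_mul_neg hop hom2 hκ
  refine ⟨S, hS, fun x hxS => ?_⟩
  have h1 := h'.mul_top hop hom2 (x := x) (by simp)
  have hre : (om/2).re = om.re/2 := by simp
  have d1 := h.dup (z := x - Complex.I*((op+om/2)/2+κ)) h' hop hom (by simp; linarith)
  have d2 := h.dup (z := -x - Complex.I*((op+om/2)/2+κ)) h' hop hom (by simp; linarith)
  have h2 := hx x hxS
  rw [gPair, d1, d2] at h2
  have m1 := h.mul_neg_strip (z := x) (by simp; linarith)
  have m2 := h.mul_neg_strip (z := x + Complex.I*om/2) (by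
    simp [abs_lt]; constructor <;> linarith)
  have sh := h.swap.shift (z := x - Complex.I*om/2) hom hop (by simp; linarith)
  rw [show (x:ℂ) - Complex.I*om/2 + Complex.I*om = x + Complex.I*om/2 by ring,
    sub_add_cancel] at sh
  rw [sh] at m2
  rw [div_mul_div_comm, div_eq_mul_inv, show op/2+om/4 = (op+om/2)/2 by ring,
    show κ+op/2+om/4 = (op+om/2)/2+κ by ring]
  push_cast
  rw [h1, h2, wShort]
  simp only [gPair]
  rw [show (x:ℂ) - Complex.I*((op+om)/2+-(op+om)/2) = x by ring,
    show -(x:ℂ) - Complex.I*((op+om)/2+-(op+om)/2) = -x by ring, m1,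
    show (x:ℂ) - Complex.I*((op+om)/2+-op/2) = x - Complex.I*om/2 by ring,
    show -(x:ℂ) - Complex.I*((op+om)/2+-op/2) = -(x + Complex.I*om/2) by ring,
    show 2*(Real.pi:ℂ)*x/op = 2*(Real.pi*x/op) by ring, Complex.sinh_two_mul,
    show (Real.pi:ℂ)*x/(om/2) = 2*Real.pi*x/om by rw [div_div_eq_mul_div]; ring,
    show (x:ℂ) - Complex.I*((op+om/2)/2+κ) - Complex.I*om/4 = x - Complex.I*((op+om)/2+κ) by ring,
    show -(x:ℂ) - Complex.I*((op+om/2)/2+κ) - Complex.I*om/4 = -x - Complex.I*((op+om)/2+κ) by ring,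
    show (x:ℂ) - Complex.I*((op+om/2)/2+κ) + Complex.I*om/4 =
      x - Complex.I*((op+om)/2+(κ-om/2)) by ring,
    show -(x:ℂ) - Complex.I*((op+om/2)/2+κ) + Complex.I*om/4 =
      -x - Complex.I*((op+om)/2+(κ-om/2)) by ring]
  linear_combination (-4 * Complex.sinh (Real.pi*x/op) * Complex.sinh (2*Real.pi*x/om) *
    (g (x - Complex.I*((op+om)/2+κ)) * g (-x - Complex.I*((op+om)/2+κ)) *
      (g (x - Complex.I*((op+om)/2+(κ-om/2))) * g (-x - Complex.I*((op+om)/2+(κ-om/2)))))) * m2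

theorem bcLong_eq_pairProd {n : ℕ} {f w : ℝ → ℂ} (v : Fin n → ℝ)
    (h : ∀ i j, i < j → f (v i + v j) * f (-(v i + v j)) = w (v i + v j) ∧
      f (v i - v j) * f (-(v i - v j)) = w (v i - v j)) :
    bcLong f v = pairProd (fun x y => w (x+y) * w (x-y)) v := by
  rw [bcLong, Finset.prod_filter, Fintype.prod_prod_type, pairProd]
  refine Finset.prod_congr rfl fun i _ => ?_
  rw [← Finset.prod_filter, show Finset.univ.filter (fun j => i < j) = Finset.Ioi i by ext; simp]
  refine Finset.prod_congr rfl fun j hj => ?_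
  obtain ⟨h1, h2⟩ := h i j (Finset.mem_Ioi.mp hj)
  rw [h1, mul_assoc, ← neg_sub (v i) (v j), h2]

theorem ae_bc_eq_rootProd {n : ℕ} {f f' w w' : ℝ → ℂ} {S S' : Set ℝ} (hS : S.Countable)
    (hS' : S'.Countable) (h : ∀ x ∉ S, f x * f (-x) = w x)
    (h' : ∀ x ∉ S', f' x * f' (-x) = w' x) :
    (fun v : Fin n → ℝ => bcShort f v * bcLong f' v) =ᵐ[volume] rootProd w w' w' := by
  have coord : ∀ i : Fin n, (LinearMap.proj i : (Fin n → ℝ) →ₗ[ℝ] ℝ) ≠ 0 := fun i h0 => by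
    have := LinearMap.congr_fun h0 (Pi.single i 1)
    simp at this
  have hs : ∀ i j : Fin n, i < j →
      ((LinearMap.proj i : (Fin n → ℝ) →ₗ[ℝ] ℝ) + LinearMap.proj j) ≠ 0 := fun i j hij h0 => by
    have : (Pi.single i (1:ℝ) : Fin n → ℝ) i + (Pi.single i (1:ℝ) : Fin n → ℝ) j = 0 :=
      LinearMap.congr_fun h0 (Pi.single i 1)
    rw [Pi.single_eq_same, Pi.single_eq_of_ne hij.ne'] at this
    norm_num at this
  have hd : ∀ i j : Fin n, i < j →
      ((LinearMap.proj i : (Fin n → ℝ) →ₗ[ℝ] ℝ) - LinearMap.proj j) ≠ 0 := fun i j hij h0 => by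
    have : (Pi.single i (1:ℝ) : Fin n → ℝ) i - (Pi.single i (1:ℝ) : Fin n → ℝ) j = 0 :=
      LinearMap.congr_fun h0 (Pi.single i 1)
    rw [Pi.single_eq_same, Pi.single_eq_of_ne hij.ne'] at this
    norm_num at this
  have a1 : ∀ᵐ v : Fin n → ℝ, ∀ i, v i ∉ S := ae_all_iff.mpr fun i =>
    ae_linear_notMem _ (coord i) hS
  have a2 : ∀ᵐ v : Fin n → ℝ, ∀ i j, i < j → v i + v j ∉ S' ∧ v i - v j ∉ S' :=
    ae_all_iff.mpr fun i => ae_all_iff.mpr fun j => by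
      by_cases hij : i < j
      · filter_upwards [ae_linear_notMem _ (hs i j hij) hS', ae_linear_notMem _ (hd i j hij) hS']
          with v h1 h2 _ using ⟨h1, h2⟩
      · exact Eventually.of_forall fun v h0 => absurd h0 hij
  filter_upwards [a1, a2] with v h1 h2
  rw [bcLong_eq_pairProd v fun i j hij => ⟨h' _ (h2 i j hij).1, h' _ (h2 i j hij).2⟩, rootProd,
    bcShort, Finset.prod_congr rfl fun i _ => h (v i) (h1 i)]

theorem ell_pos_of_eq {op om z : ℂ} (hop : 0 < op.re) (hom : 0 < om.re)
    (h : ∃ w : ℂ, 0 < w.re ∧ z = op*om*w) : 0 < ell op om z := by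
  obtain ⟨w, hw, rfl⟩ := h
  rwa [ell, mul_div_cancel_left₀ _ (mul_ne_zero (ne_zero_of_re_pos hop) (ne_zero_of_re_pos hom))]

end

/-- **Generalized Cherednik–Macdonald identity for `Σ` of type `C_n`, case (ii)**:
the integral equals `N_BC(ω₊,ω₋; γ = (k_l, k_l-ω₋/2, -ω₊/2, -ω), κ = k_s)`. -/
theorem generalized_CM_Cn_case_ii (n : ℕ) (hn : 2 ≤ n)
    (G : ℂ → ℂ → ℂ → ℂ)
    (hG : ∀ a b : ℂ, 0 < a.re → 0 < b.re → IsHypGamma a b (G a b))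
    (op om ks kl : ℂ) (hop : 0 < op.re) (hom : 0 < om.re) (him : (op*om).im < 0)
    (hks1 : ks.re < 0) (hks2 : ∃ w : ℂ, 0 < w.re ∧ ks = op*om*w)
    (hkl1 : kl.re < 0) (hkl2 : ∃ w : ℂ, 0 < w.re ∧ kl = op*om*w) :
    Integrable (fun v : Fin n → ℝ =>
      bcShort (fun x => G op (om/2) ((x:ℂ) + Complex.I*(op/2+om/4)) /
          G op (om/2) ((x:ℂ) + Complex.I*(kl+op/2+om/4))) v *
        bcLong (fun x => G op om ((x:ℂ) + Complex.I*(op+om)/2) /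
          G op om ((x:ℂ) + Complex.I*(ks+(op+om)/2))) v) ∧
    ∫ v : Fin n → ℝ,
        (bcShort (fun x => G op (om/2) ((x:ℂ) + Complex.I*(op/2+om/4)) /
            G op (om/2) ((x:ℂ) + Complex.I*(kl+op/2+om/4))) v *
          bcLong (fun x => G op om ((x:ℂ) + Complex.I*(op+om)/2) /
            G op om ((x:ℂ) + Complex.I*(ks+(op+om)/2))) v) =
      NBC G n op om ![kl, kl-om/2, -op/2, -(op+om)/2] ks := by
  have hg := hG op om hop hom
  have hg' := hG op (om/2) hop (by simpa using hom)
  have hks := ell_pos_of_eq hop hom hks2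
  have hkl := ell_pos_of_eq hop hom hkl2
  have hlop : 0 < ell op om op := by rw [ell_op hop]; exact inv_re_pos hom
  have hlom : 0 < ell op om om := by rw [ell_om hom]; exact inv_re_pos hop
  obtain ⟨S, hS, hSx⟩ := exists_countable_short hg hg' hop hom hkl1
  obtain ⟨S', hS', hSx'⟩ := exists_countable_long hg hop hom hks1
  have hae := ae_bc_eq_rootProd (n := n) hS hS' hSx hSx'
  have hsum : op+om+(kl+(kl-om/2)+-op/2+-(op+om)/2) = kl+kl := by ring
  have hθ : 0 < ell op om (op+om+(kl+(kl-om/2)+-op/2+-(op+om)/2)) := by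
    rw [hsum, ell_add]; linarith
  have hθ' : (op+om+(kl+(kl-om/2)+-op/2+-(op+om)/2)).re < 0 := by
    rw [hsum]; simp; linarith
  have hb : (kl-om/2).re < 0 := by simp; linarith
  have hc : (-op/2).re < 0 := by simp; linarith
  have hd : (-(op+om)/2).re < 0 := by simp; linarith
  refine ⟨(integrable_koorFun hG n hop hom hkl1 hb hc hd hθ hks1 hks).congr hae.symm, ?_⟩
  rw [integral_congr_ae hae]
  obtain ⟨m, rfl⟩ : ∃ m, n = m+1 := ⟨n-1, by omega⟩
  refine (koorInt_eq hG m hop hom (Or.inr him.ne) hks1 hks hθ' hθ hkl1 hb hc hd).trans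
    (NBC_eq hG m hop hom hks1 hks hθ hkl1 hb hc hd ?_ ?_ ?_ ?_ ?_ ?_).symm
  · rw [show op+om+(kl+(kl-om/2)) = op+om/2+kl+kl by ring]
    simp only [ell_add, ell_half]; linarith
  · rw [show op+om+(-op/2+-(op+om)/2) = om/2 by ring, ell_half]; linarith
  · rw [show op+om+(kl+-op/2) = op/2+om+kl by ring]
    simp only [ell_add, ell_half]; linarith
  · rw [show op+om+(kl-om/2+-(op+om)/2) = op/2+kl by ring]
    simp only [ell_add, ell_half]; linarith
  · rw [show op+om+(kl+-(op+om)/2) = op/2+om/2+kl by ring]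
    simp only [ell_add, ell_half]; linarith
  · rw [show op+om+(kl-om/2+-op/2) = op/2+om/2+kl by ring]
    simp only [ell_add, ell_half]; linarith

end
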